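/- arXiv:1704.03771 — 2 statements merged into one kernel-verified Lean document; each statement's English description precedes it below -/
import Mathlib

section
/- Let a Beurling generalized number system be given. Suppose there are real numbers 0 < t_1 < t_2 < ⋯ < t_k, y_1, …, y_k, and b_1, …, b_k such that ∫_2^∞ |Π(x) − (x/log x)(1 + Σ_{j=1}^k b_j cos(t_j log x + y_j))| x^{−2} dx < ∞. If b_j (1 + t_j²)^{1/2} cos(y_j + arctan t_j) < 2 for every j = 1, …, k, then there exists a > 0 such that N(x)/x → a as x → ∞. -/
open Filter MeasureTheory Set Topology
open scoped Classical

/-- Value `n(α) = ∏ p_k^{α(k)}` of a generalized integer `α`. -/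
noncomputable def nval (p : ℕ → ℝ) (α : ℕ →₀ ℕ) : ℝ := α.prod fun k e => p k ^ e

/-- Counting function `N(x)` of the generalized integers. -/
noncomputable def Ncount (p : ℕ → ℝ) (x : ℝ) : ℕ := Nat.card {α : ℕ →₀ ℕ // nval p α ≤ x}

/-- Riemann prime counting function `Π(x) = Σ_{j ≥ 1} π(x^{1/j})/j`. -/
noncomputable def PiCount (p : ℕ → ℝ) (x : ℝ) : ℝ :=
  ∑' j : ℕ, (Nat.card {k : ℕ // p k ≤ x ^ ((1 : ℝ) / (j + 1))} : ℝ) / (j + 1)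

/-- `log ζ(s) = ∫_1^∞ x^{-s} dΠ(x)`, the Lebesgue–Stieltjes integral against the purely
atomic measure `dΠ`, which carries mass `1/j` at each point `p_k^j`. -/
noncomputable def logZeta (p : ℕ → ℝ) (s : ℂ) : ℂ :=
  ∑' (j : ℕ) (k : ℕ), ((p k : ℂ) ^ (-s * (j + 1))) / (j + 1)

/-- The Beurling zeta function `ζ(s) = exp(∫_1^∞ x^{-s} dΠ(x))`. -/
noncomputable def zetaB (p : ℕ → ℝ) (s : ℂ) : ℂ := Complex.exp (logZeta p s)

/-- Beurling Möbius function. -/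
noncomputable def muB (α : ℕ →₀ ℕ) : ℝ :=
  if ∀ k, α k ≤ 1 then (-1 : ℝ) ^ α.support.card else 0

/-- `m(x) = Σ_{n(α) ≤ x} μ(α)/n(α)`. -/
noncomputable def mB (p : ℕ → ℝ) (x : ℝ) : ℝ :=
  ∑' α : {α : ℕ →₀ ℕ // nval p α ≤ x}, muB α / nval p α

/-- Beurling Liouville function. -/
noncomputable def lambdaB (α : ℕ →₀ ℕ) : ℝ := (-1 : ℝ) ^ (α.sum fun _ e => e)

/-- `ℓ(x) = Σ_{n(α) ≤ x} λ(α)/n(α)`. -/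
noncomputable def ellB (p : ℕ → ℝ) (x : ℝ) : ℝ :=
  ∑' α : {α : ℕ →₀ ℕ // nval p α ≤ x}, lambdaB α / nval p α

/-- An analytic function `G` on `{Re s > 1}` has `A_loc`-boundary behavior on `1 + iU`:
for every compact `K ⊂ U` there is `g ∈ L¹(ℝ)` with `G(σ + it) → ∫ g(x) e^{-itx} dx`
as `σ → 1⁺`, uniformly for `t ∈ K`. -/
def ALocBoundary (G : ℂ → ℂ) (U : Set ℝ) : Prop :=
  ∀ K : Set ℝ, K ⊆ U → IsCompact K → ∃ g : ℝ → ℂ, Integrable g ∧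
    TendstoUniformlyOn (fun σ : ℝ => fun t : ℝ => G (σ + t * Complex.I))
      (fun t : ℝ => ∫ x : ℝ, g x * Complex.exp (-(t * x) * Complex.I)) (𝓝[>] 1) K

/-- An analytic function `G` on `{Re s > 1}` has local pseudofunction boundary behavior on
`1 + iU`: for every smooth compactly supported `φ` with `supp φ ⊂ U` and every `x`, the limit
`g_φ(x) = lim_{σ→1⁺} ∫ G(σ + it) φ(t) e^{-ixt} dt` exists, and `g_φ(x) → 0` as `|x| → ∞`. -/
def LocalPseudofunctionBoundary (G : ℂ → ℂ) (U : Set ℝ) : Prop :=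
  ∀ φ : ℝ → ℂ, ContDiff ℝ (⊤ : ℕ∞) φ → HasCompactSupport φ → tsupport φ ⊆ U →
    ∃ gφ : ℝ → ℂ,
      (∀ x : ℝ, Tendsto (fun σ : ℝ => ∫ t : ℝ, G (σ + t * Complex.I) * φ t *
          Complex.exp (-(x * t) * Complex.I)) (𝓝[>] 1) (𝓝 (gφ x))) ∧
      Tendsto gφ (cocompact ℝ) (𝓝 0)

/-- `Π₀(x) = ∫_1^x (1 - 1/u)/log u du`. -/
noncomputable def Pi0 (x : ℝ) : ℝ := ∫ u in (1:ℝ)..x, (1 - 1/u) / Real.log u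


noncomputable def fk (x : ℝ) : ℝ := Real.sinc (x / 2) ^ 2

lemma fk_cont : Continuous fk := by
  unfold fk; exact (Real.continuous_sinc.comp (by fun_prop)).pow 2

lemma fk_nonneg (x : ℝ) : 0 ≤ fk x := sq_nonneg _

lemma fk_le_one (x : ℝ) : fk x ≤ 1 := by
  unfold fk
  have := Real.abs_sinc_le_one (x/2)
  rw [← sq_abs]; exact pow_le_one₀ (abs_nonneg _) this

lemma fk_eq {x : ℝ} (hx : x ≠ 0) : fk x = 2 * (1 - Real.cos x) / x ^ 2 := by
  unfold fk
  rw [Real.sinc_of_ne_zero (by positivity)]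
  have : Real.cos x = 1 - 2 * Real.sin (x/2) ^ 2 := by
    have h1 := Real.cos_two_mul (x/2)
    have h2 := Real.sin_sq_add_cos_sq (x/2)
    rw [show 2 * (x/2) = x by ring] at h1
    linarith
  rw [this]; field_simp; ring

lemma fk_le (x : ℝ) : fk x ≤ 8 * (1 + x ^ 2)⁻¹ := by
  by_cases h : x ^ 2 ≤ 7
  · refine (fk_le_one x).trans ?_
    rw [← div_eq_mul_inv, le_div_iff₀ (by positivity)]; linarith
  · have hx : x ≠ 0 := by rintro rfl; norm_num at h
    rw [fk_eq hx, ← div_eq_mul_inv, div_le_div_iff₀ (by positivity) (by positivity)]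
    have := Real.neg_one_le_cos x
    nlinarith

lemma fk_integrable : Integrable fk :=
  (integrable_inv_one_add_sq.const_mul 8).mono' fk_cont.aestronglyMeasurable
    (Eventually.of_forall fun x => by
      rw [Real.norm_of_nonneg (fk_nonneg x)]; exact fk_le x)

lemma fk_integral_pos : 0 < ∫ x, fk x := by
  rw [integral_pos_iff_support_of_nonneg fk_nonneg fk_integrable]
  refine IsOpen.measure_pos _ (fk_cont.isOpen_support) ⟨0, ?_⟩
  simp [fk]

noncomputable def tri (R t : ℝ) : ℝ := max 0 (1 - |t| / R)

lemma tri_cont (R : ℝ) : Continuous (tri R) := by unfold tri; fun_prop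

lemma tri_zero {R t : ℝ} (hR : 0 < R) (ht : R ≤ |t|) : tri R t = 0 := by
  unfold tri; rw [max_eq_left]; rw [sub_nonpos, le_div_iff₀ hR]; linarith

lemma tri_nonneg (R t : ℝ) : 0 ≤ tri R t := le_max_left _ _

lemma tri_le_one {R : ℝ} (hR : 0 < R) (t : ℝ) : tri R t ≤ 1 := by
  unfold tri; apply max_le (by norm_num); have : 0 ≤ |t|/R := by positivity
  linarith

lemma tri_integrable {R : ℝ} (hR : 0 < R) : Integrable (tri R) := by
  apply (tri_cont R).integrable_of_hasCompactSupport
  apply HasCompactSupport.intro (isCompact_Icc (a := -R) (b := R))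
  intro x hx
  apply tri_zero hR
  by_contra! h
  exact hx ⟨(abs_lt.1 h).1.le, (abs_lt.1 h).2.le⟩

lemma fejer_formula {R : ℝ} (hR : 0 < R) {x : ℝ} (hx : x ≠ 0) :
    ∫ t : ℝ, (tri R t : ℂ) * Complex.exp (Complex.I * t * x) = ((R * fk (R * x) : ℝ) : ℂ) := by
  have hRc : (R : ℂ) ≠ 0 := by exact_mod_cast hR.ne'
  have hxc : (x : ℂ) ≠ 0 := by exact_mod_cast hx
  set F : ℝ → ℂ := fun t => (tri R t : ℂ) * Complex.exp (Complex.I * t * x) with hF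
  have hc : Continuous F := by
    have := tri_cont R
    fun_prop
  have h1 : ∫ t : ℝ, F t = ∫ t in (-R)..R, F t := by
    rw [intervalIntegral.integral_of_le (by linarith), setIntegral_eq_integral_of_forall_compl_eq_zero]
    intro t ht
    have : tri R t = 0 := by
      apply tri_zero hR
      by_contra! h
      exact ht ⟨(abs_lt.1 h).1, (abs_lt.1 h).2.le⟩
    simp [hF, this]
  rw [h1, ← intervalIntegral.integral_add_adjacent_intervals (b := 0) (hc.intervalIntegrable _ _)
    (hc.intervalIntegrable _ _)]
  have hexp : ∀ t : ℝ, HasDerivAt (fun t : ℝ => Complex.exp (Complex.I * t * x))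
      (Complex.exp (Complex.I * t * x) * (Complex.I * x)) t := by
    intro t
    have : HasDerivAt (fun t : ℝ => Complex.I * (t:ℂ) * x) (Complex.I * x) t := by
      simpa using ((Complex.ofRealCLM.hasDerivAt (x := t)).const_mul Complex.I).mul_const (x:ℂ)
    exact this.cexp
  have e1 : ∫ t in (0:ℝ)..R, F t =
      (fun t : ℝ => Complex.exp (Complex.I * t * x) *
        ((1 - t / R) / (Complex.I * x) - 1 / (R * x ^ 2))) R -
      (fun t : ℝ => Complex.exp (Complex.I * t * x) *
        ((1 - t / R) / (Complex.I * x) - 1 / (R * x ^ 2))) 0 := by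
    refine intervalIntegral.integral_eq_sub_of_hasDerivAt (f := fun t : ℝ => Complex.exp (Complex.I * t * x) *
        ((1 - t / R) / (Complex.I * x) - 1 / (R * x ^ 2))) ?_ (hc.intervalIntegrable _ _)
    intro t ht
    rw [uIcc_of_le hR.le] at ht
    have hd : HasDerivAt (fun t : ℝ => ((1 - (t:ℂ) / R) / (Complex.I * x) - 1 / (R * x ^ 2) : ℂ))
        (-(1 / R) / (Complex.I * x)) t := by
      simpa using ((((Complex.ofRealCLM.hasDerivAt (x := t)).div_const (R:ℂ)).const_sub 1).div_const
        (Complex.I * x)).sub_const (1 / (R * x ^ 2) : ℂ)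
    refine ((hexp t).mul hd).congr_deriv ?_
    have : tri R t = 1 - t / R := by
      unfold tri; rw [abs_of_nonneg ht.1, max_eq_right]
      rw [sub_nonneg, div_le_one hR]; exact ht.2
    simp only [hF, this]
    push_cast
    field_simp
    ring_nf
    rw [Complex.I_sq]
    ring
  have e2 : ∫ t in (-R)..(0:ℝ), F t =
      (fun t : ℝ => Complex.exp (Complex.I * t * x) *
        ((1 + t / R) / (Complex.I * x) + 1 / (R * x ^ 2))) 0 -
      (fun t : ℝ => Complex.exp (Complex.I * t * x) *
        ((1 + t / R) / (Complex.I * x) + 1 / (R * x ^ 2))) (-R) := by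
    refine intervalIntegral.integral_eq_sub_of_hasDerivAt (f := fun t : ℝ => Complex.exp (Complex.I * t * x) *
        ((1 + t / R) / (Complex.I * x) + 1 / (R * x ^ 2))) ?_ (hc.intervalIntegrable _ _)
    intro t ht
    rw [uIcc_of_le (by linarith)] at ht
    have hd : HasDerivAt (fun t : ℝ => ((1 + (t:ℂ) / R) / (Complex.I * x) + 1 / (R * x ^ 2) : ℂ))
        ((1 / R) / (Complex.I * x)) t := by
      simpa using ((((Complex.ofRealCLM.hasDerivAt (x := t)).div_const (R:ℂ)).const_add 1).div_const
        (Complex.I * x)).add_const (1 / (R * x ^ 2) : ℂ)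
    refine ((hexp t).mul hd).congr_deriv ?_
    have : tri R t = 1 + t / R := by
      unfold tri; rw [abs_of_nonpos ht.2, max_eq_right]
      · ring
      rw [sub_nonneg, div_le_one hR]; linarith [ht.1]
    simp only [hF, this]
    push_cast
    field_simp
    ring_nf
    rw [Complex.I_sq]
    ring
  rw [e1, e2, fk_eq (by positivity)]
  have hcos : (Real.cos (R * x) : ℂ) = (Complex.exp (Complex.I * R * x) +
      Complex.exp (-(Complex.I * R * x))) / 2 := by
    rw [Complex.ofReal_cos, Complex.cos]; push_cast; congr 3 <;> ring_nf
  push_cast [-Complex.ofReal_cos]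
  rw [hcos]
  have a1 : Complex.I * (-(R:ℂ)) * x = -(Complex.I * R * x) := by ring
  rw [a1]
  simp
  field_simp
  ring


lemma smoothing_delta (f : ℝ → ℝ) (δ : ℝ)
    (hf : IntegrableOn (fun u => f u * Real.exp (-δ * u)) (Ioi 0))
    {R : ℝ} (hR : 0 < R) (v : ℝ) :
    Integrable (fun t : ℝ => (tri R t : ℂ) * Complex.exp (Complex.I * t * v) *
        ∫ u in Ioi (0:ℝ), (f u : ℂ) * Complex.exp (-(δ + t * Complex.I) * u)) ∧
    ((∫ u in Ioi (0:ℝ), f u * Real.exp (-δ * u) * (R * fk (R * (v - u))) : ℝ) : ℂ) =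
      ∫ t : ℝ, (tri R t : ℂ) * Complex.exp (Complex.I * t * v) *
        ∫ u in Ioi (0:ℝ), (f u : ℂ) * Complex.exp (-(δ + t * Complex.I) * u) := by
  set μ := (volume : Measure ℝ).restrict (Ioi 0) with hμ
  set F : ℝ → ℝ → ℂ := fun u t => ((f u * Real.exp (-δ * u) : ℝ) : ℂ) *
    ((tri R t : ℂ)) * Complex.exp (Complex.I * t * (v - u)) with hF
  have hintg : Integrable (Function.uncurry F) (μ.prod volume) := by
    have h1 : Integrable (fun p : ℝ × ℝ => ((f p.1 * Real.exp (-δ * p.1) : ℝ) : ℂ) *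
        ((tri R p.2 : ℝ) : ℂ)) (μ.prod volume) := by
      have a1 : Integrable (fun u => ((f u * Real.exp (-δ * u) : ℝ) : ℂ)) μ := hf.ofReal
      have a2 : Integrable (fun t => ((tri R t : ℝ) : ℂ)) := (tri_integrable hR).ofReal
      exact a1.mul_prod a2
    refine (h1.mul_bdd (c := 1) (g := fun p : ℝ × ℝ => Complex.exp (Complex.I * p.2 * (v - p.1))) ?_ ?_)
    · apply Continuous.aestronglyMeasurable; fun_prop
    · refine Eventually.of_forall fun p => ?_
      have : Complex.I * p.2 * (v - p.1) = ((p.2 * (v - p.1) : ℝ) : ℂ) * Complex.I := by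
        push_cast; ring
      rw [this, Complex.norm_exp_ofReal_mul_I]
  have key : ∀ t : ℝ, ∫ u, F u t ∂μ = (tri R t : ℂ) * Complex.exp (Complex.I * t * v) *
        ∫ u in Ioi (0:ℝ), (f u : ℂ) * Complex.exp (-(δ + t * Complex.I) * u) := by
    intro t
    rw [← integral_const_mul]
    congr 1; ext u
    simp only [hF]
    push_cast
    rw [show Complex.I * (t:ℂ) * (v - u) = Complex.I * t * v + -(t * Complex.I * u) by ring,
      show -((δ:ℂ) + t * Complex.I) * u = -δ * u + -(t * Complex.I * u) by ring,
      Complex.exp_add, Complex.exp_add]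
    ring
  constructor
  · have := hintg.integral_prod_right
    refine this.congr (Eventually.of_forall fun t => ?_)
    exact key t
  · refine Eq.trans ?_ (integral_congr_ae (Eventually.of_forall key))
    rw [← integral_integral_swap hintg, ← integral_complex_ofReal]
    apply integral_congr_ae
    have hne : ∀ᵐ u ∂μ, u ≠ v := by
      apply ae_restrict_of_ae
      exact (measure_singleton (μ := volume) v : volume {v} = 0) |> compl_mem_ae_iff.2
    filter_upwards [hne] with u hu
    have := fejer_formula hR (x := v - u) (sub_ne_zero.2 (Ne.symm hu))
    simp only [hF]
    simp only [mul_assoc, ← Complex.ofReal_sub] at this ⊢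
    rw [integral_const_mul, this]
    push_cast; ring

lemma smoothing (M V : ℝ → ℝ) (hM0 : ∀ u, 0 ≤ M u) 
    (hMi : ∀ δ > 0, IntegrableOn (fun u => M u * Real.exp (-δ * u)) (Ioi 0))
    (hVm : Measurable V) (B : ℝ) (hVB : ∀ u, |V u| ≤ B)
    (G : ℂ → ℂ) (hG : ∀ z : ℂ, 0 < z.re →
      G z = ∫ u in Ioi (0:ℝ), ((M u - V u : ℝ) : ℂ) * Complex.exp (-z * u))
    (G0 : ℝ → ℂ) (hlim : ∀ᵐ t : ℝ, Tendsto (fun δ : ℝ => G (δ + t * Complex.I)) (𝓝[>] 0) (𝓝 (G0 t)))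
    {R : ℝ} (hR : 0 < R)
    (hdom : ∃ D : ℝ → ℝ, Integrable D ∧ ∃ δ0 > 0, ∀ᵐ t : ℝ, |t| ≤ R → ∀ δ : ℝ, 0 < δ → δ < δ0 →
      ‖G (δ + t * Complex.I)‖ ≤ D t) (v : ℝ) :
    IntegrableOn (fun u => M u * (R * fk (R * (v - u)))) (Ioi 0) ∧
    ((∫ u in Ioi (0:ℝ), M u * (R * fk (R * (v - u))) : ℝ) : ℂ) =
      ((∫ u in Ioi (0:ℝ), V u * (R * fk (R * (v - u))) : ℝ) : ℂ) +
      ∫ t : ℝ, (tri R t : ℂ) * Complex.exp (Complex.I * t * v) * G0 t := by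
  obtain ⟨D, hD, δ0, hδ0, hDb⟩ := hdom
  have hkc : Continuous (fun u => R * fk (R * (v - u))) := by
    have := fk_cont; fun_prop
  have hki : Integrable (fun u => R * fk (R * (v - u))) := by
    apply Integrable.const_mul
    have := (fk_integrable.comp_mul_left' hR.ne')
    exact this.comp_sub_left v
  have hk0 : ∀ u, 0 ≤ R * fk (R * (v - u)) := fun u => mul_nonneg hR.le (fk_nonneg _)
  have hexpi : ∀ δ > 0, IntegrableOn (fun u : ℝ => Real.exp (-δ * u)) (Ioi 0) := fun δ hδ => by
    simpa using integrableOn_exp_mul_Ioi (neg_lt_zero.2 hδ) 0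
  have hVi : ∀ δ > 0, IntegrableOn (fun u => V u * Real.exp (-δ * u)) (Ioi 0) := by
    intro δ hδ
    exact (hexpi δ hδ).bdd_mul (c := B) hVm.aestronglyMeasurable (Eventually.of_forall hVB)
  set d : ℕ → ℝ := fun n => δ0 / (n + 2) with hd
  have hdpos : ∀ n, 0 < d n := fun n => by positivity
  have hdlt : ∀ n, d n < δ0 := fun n => by
    rw [hd]; simp only
    rw [div_lt_iff₀ (by positivity)]
    have : (0:ℝ) ≤ n := n.cast_nonneg
    nlinarith
  have hdt : Tendsto d atTop (𝓝 0) := by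
    apply Tendsto.div_atTop tendsto_const_nhds
    exact tendsto_atTop_add_const_right _ _ tendsto_natCast_atTop_atTop
  have hdt' : Tendsto d atTop (𝓝[>] 0) :=
    tendsto_nhdsWithin_iff.2 ⟨hdt, Eventually.of_forall hdpos⟩
  have hexpt : ∀ u : ℝ, Tendsto (fun n => Real.exp (-d n * u)) atTop (𝓝 1) := by
    intro u
    have : Tendsto (fun n => Real.exp (-d n * u)) atTop (𝓝 (Real.exp (-0 * u))) :=
      (Real.continuous_exp.tendsto _).comp ((hdt.neg).mul_const u)
    simpa using this
  have hexp1 : ∀ u ∈ Ioi (0:ℝ), ∀ n, Real.exp (-d n * u) ≤ 1 := by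
    intro u hu n
    rw [Real.exp_le_one_iff]
    have := mul_pos (hdpos n) hu
    linarith
  -- right-hand side limit
  have hrhs : Tendsto (fun n => ∫ t : ℝ, (tri R t : ℂ) * Complex.exp (Complex.I * t * v) *
      G (d n + t * Complex.I)) atTop (𝓝 (∫ t : ℝ, (tri R t : ℂ) * Complex.exp (Complex.I * t * v) * G0 t)) := by
    apply tendsto_integral_of_dominated_convergence (fun t => |D t|) _ hD.abs
    · intro n
      filter_upwards [hDb] with t ht
      have h1 : ‖Complex.exp (Complex.I * t * v)‖ = 1 := by
        rw [show Complex.I * t * v = ((t * v : ℝ) : ℂ) * Complex.I by push_cast; ring,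
          Complex.norm_exp_ofReal_mul_I]
      rw [norm_mul, norm_mul, h1, mul_one, Complex.norm_real, Real.norm_of_nonneg (tri_nonneg R t)]
      by_cases h : |t| ≤ R
      · calc _ ≤ 1 * ‖G (d n + t * Complex.I)‖ :=
              mul_le_mul_of_nonneg_right (tri_le_one hR t) (norm_nonneg _)
          _ ≤ |D t| := by rw [one_mul]; exact (ht h _ (hdpos n) (hdlt n)).trans (le_abs_self _)
      · rw [tri_zero hR (le_of_not_ge h)]; simp
    · filter_upwards [hlim] with t ht
      exact (ht.comp hdt').const_mul _
    · intro n
      have hfi : IntegrableOn (fun u => (M u - V u) * Real.exp (-d n * u)) (Ioi 0) := by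
        simp only [sub_mul]; exact (hMi _ (hdpos n)).sub (hVi _ (hdpos n))
      have := (smoothing_delta (fun u => M u - V u) (d n) hfi hR v).1.aestronglyMeasurable
      refine this.congr (Eventually.of_forall fun t => ?_)
      simp only
      rw [hG _ (by simpa using hdpos n)]
  have hMki : ∀ n, IntegrableOn (fun u => M u * Real.exp (-d n * u) * (R * fk (R * (v - u)))) (Ioi 0) := by
    intro n
    refine (hMi _ (hdpos n)).mul_bdd (c := R) hkc.aestronglyMeasurable (Eventually.of_forall fun u => ?_)
    rw [Real.norm_of_nonneg (hk0 u)]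
    have := fk_le_one (R * (v - u))
    nlinarith
  have hVki : ∀ n, IntegrableOn (fun u => V u * Real.exp (-d n * u) * (R * fk (R * (v - u)))) (Ioi 0) := by
    intro n
    refine (hVi _ (hdpos n)).mul_bdd (c := R) hkc.aestronglyMeasurable (Eventually.of_forall fun u => ?_)
    rw [Real.norm_of_nonneg (hk0 u)]
    have := fk_le_one (R * (v - u))
    nlinarith
  have hVl : Tendsto (fun n => ∫ u in Ioi (0:ℝ), V u * Real.exp (-d n * u) * (R * fk (R * (v - u)))) atTop
      (𝓝 (∫ u in Ioi (0:ℝ), V u * (R * fk (R * (v - u))))) := by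
    apply tendsto_integral_of_dominated_convergence (fun u => B * (R * fk (R * (v - u))))
    · intro n; exact (hVki n).aestronglyMeasurable
    · exact (hki.const_mul B).integrableOn
    · intro n
      filter_upwards [ae_restrict_mem measurableSet_Ioi] with u hu
      rw [norm_mul, Real.norm_of_nonneg (hk0 u), norm_mul, Real.norm_of_nonneg (Real.exp_pos _).le]
      refine mul_le_mul_of_nonneg_right ?_ (hk0 u)
      have h1 := hexp1 u hu n
      have h2 := hVB u
      have h3 := abs_nonneg (V u)
      have h4 := (Real.exp_pos (-d n * u)).le
      rw [Real.norm_eq_abs]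
      nlinarith
    · refine Eventually.of_forall fun u => ?_
      simpa using ((hexpt u).const_mul (V u)).mul_const (R * fk (R * (v - u)))
  have heq : ∀ n, ((∫ u in Ioi (0:ℝ), M u * Real.exp (-d n * u) * (R * fk (R * (v - u))) : ℝ) : ℂ) =
      ((∫ u in Ioi (0:ℝ), V u * Real.exp (-d n * u) * (R * fk (R * (v - u))) : ℝ) : ℂ) +
      ∫ t : ℝ, (tri R t : ℂ) * Complex.exp (Complex.I * t * v) * G (d n + t * Complex.I) := by
    intro n
    have hfi : IntegrableOn (fun u => (M u - V u) * Real.exp (-d n * u)) (Ioi 0) := by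
      simp only [sub_mul]; exact (hMi _ (hdpos n)).sub (hVi _ (hdpos n))
    have h1 := (smoothing_delta (fun u => M u - V u) (d n) hfi hR v).2
    have h2 : ∀ t : ℝ, G (d n + t * Complex.I) = ∫ u in Ioi (0:ℝ), ((M u - V u : ℝ) : ℂ) * Complex.exp (-(d n + t * Complex.I) * u) :=
      fun t => hG _ (by simpa using hdpos n)
    simp_rw [h2]
    rw [← h1]
    simp only [sub_mul]
    rw [integral_sub (hMki n) (hVki n)]
    push_cast
    ring
  have hMl : Tendsto (fun n => ((∫ u in Ioi (0:ℝ), M u * Real.exp (-d n * u) * (R * fk (R * (v - u))) : ℝ) : ℂ))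
      atTop (𝓝 (((∫ u in Ioi (0:ℝ), V u * (R * fk (R * (v - u))) : ℝ) : ℂ) +
      ∫ t : ℝ, (tri R t : ℂ) * Complex.exp (Complex.I * t * v) * G0 t)) := by
    simp_rw [heq]
    exact ((Complex.continuous_ofReal.tendsto _).comp hVl).add hrhs
  have hMint : IntegrableOn (fun u => M u * (R * fk (R * (v - u)))) (Ioi 0) := by
    apply integrable_of_tendsto (G := fun n u => M u * Real.exp (-d n * u) * (R * fk (R * (v - u))))
    · refine Eventually.of_forall fun u => ?_
      simpa using ((hexpt u).const_mul (M u)).mul_const (R * fk (R * (v - u)))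
    · intro n; exact (hMki n).aestronglyMeasurable
    · have hre := (Complex.continuous_re.tendsto _).comp hMl
      have he : ∀ n, ∫⁻ u in Ioi (0:ℝ), ‖M u * Real.exp (-d n * u) * (R * fk (R * (v - u)))‖ₑ =
          ENNReal.ofReal (∫ u in Ioi (0:ℝ), M u * Real.exp (-d n * u) * (R * fk (R * (v - u)))) := by
        intro n
        rw [ofReal_integral_eq_lintegral_ofReal (hMki n)]
        · apply lintegral_congr; intro u
          rw [Real.enorm_of_nonneg]
          exact mul_nonneg (mul_nonneg (hM0 u) (Real.exp_pos _).le) (hk0 u)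
        · exact Eventually.of_forall fun u => mul_nonneg (mul_nonneg (hM0 u) (Real.exp_pos _).le) (hk0 u)
      simp_rw [he]
      have := (ENNReal.continuous_ofReal.tendsto _).comp hre
      have h2 := this.liminf_eq
      simp only [Function.comp_def, Complex.ofReal_re] at h2
      rw [h2]; exact ENNReal.ofReal_ne_top
  refine ⟨hMint, ?_⟩
  have hMl2 : Tendsto (fun n => ∫ u in Ioi (0:ℝ), M u * Real.exp (-d n * u) * (R * fk (R * (v - u)))) atTop
      (𝓝 (∫ u in Ioi (0:ℝ), M u * (R * fk (R * (v - u))))) := by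
    apply tendsto_integral_of_dominated_convergence (fun u => M u * (R * fk (R * (v - u))))
    · intro n; exact (hMki n).aestronglyMeasurable
    · exact hMint
    · intro n
      filter_upwards [ae_restrict_mem measurableSet_Ioi] with u hu
      rw [norm_mul, Real.norm_of_nonneg (hk0 u), norm_mul, Real.norm_of_nonneg (Real.exp_pos _).le,
        Real.norm_of_nonneg (hM0 u)]
      refine mul_le_mul_of_nonneg_right ?_ (hk0 u)
      have h1 := hexp1 u hu n
      have h2 := hM0 u
      nlinarith
    · refine Eventually.of_forall fun u => ?_
      simpa using ((hexpt u).const_mul (M u)).mul_const (R * fk (R * (v - u)))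
  exact tendsto_nhds_unique ((Complex.continuous_ofReal.tendsto _).comp hMl2) hMl


lemma fk_total {R : ℝ} (hR : 0 < R) (v : ℝ) : ∫ u, R * fk (R * (v - u)) = ∫ x, fk x := by
  have h1 : ∫ u, R * fk (R * (v - u)) = ∫ u, R * fk (R * u) :=
    integral_sub_left_eq_self (fun u => R * fk (R * u)) volume v
  rw [h1, integral_const_mul, Measure.integral_comp_mul_left, abs_of_pos (by positivity), smul_eq_mul]
  field_simp

lemma fk_ki {R : ℝ} (hR : 0 < R) (v : ℝ) : Integrable (fun u => R * fk (R * (v - u))) := by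
  apply Integrable.const_mul
  have := (fk_integrable.comp_mul_left' hR.ne')
  exact this.comp_sub_left v

lemma fk_window {R h : ℝ} (hh : 0 < h) (v : ℝ) :
    ∫ u in Icc (v - h) (v + h), R * fk (R * (v - u)) = ∫ x in (-(R * h))..(R * h), fk x := by
  rw [integral_Icc_eq_integral_Ioc, ← intervalIntegral.integral_of_le (by linarith)]
  have h1 := intervalIntegral.integral_comp_sub_left (a := v - h) (b := v + h)
    (fun u => R * fk (R * u)) v
  rw [h1, intervalIntegral.integral_const_mul, intervalIntegral.mul_integral_comp_mul_left]
  congr 1 <;> ring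

lemma smooth_tendsto (M V : ℝ → ℝ) (hM0 : ∀ u, 0 ≤ M u)
    (hMi : ∀ δ > 0, IntegrableOn (fun u => M u * Real.exp (-δ * u)) (Ioi 0))
    (hVm : Measurable V) (B : ℝ) (hVB : ∀ u, |V u| ≤ B) (a : ℝ) (hVa : Tendsto V atTop (𝓝 a))
    (G : ℂ → ℂ) (hG : ∀ z : ℂ, 0 < z.re →
      G z = ∫ u in Ioi (0:ℝ), ((M u - V u : ℝ) : ℂ) * Complex.exp (-z * u))
    (G0 : ℝ → ℂ) (hlim : ∀ᵐ t : ℝ, Tendsto (fun δ : ℝ => G (δ + t * Complex.I)) (𝓝[>] 0) (𝓝 (G0 t)))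
    {R : ℝ} (hR : 0 < R)
    (hdom : ∃ D : ℝ → ℝ, Integrable D ∧ ∃ δ0 > 0, ∀ᵐ t : ℝ, |t| ≤ R → ∀ δ : ℝ, 0 < δ → δ < δ0 →
      ‖G (δ + t * Complex.I)‖ ≤ D t) :
    Tendsto (fun v => ∫ u in Ioi (0:ℝ), M u * (R * fk (R * (v - u)))) atTop (𝓝 (a * ∫ x, fk x)) := by
  have hV : Tendsto (fun v => ∫ u in Ioi (0:ℝ), V u * (R * fk (R * (v - u)))) atTop
      (𝓝 (a * ∫ x, fk x)) := by
    have e : ∀ v, ∫ u in Ioi (0:ℝ), V u * (R * fk (R * (v - u))) =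
        ∫ x, (Ioi (0:ℝ)).indicator V (v - x) * (R * fk (R * x)) := by
      intro v
      rw [← integral_indicator measurableSet_Ioi,
        ← integral_sub_left_eq_self _ volume v]
      congr 1; ext x
      by_cases hx : v - x ∈ Ioi (0:ℝ)
      · simp only [indicator_of_mem hx]; simp
      · simp only [indicator_of_notMem hx]; simp
    simp_rw [e]
    have hk := fk_ki hR 0
    have e2 : a * ∫ x, fk x = ∫ x, a * (R * fk (R * x)) := by
      rw [integral_const_mul]
      have := fk_total hR 0
      have h1 : ∫ u, R * fk (R * (0 - u)) = ∫ u, R * fk (R * u) :=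
        integral_sub_left_eq_self (fun u => R * fk (R * u)) volume 0
      rw [← h1, this]
    rw [e2]
    have hk' : Integrable (fun u => R * fk (R * u)) := by
      have := hk.comp_sub_left 0
      simpa using this
    apply tendsto_integral_filter_of_dominated_convergence (fun x => B * (R * fk (R * x)))
    · refine Eventually.of_forall fun v => ?_
      refine AEStronglyMeasurable.mul ?_ hk'.aestronglyMeasurable
      exact ((hVm.indicator measurableSet_Ioi).comp (measurable_const.sub measurable_id)).aestronglyMeasurable
    · refine Eventually.of_forall fun v => Eventually.of_forall fun x => ?_
      have h0 : 0 ≤ R * fk (R * x) := mul_nonneg hR.le (fk_nonneg _)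
      rw [norm_mul, Real.norm_of_nonneg h0]
      refine mul_le_mul_of_nonneg_right ?_ h0
      by_cases hx : v - x ∈ Ioi (0:ℝ)
      · rw [indicator_of_mem hx]; exact hVB _
      · rw [indicator_of_notMem hx]; simpa using (abs_nonneg _).trans (hVB 0)
    · exact hk'.const_mul B
    · refine Eventually.of_forall fun x => ?_
      refine Tendsto.mul_const _ ?_
      have : Tendsto (fun v => V (v - x)) atTop (𝓝 a) :=
        hVa.comp (tendsto_atTop_add_const_right _ (-x) tendsto_id)
      refine this.congr' ?_
      filter_upwards [eventually_gt_atTop x] with v hv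
      rw [indicator_of_mem]; exact sub_pos.2 hv
  have hF : Tendsto (fun v : ℝ => ∫ t : ℝ, (tri R t : ℂ) * Complex.exp (Complex.I * t * v) * G0 t) atTop (𝓝 0) := by
    have h1 := Real.tendsto_integral_exp_smul_cocompact (fun t => (tri R t : ℂ) * G0 t)
    have h2 : Tendsto (fun v : ℝ => -(v / (2 * Real.pi))) atTop (cocompact ℝ) := by
      have : Tendsto (fun v : ℝ => -(v / (2 * Real.pi))) atTop atBot :=
        tendsto_neg_atTop_atBot.comp (tendsto_id.atTop_div_const (by positivity))
      exact this.mono_right atBot_le_cocompact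
    refine (h1.comp h2).congr fun v => ?_
    simp only [Function.comp_def]
    congr 1; ext t
    rw [Circle.smul_def, Real.fourierChar_apply, smul_eq_mul]
    have : (((2 * Real.pi * (-(t * -(v / (2 * Real.pi))))) : ℝ) : ℂ) * Complex.I = Complex.I * t * v := by
      have : 2 * Real.pi * (-(t * -(v / (2 * Real.pi)))) = t * v := by
        have := Real.pi_ne_zero
        field_simp
      rw [this]; push_cast; ring
    rw [this]; ring
  have hs := fun v => (smoothing M V hM0 hMi hVm B hVB G hG G0 hlim hR hdom v).2
  have h3 : Tendsto (fun v => ((∫ u in Ioi (0:ℝ), M u * (R * fk (R * (v - u))) : ℝ) : ℂ)) atTop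
      (𝓝 (((a * ∫ x, fk x : ℝ) : ℂ) + 0)) := by
    simp_rw [hs]
    exact ((Complex.continuous_ofReal.tendsto _).comp hV).add hF
  have h4 := (Complex.continuous_re.tendsto _).comp h3
  simpa [Function.comp_def] using h4

lemma window_tendsto {h : ℝ} (hh : 0 < h) :
    Tendsto (fun R : ℝ => ∫ x in (-(R * h))..(R * h), fk x) atTop (𝓝 (∫ x, fk x)) := by
  have h1 : Tendsto (fun R : ℝ => R * h) atTop atTop := tendsto_id.atTop_mul_const hh
  exact intervalIntegral_tendsto_integral fk_integrable (tendsto_neg_atTop_atBot.comp h1) h1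

theorem tauber (M V : ℝ → ℝ) (hM0 : ∀ u, 0 ≤ M u)
    (hMexp : ∀ u h, 0 ≤ h → M u * Real.exp (-h) ≤ M (u + h))
    (hMi : ∀ δ > 0, IntegrableOn (fun u => M u * Real.exp (-δ * u)) (Ioi 0))
    (hVm : Measurable V) (B : ℝ) (hVB : ∀ u, |V u| ≤ B) (a : ℝ) (hVa : Tendsto V atTop (𝓝 a))
    (G : ℂ → ℂ) (hG : ∀ z : ℂ, 0 < z.re →
      G z = ∫ u in Ioi (0:ℝ), ((M u - V u : ℝ) : ℂ) * Complex.exp (-z * u))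
    (G0 : ℝ → ℂ) (hlim : ∀ᵐ t : ℝ, Tendsto (fun δ : ℝ => G (δ + t * Complex.I)) (𝓝[>] 0) (𝓝 (G0 t)))
    (hdom : ∀ R : ℝ, 0 < R → ∃ D : ℝ → ℝ, Integrable D ∧ ∃ δ0 > 0, ∀ᵐ t : ℝ, |t| ≤ R → ∀ δ : ℝ, 0 < δ → δ < δ0 →
      ‖G (δ + t * Complex.I)‖ ≤ D t) :
    Tendsto M atTop (𝓝 a) := by
  set κ := ∫ x, fk x with hκ
  have hκ0 : 0 < κ := fk_integral_pos
  set S : ℝ → ℝ → ℝ := fun R v => ∫ u in Ioi (0:ℝ), M u * (R * fk (R * (v - u))) with hS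
  set c : ℝ → ℝ → ℝ := fun h R => ∫ x in (-(R * h))..(R * h), fk x with hc
  have hSt : ∀ R, 0 < R → Tendsto (S R) atTop (𝓝 (a * κ)) := fun R hR =>
    smooth_tendsto M V hM0 hMi hVm B hVB a hVa G hG G0 hlim hR (hdom R hR)
  have hSi : ∀ R, 0 < R → ∀ v, IntegrableOn (fun u => M u * (R * fk (R * (v - u)))) (Ioi 0) :=
    fun R hR v => (smoothing M V hM0 hMi hVm B hVB G hG G0 hlim hR (hdom R hR) v).1
  have hct : ∀ h, 0 < h → Tendsto (c h) atTop (𝓝 κ) := fun h hh => window_tendsto hh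
  have hk0 : ∀ R, 0 < R → ∀ v u, 0 ≤ R * fk (R * (v - u)) := fun R hR v u => mul_nonneg hR.le (fk_nonneg _)
  have hMexp' : ∀ u w, u ≤ w → M u ≤ M w * Real.exp (w - u) := by
    intro u w huw
    have := hMexp u (w - u) (by linarith)
    rw [add_sub_cancel, Real.exp_neg, ← div_eq_mul_inv, div_le_iff₀ (Real.exp_pos _)] at this
    exact this
  have hwin : ∀ h, 0 < h → ∀ R, 0 < R → ∀ v, h < v → M (v - h) * Real.exp (-(2 * h)) * c h R ≤ S R v := by
    intro h hh R hR v hv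
    simp only [hc, hS]
    rw [← fk_window hh v, ← integral_const_mul]
    have hsub : Icc (v - h) (v + h) ⊆ Ioi 0 := fun u hu => by
      have := hu.1; simp only [mem_Ioi]; linarith
    calc _ ≤ ∫ u in Icc (v - h) (v + h), M u * (R * fk (R * (v - u))) := by
          apply setIntegral_mono_on _ ((hSi R hR v).mono_set hsub) measurableSet_Icc
          · intro u hu
            refine mul_le_mul_of_nonneg_right ?_ (hk0 R hR v u)
            have h1 := hMexp' (v - h) u hu.1
            have h2 : Real.exp (u - (v - h)) ≤ Real.exp (2 * h) := by
              apply Real.exp_le_exp.2; linarith [hu.2]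
            rw [Real.exp_neg, ← div_eq_mul_inv, div_le_iff₀ (Real.exp_pos _)]
            exact h1.trans (mul_le_mul_of_nonneg_left h2 (hM0 u))
          · exact ((fk_ki hR v).const_mul _).integrableOn
      _ ≤ _ := by
          apply setIntegral_mono_set (hSi R hR v)
          · exact Eventually.of_forall fun u => mul_nonneg (hM0 u) (hk0 R hR v u)
          · exact hsub.eventuallyLE
  have hupper : ∀ ε > 0, ∀ᶠ v in atTop, M v < a + ε := by
    intro ε hε
    obtain ⟨h, hh1, hh⟩ : ∃ h, a * Real.exp (2 * h) < a + ε ∧ 0 < h := by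
      have : Tendsto (fun h : ℝ => a * Real.exp (2 * h)) (𝓝[>] 0) (𝓝 (a * Real.exp (2 * 0))) :=
        (Continuous.tendsto (by fun_prop) 0).mono_left nhdsWithin_le_nhds
      simp only [mul_zero, Real.exp_zero, mul_one] at this
      exact ((this.eventually (gt_mem_nhds (by linarith))).and self_mem_nhdsWithin).exists
    obtain ⟨R, hR1, hRc, hR⟩ : ∃ R, a * κ * Real.exp (2 * h) / c h R < a + ε ∧ 0 < c h R ∧ 0 < R := by
      have : Tendsto (fun R => a * κ * Real.exp (2 * h) / c h R) atTop (𝓝 (a * κ * Real.exp (2 * h) / κ)) :=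
        tendsto_const_nhds.div (hct h hh) hκ0.ne'
      have e : a * κ * Real.exp (2 * h) / κ = a * Real.exp (2 * h) := by field_simp
      rw [e] at this
      exact ((this.eventually (gt_mem_nhds hh1)).and (((hct h hh).eventually (lt_mem_nhds hκ0)).and
        (eventually_gt_atTop 0))).exists
    have h5 : Tendsto (fun v => S R (v + h) * Real.exp (2 * h) / c h R) atTop (𝓝 (a * κ * Real.exp (2 * h) / c h R)) :=
      ((((hSt R hR).comp (tendsto_atTop_add_const_right _ h tendsto_id))).mul_const _).div_const _
    filter_upwards [h5.eventually (gt_mem_nhds hR1), eventually_gt_atTop 0] with v hv hv0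
    refine lt_of_le_of_lt ?_ hv
    have h6 := hwin h hh R hR (v + h) (by linarith)
    rw [add_sub_cancel_right] at h6
    rw [le_div_iff₀ hRc]
    have h7 : M v * c h R = M v * Real.exp (-(2 * h)) * c h R * Real.exp (2 * h) := by
      rw [Real.exp_neg]; field_simp
    rw [h7]
    exact mul_le_mul_of_nonneg_right h6 (Real.exp_pos _).le
  obtain ⟨C, hC⟩ : ∃ C, ∀ u, 0 < u → M u ≤ C := by
    obtain ⟨v1, hv1⟩ := eventually_atTop.1 (hupper 1 one_pos)
    refine ⟨max (a + 1) (M v1 * Real.exp v1), fun u hu => ?_⟩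
    rcases le_total v1 u with h | h
    · exact (hv1 u h).le.trans (le_max_left _ _)
    · refine le_trans ?_ (le_max_right _ _)
      refine (hMexp' u v1 h).trans (mul_le_mul_of_nonneg_left ?_ (hM0 _))
      apply Real.exp_le_exp.2; linarith
  have hC0 : 0 ≤ C := (hM0 1).trans (hC 1 one_pos)
  have hlow : ∀ h, 0 < h → ∀ R, 0 < R → ∀ v, S R v ≤ M (v + h) * Real.exp (2 * h) * c h R + C * (κ - c h R) := by
    intro h hh R hR v
    set A := M (v + h) * Real.exp (2 * h) with hA
    have hA0 : 0 ≤ A := mul_nonneg (hM0 _) (Real.exp_pos _).le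
    have hki := fk_ki hR v
    set k : ℝ → ℝ := fun u => R * fk (R * (v - u)) with hk
    have hkn : ∀ u, 0 ≤ k u := hk0 R hR v
    have i1 : Integrable (fun u => (Icc (v - h) (v + h)).indicator (fun u => A * k u) u) :=
      (hki.const_mul A).indicator measurableSet_Icc
    have i2 : Integrable (fun u => (Icc (v - h) (v + h))ᶜ.indicator (fun u => C * k u) u) :=
      (hki.const_mul C).indicator measurableSet_Icc.compl
    calc S R v ≤ ∫ u in Ioi (0:ℝ), ((Icc (v - h) (v + h)).indicator (fun u => A * k u) u +
          (Icc (v - h) (v + h))ᶜ.indicator (fun u => C * k u) u) := by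
          apply setIntegral_mono_on (hSi R hR v) (i1.add i2).integrableOn measurableSet_Ioi
          intro u hu
          simp only [Pi.add_apply]
          by_cases hx : u ∈ Icc (v - h) (v + h)
          · rw [indicator_of_mem hx, indicator_of_notMem (by simpa using hx), add_zero]
            refine mul_le_mul_of_nonneg_right ?_ (hkn u)
            refine (hMexp' u (v + h) hx.2).trans (mul_le_mul_of_nonneg_left ?_ (hM0 _))
            apply Real.exp_le_exp.2; linarith [hx.1]
          · rw [indicator_of_notMem hx, indicator_of_mem (by simpa using hx), zero_add]
            exact mul_le_mul_of_nonneg_right (hC u hu) (hkn u)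
      _ ≤ ∫ u, ((Icc (v - h) (v + h)).indicator (fun u => A * k u) u +
          (Icc (v - h) (v + h))ᶜ.indicator (fun u => C * k u) u) := by
          apply setIntegral_le_integral (i1.add i2)
          refine Eventually.of_forall fun u => add_nonneg ?_ ?_
          · exact indicator_nonneg (fun u _ => mul_nonneg hA0 (hkn u)) u
          · exact indicator_nonneg (fun u _ => mul_nonneg hC0 (hkn u)) u
      _ = _ := by
          rw [integral_add i1 i2, integral_indicator measurableSet_Icc,
            integral_indicator measurableSet_Icc.compl,
            integral_const_mul A k, integral_const_mul C k,
            setIntegral_compl measurableSet_Icc hki, fk_total hR v, fk_window hh v]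
  have hlower : ∀ ε > 0, ∀ᶠ v in atTop, a - ε < M v := by
    intro ε hε
    obtain ⟨h, hh1, hh⟩ : ∃ h, a - ε < a * Real.exp (-(2 * h)) ∧ 0 < h := by
      have : Tendsto (fun h : ℝ => a * Real.exp (-(2 * h))) (𝓝[>] 0) (𝓝 (a * Real.exp (-(2 * 0)))) :=
        (Continuous.tendsto (by fun_prop) 0).mono_left nhdsWithin_le_nhds
      simp only [mul_zero, neg_zero, Real.exp_zero, mul_one] at this
      exact ((this.eventually (lt_mem_nhds (by linarith))).and self_mem_nhdsWithin).exists
    obtain ⟨R, hR1, hRc, hR⟩ : ∃ R, a - ε < (a * κ - C * (κ - c h R)) * Real.exp (-(2 * h)) / c h R ∧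
        0 < c h R ∧ 0 < R := by
      have : Tendsto (fun R => (a * κ - C * (κ - c h R)) * Real.exp (-(2 * h)) / c h R) atTop
          (𝓝 ((a * κ - C * (κ - κ)) * Real.exp (-(2 * h)) / κ)) :=
        ((tendsto_const_nhds.sub (((tendsto_const_nhds.sub (hct h hh))).const_mul C)).mul_const _).div
          (hct h hh) hκ0.ne'
      have e : (a * κ - C * (κ - κ)) * Real.exp (-(2 * h)) / κ = a * Real.exp (-(2 * h)) := by
        rw [sub_self, mul_zero, sub_zero]; field_simp
      rw [e] at this
      exact ((this.eventually (lt_mem_nhds hh1)).and (((hct h hh).eventually (lt_mem_nhds hκ0)).and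
        (eventually_gt_atTop 0))).exists
    have h5 : Tendsto (fun v => (S R (v + -h) - C * (κ - c h R)) * Real.exp (-(2 * h)) / c h R) atTop
        (𝓝 ((a * κ - C * (κ - c h R)) * Real.exp (-(2 * h)) / c h R)) :=
      ((((hSt R hR).comp (tendsto_atTop_add_const_right _ (-h) tendsto_id)).sub_const _).mul_const _).div_const _
    filter_upwards [h5.eventually (lt_mem_nhds hR1)] with v hv
    refine lt_of_lt_of_le hv ?_
    have h6 := hlow h hh R hR (v + -h)
    rw [neg_add_cancel_right] at h6
    rw [div_le_iff₀ hRc, Real.exp_neg, ← div_eq_mul_inv, div_le_iff₀ (Real.exp_pos _)]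
    linarith
  rw [Metric.tendsto_nhds]
  intro ε hε
  filter_upwards [hupper ε hε, hlower ε hε] with v h1 h2
  rw [Real.dist_eq, abs_lt]; constructor <;> linarith


lemma integrable_tsum_of_summable {α ι E : Type*} [MeasurableSpace α] [Countable ι]
    [NormedAddCommGroup E] [NormedSpace ℝ E] [CompleteSpace E]
    {μ : Measure α} {F : ι → α → E} (hF : ∀ i, Integrable (F i) μ)
    (hs : Summable fun i => ∫ a, ‖F i a‖ ∂μ)
    (hm : AEStronglyMeasurable (fun a => ∑' i, F i a) μ) :
    Integrable (fun a => ∑' i, F i a) μ := by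
  refine ⟨hm, ?_⟩
  have (i : ι) : ∫⁻ a, ‖F i a‖ₑ ∂μ = ENNReal.ofReal (∫ a, ‖F i a‖ ∂μ) := by
    rw [ofReal_integral_norm_eq_lintegral_enorm (hF i)]
  calc ∫⁻ a, ‖∑' i, F i a‖ₑ ∂μ ≤ ∫⁻ a, ∑' i, ‖F i a‖ₑ ∂μ :=
        lintegral_mono fun a => enorm_tsum_le_tsum_enorm
    _ = ∑' i, ∫⁻ a, ‖F i a‖ₑ ∂μ := lintegral_tsum fun i => (hF i).1.enorm
    _ < ⊤ := by
        simp_rw [this]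
        exact (hs.tsum_ofReal_lt_top)

lemma ae_summable_of_summable {α ι E : Type*} [MeasurableSpace α] [Countable ι]
    [NormedAddCommGroup E] [NormedSpace ℝ E] [CompleteSpace E]
    {μ : Measure α} {F : ι → α → E} (hF : ∀ i, Integrable (F i) μ)
    (hs : Summable fun i => ∫ a, ‖F i a‖ ∂μ) :
    ∀ᵐ a ∂μ, Summable (fun i => F i a) := by
  have (i : ι) : ∫⁻ a, ‖F i a‖ₑ ∂μ = ENNReal.ofReal (∫ a, ‖F i a‖ ∂μ) := by
    rw [ofReal_integral_norm_eq_lintegral_enorm (hF i)]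
  have h1 : ∫⁻ a, ∑' i, ‖F i a‖ₑ ∂μ ≠ ⊤ := by
    rw [lintegral_tsum fun i => (hF i).1.enorm]
    simp_rw [this]
    exact (hs.tsum_ofReal_lt_top).ne
  have h2 := ae_lt_top' (AEMeasurable.tsum fun i => (hF i).1.enorm) h1
  filter_upwards [h2] with a ha
  have : Summable fun i => ‖F i a‖₊ := ENNReal.tsum_coe_ne_top_iff_summable.1 ha.ne
  have h3 : Summable fun i => ‖F i a‖ := NNReal.summable_coe.2 this
  exact h3.of_norm

/-- Damping factor is at most one. -/
lemma norm_damp_le {z : ℂ} (hz : 0 ≤ z.re) {u : ℝ} (hu : 0 ≤ u) : ‖Complex.exp (-z * u)‖ ≤ 1 := by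
  rw [Complex.norm_exp, Real.exp_le_one_iff]
  simp
  positivity

lemma damp_integrable {f : ℝ → ℝ} (hf : Integrable f) (h0 : ∀ u ≤ 0, f u = 0) {z : ℂ} (hz : 0 ≤ z.re) :
    Integrable (fun u => (f u : ℂ) * Complex.exp (-z * u)) := by
  refine hf.norm.mono' (hf.ofReal.aestronglyMeasurable.mul (by apply Continuous.aestronglyMeasurable; fun_prop)) ?_
  refine Eventually.of_forall fun u => ?_
  rcases le_total u 0 with h | h
  · simp [h0 u h]
  · rw [norm_mul, Complex.norm_real]
    exact mul_le_of_le_one_right (norm_nonneg _) (norm_damp_le hz h)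

noncomputable def cpow (e : ℝ → ℝ) : ℕ → ℝ → ℝ
  | 0 => e
  | n + 1 => convolution e (cpow e n) (ContinuousLinearMap.mul ℝ ℝ) volume

lemma cpow_integrable {e : ℝ → ℝ} (he : Integrable e) (n : ℕ) : Integrable (cpow e n) := by
  induction n with
  | zero => exact he
  | succ n ih => exact he.integrable_convolution _ ih

lemma cpow_zero {e : ℝ → ℝ} (h0 : ∀ u ≤ 0, e u = 0) (n : ℕ) : ∀ u ≤ 0, cpow e n u = 0 := by
  induction n with
  | zero => exact h0
  | succ n ih =>
    intro u hu
    simp only [cpow, convolution, ContinuousLinearMap.mul_apply']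
    refine integral_eq_zero_of_ae (Eventually.of_forall fun t => ?_)
    rcases le_total t 0 with h | h
    · simp [h0 t h]
    · simp [ih (u - t) (by linarith)]

lemma cpow_norm {e : ℝ → ℝ} (he : Integrable e) (n : ℕ) :
    ∫ u, ‖cpow e n u‖ ≤ (∫ u, ‖e u‖) ^ (n + 1) := by
  induction n with
  | zero => simp [cpow]
  | succ n ih =>
    have h1 : ∀ u, ‖cpow e (n+1) u‖ ≤ convolution (fun u => ‖e u‖) (fun u => ‖cpow e n u‖)
        (ContinuousLinearMap.mul ℝ ℝ) volume u := by
      intro u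
      simp only [cpow, convolution, ContinuousLinearMap.mul_apply']
      refine (norm_integral_le_integral_norm _).trans_eq ?_
      simp
    calc ∫ u, ‖cpow e (n+1) u‖
      _ ≤ ∫ u, convolution (fun u => ‖e u‖) (fun u => ‖cpow e n u‖)
            (ContinuousLinearMap.mul ℝ ℝ) volume u :=
          integral_mono (cpow_integrable he (n+1)).norm
            (he.norm.integrable_convolution _ (cpow_integrable he n).norm) h1
      _ = (∫ u, ‖e u‖) * ∫ u, ‖cpow e n u‖ := by
          rw [integral_convolution _ he.norm (cpow_integrable he n).norm]; rfl
      _ ≤ _ := by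
          rw [pow_succ' _ (n+1)]
          exact mul_le_mul_of_nonneg_left ih (integral_nonneg fun u => norm_nonneg _)

lemma cpow_laplace {e : ℝ → ℝ} (he : Integrable e) (h0 : ∀ u ≤ 0, e u = 0) {z : ℂ} (hz : 0 ≤ z.re)
    (n : ℕ) : ∫ u, (cpow e n u : ℂ) * Complex.exp (-z * u) =
      (∫ u, (e u : ℂ) * Complex.exp (-z * u)) ^ (n + 1) := by
  induction n with
  | zero => simp [cpow]
  | succ n ih =>
    have h1 : ∀ u : ℝ, (cpow e (n+1) u : ℂ) * Complex.exp (-z * u) =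
        convolution (fun u : ℝ => (e u : ℂ) * Complex.exp (-z * u))
          (fun u : ℝ => (cpow e n u : ℂ) * Complex.exp (-z * u)) (ContinuousLinearMap.mul ℝ ℂ) volume u := by
      intro u
      simp only [cpow, convolution, ContinuousLinearMap.mul_apply']
      rw [← integral_complex_ofReal, ← integral_mul_const]
      congr 1; ext t
      rw [show -z * (u:ℂ) = -z * t + -z * ((u - t : ℝ) : ℂ) by push_cast; ring, Complex.exp_add]
      push_cast; ring
    simp_rw [h1]
    rw [integral_convolution _ (damp_integrable he h0 hz)
      (damp_integrable (cpow_integrable he n) (cpow_zero h0 n) hz), ih, pow_succ' _ (n+1)]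
    rfl

lemma conv_exp {e : ℝ → ℝ} (he : Integrable e) (h0 : ∀ u ≤ 0, e u = 0) :
    ∃ w : ℝ → ℝ, Integrable w ∧ (∀ u ≤ 0, w u = 0) ∧ ∀ z : ℂ, 0 ≤ z.re →
      ∫ u, (w u : ℂ) * Complex.exp (-z * u) = Complex.exp (∫ u, (e u : ℂ) * Complex.exp (-z * u)) - 1 := by
  set F : ℕ → ℝ → ℝ := fun n u => cpow e n u / ((n + 1).factorial : ℝ) with hF
  have hFi : ∀ n, Integrable (F n) := fun n => (cpow_integrable he n).div_const _
  have hE : Summable (fun n : ℕ => (∫ u, ‖e u‖) ^ (n + 1) / ((n + 1).factorial : ℝ)) :=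
    (summable_nat_add_iff 1).2 (Real.summable_pow_div_factorial _)
  have hFs : Summable fun n => ∫ u, ‖F n u‖ := by
    refine Summable.of_nonneg_of_le (fun n => integral_nonneg fun u => norm_nonneg _) (fun n => ?_) hE
    simp only [hF, norm_div, Real.norm_natCast]
    rw [integral_div]
    gcongr
    exact cpow_norm he n
  have hFm : AEStronglyMeasurable (fun u => ∑' n, F n u) := by
    refine aestronglyMeasurable_of_tendsto_ae atTop (f := fun N u => ∑ n ∈ Finset.range N, F n u) ?_ ?_
    · intro N
      exact Finset.aestronglyMeasurable_fun_sum _ fun n _ => (hFi n).1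
    · filter_upwards [ae_summable_of_summable hFi hFs] with u hu
      exact hu.hasSum.tendsto_sum_nat
  refine ⟨fun u => ∑' n, F n u, integrable_tsum_of_summable hFi hFs hFm, ?_, ?_⟩
  · intro u hu
    simp [hF, cpow_zero h0 _ u hu]
  · intro z hz
    set L := ∫ u, (e u : ℂ) * Complex.exp (-z * u) with hL
    have hi : ∀ n, Integrable (fun u => (F n u : ℂ) * Complex.exp (-z * u)) := fun n =>
      damp_integrable (hFi n) (fun u hu => by simp [hF, cpow_zero h0 _ u hu]) hz
    have hs : Summable fun n => ∫ u, ‖(F n u : ℂ) * Complex.exp (-z * u)‖ := by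
      refine Summable.of_nonneg_of_le (fun n => integral_nonneg fun u => norm_nonneg _) (fun n => ?_) hFs
      refine integral_mono (hi n).norm (hFi n).norm fun u => ?_
      simp only
      rcases le_total u 0 with h | h
      · simp [hF, cpow_zero h0 _ u h]
      · rw [norm_mul, Complex.norm_real]
        exact mul_le_of_le_one_right (norm_nonneg _) (norm_damp_le hz h)
    have h1 := hasSum_integral_of_summable_integral_norm hi hs
    have h2 : ∀ n, ∫ u, (F n u : ℂ) * Complex.exp (-z * u) = L ^ (n + 1) / ((n + 1).factorial : ℂ) := by
      intro n
      rw [hL, ← cpow_laplace he h0 hz n, ← integral_div]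
      congr 1; ext u; simp only [hF]; push_cast; ring
    simp_rw [h2] at h1
    have h3 : HasSum (fun n : ℕ => L ^ n / (n.factorial : ℂ)) (Complex.exp L) := by
      rw [Complex.exp_eq_exp_ℂ]; exact NormedSpace.expSeries_div_hasSum_exp L
    have h4 : HasSum (fun n : ℕ => L ^ (n+1) / ((n+1).factorial : ℂ)) (Complex.exp L - 1) := by
      have := (hasSum_nat_add_iff' 1).2 h3
      simpa using this
    refine Eq.trans ?_ (h1.unique h4)
    congr 1; ext u
    rw [tsum_mul_right, Complex.ofReal_tsum]

lemma tail_lemma {w : ℝ → ℝ} (hw : Integrable w) (h0 : ∀ u ≤ 0, w u = 0) :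
    Measurable (fun v => ∫ u in Ioi v, w u) ∧ (∀ v, |∫ u in Ioi v, w u| ≤ ∫ u, ‖w u‖) ∧
    Tendsto (fun v => ∫ u in Ioi v, w u) atTop (𝓝 0) ∧
    ∀ z : ℂ, 0 < z.re → ∫ v in Ioi (0:ℝ), ((∫ u in Ioi v, w u : ℝ) : ℂ) * Complex.exp (-z * v) =
      (((∫ u, w u : ℝ) : ℂ) - ∫ u, (w u : ℂ) * Complex.exp (-z * u)) / z := by
  have heq : ∀ v, ∫ u in Ioi v, w u = (∫ u, w u) - ∫ u in Iic v, w u := fun v => by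
    have := integral_add_compl (measurableSet_Iic (a := v)) hw
    rw [compl_Iic] at this; linarith
  refine ⟨?_, ?_, ?_, ?_⟩
  · simp_rw [heq]
    have h1 : Continuous (fun v => ∫ u in Iic v, w u) := by
      have : ∀ v, ∫ u in Iic v, w u = (∫ u in Iic 0, w u) + ∫ u in (0:ℝ)..v, w u := fun v => by
        rw [intervalIntegral.integral_Iic_sub_Iic hw.integrableOn hw.integrableOn |>.symm]; ring
      exact (continuous_const.add (intervalIntegral.continuous_primitive
        (fun a b => hw.intervalIntegrable) 0)).congr fun v => (this v).symm
    exact (continuous_const.sub h1).measurable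
  · intro v
    rw [← Real.norm_eq_abs]
    refine (norm_integral_le_integral_norm _).trans ?_
    exact setIntegral_le_integral hw.norm (Eventually.of_forall fun u => norm_nonneg _)
  · have : Tendsto (fun v : ℝ => ∫ u, (Ioi v).indicator w u) atTop (𝓝 (∫ u : ℝ, (0:ℝ))) := by
      apply tendsto_integral_filter_of_dominated_convergence (fun u => ‖w u‖)
      · exact Eventually.of_forall fun v => hw.1.indicator measurableSet_Ioi
      · exact Eventually.of_forall fun v => Eventually.of_forall fun u => norm_indicator_le_norm_self _ _
      · exact hw.norm
      · refine Eventually.of_forall fun u => ?_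
        refine tendsto_const_nhds.congr' ?_
        filter_upwards [eventually_ge_atTop u] with v hv
        rw [indicator_of_notMem]; simpa using hv
    simpa [integral_indicator measurableSet_Ioi] using this
  · intro z hz
    have hz0 : z ≠ 0 := by rintro rfl; simp at hz
    set μ := (volume : Measure ℝ).restrict (Ioi 0) with hμ
    set F : ℝ → ℝ → ℂ := fun v u => {p : ℝ × ℝ | p.1 < p.2}.indicator
      (fun p => Complex.exp (-z * p.1) * (w p.2 : ℂ)) (v, u) with hF
    have hexpi : Integrable (fun v : ℝ => Complex.exp (-z * v)) μ :=
      integrableOn_exp_mul_complex_Ioi (a := -z) (by simpa using hz) 0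
    have hintg : Integrable (Function.uncurry F) (μ.prod volume) := by
      have h1 : Integrable (fun p : ℝ × ℝ => Complex.exp (-z * p.1) * (w p.2 : ℂ)) (μ.prod volume) :=
        hexpi.mul_prod (g := fun u => (w u : ℂ)) hw.ofReal
      exact h1.indicator (measurableSet_lt measurable_fst measurable_snd)
    have hl : ∀ v, ((∫ u in Ioi v, w u : ℝ) : ℂ) * Complex.exp (-z * v) = ∫ u, F v u := by
      intro v
      rw [← integral_complex_ofReal, ← integral_mul_const, ← integral_indicator measurableSet_Ioi]
      congr 1; ext u
      by_cases h : v < u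
      · rw [indicator_of_mem (by exact h), hF]; simp only
        rw [indicator_of_mem (by exact h)]; ring
      · rw [indicator_of_notMem (by exact h), hF]; simp only
        rw [indicator_of_notMem (by exact h)]
    simp_rw [hl]
    rw [integral_integral_swap hintg]
    have hr : ∀ u, ∫ v, F v u ∂μ = (w u : ℂ) / z - (w u : ℂ) * Complex.exp (-z * u) / z := by
      intro u
      rcases le_or_gt u 0 with h | h
      · rw [h0 u h]
        simp only [Complex.ofReal_zero, zero_div, zero_mul, sub_zero]
        refine integral_eq_zero_of_ae (Eventually.of_forall fun v => ?_)
        by_cases hv : (v, u) ∈ {p : ℝ × ℝ | p.1 < p.2}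
        · simp only [hF, indicator_of_mem hv, h0 u h]; simp
        · simp only [hF, indicator_of_notMem hv]; simp
      · have e1 : ∫ v, F v u ∂μ = ∫ v in (0:ℝ)..u, Complex.exp (-z * v) * (w u : ℂ) := by
          rw [intervalIntegral.integral_of_le h.le, integral_Ioc_eq_integral_Ioo, hμ,
            ← integral_indicator measurableSet_Ioi, ← integral_indicator measurableSet_Ioo]
          congr 1; ext v
          by_cases hv : v ∈ Ioo 0 u
          · rw [indicator_of_mem hv, indicator_of_mem (by exact hv.1)]
            simp only [hF]; rw [indicator_of_mem (by exact hv.2)]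
          · rw [indicator_of_notMem hv]
            by_cases hv0 : v ∈ Ioi (0:ℝ)
            · rw [indicator_of_mem hv0]; simp only [hF]
              rw [indicator_of_notMem]
              intro h'; exact hv ⟨hv0, h'⟩
            · rw [indicator_of_notMem hv0]
        rw [e1, intervalIntegral.integral_mul_const, integral_exp_mul_complex (neg_ne_zero.2 hz0)]
        simp only [Complex.ofReal_zero, mul_zero, Complex.exp_zero]
        field_simp
        ring
    simp_rw [hr]
    have i1 : Integrable (fun u => (w u : ℂ) / z) := Integrable.div_const hw.ofReal z
    refine (integral_sub i1 ((damp_integrable hw h0 hz.le).div_const z)).trans ?_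
    rw [integral_div, integral_div, integral_complex_ofReal]
    ring


/-- `log(1+z) - log z`. -/
noncomputable def Lam (z : ℂ) : ℂ := Complex.log (1 + z) - Complex.log z

/-- The kernel `(1-e^{-u})/u`. -/
noncomputable def qk (u : ℝ) : ℝ := (1 - Real.exp (-u)) / u

lemma qk_measurable : Measurable qk := by unfold qk; fun_prop

lemma qk_nonneg {u : ℝ} (hu : 0 < u) : 0 ≤ qk u := by
  unfold qk
  have : Real.exp (-u) ≤ 1 := Real.exp_le_one_iff.2 (by linarith)
  exact div_nonneg (by linarith) hu.le

lemma qk_le {u : ℝ} (hu : 0 < u) : qk u ≤ 1 := by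
  unfold qk
  rw [div_le_one hu]
  have := Real.add_one_le_exp (-u)
  linarith

lemma qk_abs {u : ℝ} (hu : 0 < u) : |qk u| ≤ 1 := by
  rw [abs_of_nonneg (qk_nonneg hu)]; exact qk_le hu

lemma qk_integrable {z : ℂ} (hz : 0 < z.re) (f : ℝ → ℝ) (hf : Measurable f) (B : ℝ)
    (hB : ∀ u, |f u| ≤ B) :
    IntegrableOn (fun u : ℝ => ((qk u * f u : ℝ) : ℂ) * Complex.exp (-z * u)) (Ioi 0) := by
  have h1 : IntegrableOn (fun v : ℝ => B * ‖Complex.exp (-z * v)‖) (Ioi 0) :=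
    Integrable.const_mul (integrableOn_exp_mul_complex_Ioi (a := -z) (by simpa using hz) 0).norm B
  refine Integrable.mono' h1 ?_ ?_
  · refine AEStronglyMeasurable.mul ?_ (by apply Continuous.aestronglyMeasurable; fun_prop)
    exact (Complex.measurable_ofReal.comp (qk_measurable.mul hf)).aestronglyMeasurable
  · refine (ae_restrict_iff' measurableSet_Ioi).2 (Eventually.of_forall fun u hu => ?_)
    rw [norm_mul, Complex.norm_real, Real.norm_eq_abs, abs_mul]
    have h2 := qk_abs hu
    have h3 := hB u
    have : |qk u| * |f u| ≤ 1 * B := mul_le_mul h2 h3 (abs_nonneg _) zero_le_one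
    gcongr
    linarith

lemma frullani {z : ℂ} (hz : 0 < z.re) :
    ∫ u in Ioi (0:ℝ), ((qk u : ℝ) : ℂ) * Complex.exp (-z * u) = Lam z := by
  have hz0 : z ≠ 0 := by rintro rfl; simp at hz
  set μ := (volume : Measure ℝ).restrict (Ioi 0) with hμ
  set ν := (volume : Measure ℝ).restrict (Ioc 0 1) with hν
  have hexpi : Integrable (fun v : ℝ => Complex.exp (-z * v)) μ :=
    integrableOn_exp_mul_complex_Ioi (a := -z) (by simpa using hz) 0
  have hintg : Integrable (Function.uncurry fun (u r : ℝ) => Complex.exp (-(z + r) * u)) (μ.prod ν) := by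
    have h1 : Integrable (fun p : ℝ × ℝ => ‖Complex.exp (-z * p.1)‖ * (1:ℝ)) (μ.prod ν) :=
      hexpi.norm.mul_prod (g := fun _ => (1:ℝ)) (integrable_const _)
    refine h1.mono' ?_ ?_
    · apply Continuous.aestronglyMeasurable
      unfold Function.uncurry
      fun_prop
    · rw [hμ, hν, Measure.prod_restrict]
      refine (ae_restrict_iff' (measurableSet_Ioi.prod measurableSet_Ioc)).2
        (Eventually.of_forall fun q hq => ?_)
      simp only [Function.uncurry, mul_one, Complex.norm_exp]
      apply Real.exp_le_exp.2
      have h1 : 0 < q.1 := hq.1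
      have h2 : 0 < q.2 := hq.2.1
      simp
      nlinarith
  have hl : ∀ u ∈ Ioi (0:ℝ), ((qk u : ℝ) : ℂ) * Complex.exp (-z * u) =
      ∫ r, Complex.exp (-(z + r) * u) ∂ν := by
    intro u hu
    have hu0 : (u:ℂ) ≠ 0 := by exact_mod_cast (ne_of_gt hu)
    rw [hν, ← intervalIntegral.integral_of_le zero_le_one]
    have : ∀ r : ℝ, Complex.exp (-(z + r) * u) = Complex.exp (-z * u) * Complex.exp ((-u : ℂ) * r) := by
      intro r; rw [← Complex.exp_add]; congr 1; ring
    simp_rw [this]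
    rw [intervalIntegral.integral_const_mul, integral_exp_mul_complex (neg_ne_zero.2 hu0)]
    simp only [qk]
    push_cast
    simp only [mul_zero, mul_one, Complex.exp_zero]
    field_simp
    ring
  rw [setIntegral_congr_fun measurableSet_Ioi hl, integral_integral_swap hintg]
  have hr : ∀ r ∈ Ioc (0:ℝ) 1, ∫ u, Complex.exp (-(z + r) * u) ∂μ = 1 / (z + r) := by
    intro r hr
    have hzr : 0 < (z + r).re := by have := hr.1; simp; linarith
    have := integral_exp_mul_complex_Ioi (a := -(z + r)) (by rw [Complex.neg_re]; linarith) 0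
    rw [this]
    have : z + r ≠ 0 := by intro h; rw [h] at hzr; simp at hzr
    rw [Complex.ofReal_zero, mul_zero, Complex.exp_zero, neg_div_neg_eq]
  rw [setIntegral_congr_fun measurableSet_Ioc hr, ← intervalIntegral.integral_of_le zero_le_one]
  have hs : ∀ r ∈ uIcc (0:ℝ) 1, z + r ∈ Complex.slitPlane := by
    intro r hr
    rw [uIcc_of_le zero_le_one] at hr
    left; have := hr.1; simp; linarith
  have hd : ∀ r ∈ uIcc (0:ℝ) 1, HasDerivAt (fun r : ℝ => Complex.log (z + r)) (1 / (z + r)) r := by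
    intro r hr
    have h1 : HasDerivAt (fun r : ℝ => z + (r:ℂ)) 1 r := by
      simpa using (Complex.ofRealCLM.hasDerivAt (x := r)).const_add z
    have := h1.clog_real (hs r hr)
    exact this
  rw [intervalIntegral.integral_eq_sub_of_hasDerivAt hd]
  · simp [Lam, add_comm]
  · apply ContinuousOn.intervalIntegrable
    refine continuousOn_const.div (by fun_prop) fun r hr => Complex.slitPlane_ne_zero (hs r hr)


lemma hasSum_fin_geom (n : ℕ) (x : ℕ → ℂ) (hx : ∀ k, ‖x k‖ < 1) :
    Summable (fun f : Fin n → ℕ => ‖∏ i : Fin n, x i ^ f i‖) ∧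
    HasSum (fun f : Fin n → ℕ => ∏ i : Fin n, x i ^ f i) (∏ k ∈ Finset.range n, (1 - x k)⁻¹) := by
  induction n with
  | zero =>
    constructor
    · exact Summable.of_finite
    · simpa using hasSum_unique (fun f : Fin 0 → ℕ => (1:ℂ))
  | succ n ih =>
    obtain ⟨ih1, ih2⟩ := ih
    have g := hasSum_geometric_of_norm_lt_one (hx n)
    have gs : Summable fun e : ℕ => ‖x n ^ e‖ := by
      simp_rw [norm_pow]; exact summable_geometric_of_lt_one (norm_nonneg _) (hx n)
    let E : (ℕ × (Fin n → ℕ)) ≃ (Fin (n+1) → ℕ) := Fin.snocEquiv (fun _ => ℕ)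
    have hE : ∀ q : ℕ × (Fin n → ℕ), ∏ i : Fin (n+1), x i ^ (E q) i = x n ^ q.1 * ∏ i : Fin n, x i ^ q.2 i := by
      intro q
      rw [Fin.prod_univ_castSucc, mul_comm]
      simp [E, Fin.snocEquiv]
    have hs : Summable (fun q : ℕ × (Fin n → ℕ) => ‖x n ^ q.1 * ∏ i : Fin n, x i ^ q.2 i‖) :=
      Summable.mul_norm (f := fun e : ℕ => x n ^ e) (g := fun f : Fin n → ℕ => ∏ i : Fin n, x i ^ f i) gs ih1
    constructor
    · rw [← E.summable_iff]
      refine hs.congr fun q => ?_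
      simp only [Function.comp]
      rw [hE]
    · rw [← E.hasSum_iff, Finset.prod_range_succ, mul_comm]
      have := g.mul ih2 hs.of_norm
      refine this.congr_fun ?_
      intro q
      simp only [Function.comp]
      rw [hE]

/-- Truncated multiplicative function. -/
noncomputable def Ftr (x : ℕ → ℂ) (n : ℕ) (α : ℕ →₀ ℕ) : ℂ :=
  if α.support ⊆ Finset.range n then α.prod (fun k e => x k ^ e) else 0

lemma Ftr_hasSum (n : ℕ) (x : ℕ → ℂ) (hx : ∀ k, ‖x k‖ < 1) :
    Summable (fun α => ‖Ftr x n α‖) ∧ HasSum (Ftr x n) (∏ k ∈ Finset.range n, (1 - x k)⁻¹) := by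
  let ι : (Fin n → ℕ) → (ℕ →₀ ℕ) := fun f =>
    Finsupp.embDomain Fin.valEmbedding (Finsupp.equivFunOnFinite.symm f)
  have hι : Function.Injective ι :=
    (Finsupp.embDomain_injective _).comp Finsupp.equivFunOnFinite.symm.injective
  have hv : ∀ f, Ftr x n (ι f) = ∏ i : Fin n, x i ^ f i := by
    intro f
    have : (ι f).support ⊆ Finset.range n := by
      intro k hk
      simp only [ι, Finsupp.support_embDomain, Finset.mem_map] at hk
      obtain ⟨i, -, rfl⟩ := hk
      simp
    rw [Ftr, if_pos this, Finsupp.prod_embDomain, Finsupp.prod_fintype _ _ (by simp)]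
    rfl
  have h0 : ∀ α, α ∉ range ι → Ftr x n α = 0 := by
    intro α hα
    rw [Ftr, if_neg]
    intro hs
    apply hα
    refine ⟨fun i => α i, ?_⟩
    ext k
    by_cases hk : k < n
    · have := Finsupp.embDomain_apply_self Fin.valEmbedding
        (Finsupp.equivFunOnFinite.symm (fun i : Fin n => α i)) ⟨k, hk⟩
      simpa using this
    · rw [Finsupp.embDomain_of_notMem_range]
      · symm
        by_contra h
        exact hk (Finset.mem_range.1 (hs (Finsupp.mem_support_iff.2 h)))
      · rintro ⟨i, rfl⟩; exact hk i.2
  obtain ⟨h1, h2⟩ := hasSum_fin_geom n x hx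
  constructor
  · rw [← hι.summable_iff]
    · refine h1.congr fun f => ?_
      simp only [Function.comp]; rw [hv]
    · intro α hα; rw [h0 α hα, norm_zero]
  · rw [← hι.hasSum_iff h0]
    refine h2.congr_fun fun f => ?_
    simp only [Function.comp]; rw [hv]

lemma prod_tendsto (x : ℕ → ℂ) (hx : ∀ k, ‖x k‖ < 1)
    (hs : Summable fun q : ℕ × ℕ => ‖x q.1 ^ (q.2 + 1) / (q.2 + 1 : ℂ)‖) :
    Tendsto (fun n => ∏ k ∈ Finset.range n, (1 - x k)⁻¹) atTop
      (𝓝 (Complex.exp (∑' q : ℕ × ℕ, x q.1 ^ (q.2 + 1) / (q.2 + 1 : ℂ)))) := by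
  have h1 : ∀ k, HasSum (fun j : ℕ => x k ^ (j + 1) / (j + 1 : ℂ)) (-Complex.log (1 - x k)) := by
    intro k
    have := (hasSum_nat_add_iff' 1).2 (Complex.hasSum_taylorSeries_neg_log (hx k))
    simpa using this
  have h2 := (hs.of_norm.hasSum.prod_fiberwise h1).tendsto_sum_nat
  have h3 := (Complex.continuous_exp.tendsto _).comp h2
  refine h3.congr fun n => ?_
  simp only [Function.comp]
  rw [Complex.exp_sum]
  refine Finset.prod_congr rfl fun k _ => ?_
  rw [Complex.exp_neg, Complex.exp_log]
  intro h
  have := hx k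
  rw [← sub_eq_zero.1 h] at this
  simp at this

theorem euler (x : ℕ → ℂ) (hx : ∀ k, ‖x k‖ < 1)
    (hs : Summable fun q : ℕ × ℕ => ‖x q.1 ^ (q.2 + 1) / (q.2 + 1 : ℂ)‖) :
    Summable (fun α : ℕ →₀ ℕ => ‖α.prod (fun k e => x k ^ e)‖) ∧
    HasSum (fun α : ℕ →₀ ℕ => α.prod (fun k e => x k ^ e))
      (Complex.exp (∑' q : ℕ × ℕ, x q.1 ^ (q.2 + 1) / (q.2 + 1 : ℂ))) := by
  have hsum : Summable (fun α : ℕ →₀ ℕ => ‖α.prod (fun k e => x k ^ e)‖) := by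
    set r : ℕ → ℂ := fun k => ((‖x k‖ : ℝ) : ℂ) with hr
    have hrx : ∀ k, ‖r k‖ < 1 := fun k => by simpa [hr] using hx k
    have hrs : Summable fun q : ℕ × ℕ => ‖r q.1 ^ (q.2 + 1) / (q.2 + 1 : ℂ)‖ := by
      simpa [hr] using hs
    have hb := (prod_tendsto r hrx hrs).norm.bddAbove_range
    obtain ⟨B, hB⟩ := hb
    refine summable_of_sum_le (c := B) (fun α => norm_nonneg _) fun T => ?_
    obtain ⟨n, hn⟩ : ∃ n, ∀ α ∈ T, α.support ⊆ Finset.range n := by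
      obtain ⟨n, hn⟩ := Finset.exists_nat_subset_range (T.biUnion fun α => α.support)
      exact ⟨n, fun α hα => (Finset.subset_biUnion_of_mem (fun α : ℕ →₀ ℕ => α.support) hα).trans hn⟩
    obtain ⟨h1, h2⟩ := Ftr_hasSum n r hrx
    have hval : ∀ α ∈ T, ‖α.prod (fun k e => x k ^ e)‖ = ‖Ftr r n α‖ := by
      intro α hα
      rw [Ftr, if_pos (hn α hα)]
      simp [Finsupp.prod, norm_prod, hr]
    have hnn : ∀ α, ((‖Ftr r n α‖ : ℝ) : ℂ) = Ftr r n α := by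
      intro α
      unfold Ftr
      split_ifs
      · simp [Finsupp.prod, norm_prod, hr]
      · simp
    rw [Finset.sum_congr rfl hval]
    refine (h1.sum_le_tsum T fun α _ => norm_nonneg _).trans ?_
    have : ∑' α, ‖Ftr r n α‖ = ‖∏ k ∈ Finset.range n, (1 - r k)⁻¹‖ := by
      rw [← h2.tsum_eq]
      have h5 : ∑' α, Ftr r n α = ((∑' α, ‖Ftr r n α‖ : ℝ) : ℂ) := by
        rw [Complex.ofReal_tsum]; exact tsum_congr fun α => (hnn α).symm
      rw [h5, Complex.norm_real, Real.norm_of_nonneg (tsum_nonneg fun α => norm_nonneg _)]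
    rw [this]
    exact hB ⟨n, rfl⟩
  refine ⟨hsum, ?_⟩
  have h1 : Tendsto (fun n => ∑' α, Ftr x n α) atTop (𝓝 (∑' α : ℕ →₀ ℕ, α.prod (fun k e => x k ^ e))) := by
    refine tendsto_tsum_of_dominated_convergence hsum ?_ ?_
    · intro α
      refine tendsto_const_nhds.congr' ?_
      obtain ⟨n, hn⟩ := Finset.exists_nat_subset_range α.support
      filter_upwards [eventually_ge_atTop n] with m hm
      rw [Ftr, if_pos (hn.trans (Finset.range_mono hm))]
    · refine Eventually.of_forall fun n α => ?_
      unfold Ftr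
      split_ifs
      · exact le_rfl
      · simp
  have h2 := prod_tendsto x hx hs
  have h3 := tendsto_nhds_unique h1 (h2.congr fun n => ((Ftr_hasSum n x hx).2.tsum_eq).symm)
  rw [← h3]
  exact hsum.of_norm.hasSum


/-- Step function with jumps `c i` at `l i`. -/
noncomputable def stepF {ι : Type*} (c l : ι → ℝ) (u : ℝ) : ℝ := ∑' i, if l i ≤ u then c i else 0

lemma stepF_mono {ι : Type*} {c l : ι → ℝ} (hc : ∀ i, 0 ≤ c i)
    (hfin : ∀ u, Summable fun i => if l i ≤ u then c i else 0) : Monotone (stepF c l) := by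
  intro u v huv
  refine Summable.tsum_le_tsum (fun i => ?_) (hfin u) (hfin v)
  split_ifs with h1 h2
  · exact le_rfl
  · exact absurd (h1.trans huv) h2
  · exact hc i
  · exact le_rfl

lemma step_single {c l : ℝ} (hl : 0 ≤ l) {s : ℂ} (hs : 0 < s.re) :
    IntegrableOn (fun u : ℝ => (((if l ≤ u then c else 0 : ℝ)) : ℂ) * Complex.exp (-s * u)) (Ioi 0) ∧
    ∫ u in Ioi (0:ℝ), (((if l ≤ u then c else 0 : ℝ)) : ℂ) * Complex.exp (-s * u) =
      c * Complex.exp (-s * l) / s := by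
  have h0 : IntegrableOn (fun u : ℝ => Complex.exp (-s * u)) (Ioi 0) :=
    integrableOn_exp_mul_complex_Ioi (a := -s) (by simpa using hs) 0
  have heq : (fun u : ℝ => (((if l ≤ u then c else 0 : ℝ)) : ℂ) * Complex.exp (-s * u)) =
      (Ici l).indicator (fun u : ℝ => c * Complex.exp (-s * u)) := by
    ext u
    by_cases h : l ≤ u
    · rw [indicator_of_mem (by exact h), if_pos h]
    · rw [indicator_of_notMem (by exact h), if_neg h]; simp
  rw [heq]
  constructor
  · exact Integrable.indicator (Integrable.const_mul h0 _) measurableSet_Ici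
  · rw [setIntegral_indicator measurableSet_Ici]
    have : (Ioi (0:ℝ) ∩ Ici l : Set ℝ) =ᵐ[volume] Ioi l := by
      have h2 : (Ioi (0:ℝ) ∩ Ici l : Set ℝ) =ᵐ[volume] (Ioi (0:ℝ) ∩ Ioi l : Set ℝ) :=
        (ae_eq_refl _).inter Ioi_ae_eq_Ici.symm
      refine h2.trans ?_
      rw [Ioi_inter_Ioi, max_eq_right hl]
      exact ae_eq_refl _
    rw [setIntegral_congr_set this, integral_const_mul,
      integral_exp_mul_complex_Ioi (a := -s) (by simpa using hs) l, neg_div_neg_eq]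
    ring

lemma step_norm {c l : ℝ} (hc : 0 ≤ c) (hl : 0 ≤ l) {s : ℂ} (hs : 0 < s.re) :
    ∫ u in Ioi (0:ℝ), ‖(((if l ≤ u then c else 0 : ℝ)) : ℂ) * Complex.exp (-s * u)‖ =
      c * Real.exp (-s.re * l) / s.re := by
  have h := (step_single (c := c) hl (s := (s.re : ℂ)) (by simpa using hs)).2
  have h2 : ∀ u : ℝ, (((if l ≤ u then c else 0 : ℝ)) : ℂ) * Complex.exp (-(s.re : ℂ) * u) =
      ((‖(((if l ≤ u then c else 0 : ℝ)) : ℂ) * Complex.exp (-s * u)‖ : ℝ) : ℂ) := by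
    intro u
    rw [norm_mul, Complex.norm_real, Complex.norm_exp, Real.norm_of_nonneg (by split_ifs <;> simp [hc])]
    push_cast
    congr 2
    simp
  simp_rw [h2] at h
  rw [integral_complex_ofReal] at h
  exact_mod_cast h

lemma step_a {ι : Type*} {c l : ι → ℝ} (hc : ∀ i, 0 ≤ c i) (hl : ∀ i, 0 ≤ l i)
    (hfin : ∀ u, Summable fun i => if l i ≤ u then c i else 0) {σ : ℝ} (hσ : 0 < σ)
    (hi : IntegrableOn (fun u => stepF c l u * Real.exp (-σ * u)) (Ioi 0)) :
    Summable fun i => c i * Real.exp (-σ * l i) := by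
  refine summable_of_sum_le (c := (∫ u in Ioi 0, stepF c l u * Real.exp (-σ * u)) * σ)
    (fun i => mul_nonneg (hc i) (Real.exp_pos _).le) fun T => ?_
  have hpt : ∀ i, ∀ u : ℝ, ‖(((if l i ≤ u then c i else 0 : ℝ)) : ℂ) * Complex.exp (-(σ:ℂ) * u)‖ =
      (if l i ≤ u then c i else 0) * Real.exp (-σ * u) := by
    intro i u
    rw [norm_mul, Complex.norm_real, Complex.norm_exp,
      Real.norm_of_nonneg (by split_ifs <;> simp [hc])]
    simp
  have hsr : 0 < (σ:ℂ).re := by simpa using hσ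
  have h1 : ∀ i, c i * Real.exp (-σ * l i) =
      (∫ u in Ioi (0:ℝ), (if l i ≤ u then c i else 0) * Real.exp (-σ * u)) * σ := by
    intro i
    have := step_norm (hc i) (hl i) hsr
    simp_rw [hpt] at this
    rw [this]; simp; field_simp
  have hi1 : ∀ i, IntegrableOn (fun u : ℝ => (if l i ≤ u then c i else 0) * Real.exp (-σ * u)) (Ioi 0) := by
    intro i
    have := (step_single (c := c i) (hl i) hsr).1.norm
    simp_rw [hpt] at this
    exact this
  rw [Finset.sum_congr rfl fun i _ => h1 i, ← Finset.sum_mul, ← integral_finsetSum _ fun i _ => hi1 i]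
  refine mul_le_mul_of_nonneg_right ?_ hσ.le
  refine integral_mono (integrable_finsetSum _ fun i _ => hi1 i) hi fun u => ?_
  simp only
  rw [← Finset.sum_mul]
  refine mul_le_mul_of_nonneg_right ?_ (Real.exp_pos _).le
  exact (hfin u).sum_le_tsum T fun i _ => by split_ifs <;> simp [hc]

lemma step_b {ι : Type*} [Countable ι] {c l : ι → ℝ} (hc : ∀ i, 0 ≤ c i) (hl : ∀ i, 0 ≤ l i)
    (hfin : ∀ u, Summable fun i => if l i ≤ u then c i else 0) {s : ℂ} (hs : 0 < s.re)
    (hsum : Summable fun i => c i * Real.exp (-s.re * l i)) :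
    IntegrableOn (fun u : ℝ => (stepF c l u : ℂ) * Complex.exp (-s * u)) (Ioi 0) ∧
    ∫ u in Ioi (0:ℝ), (stepF c l u : ℂ) * Complex.exp (-s * u) =
      (∑' i, c i * Complex.exp (-s * l i)) / s := by
  have hi := fun i => (step_single (c := c i) (hl i) hs).1
  have hn : Summable fun i => ∫ u in Ioi (0:ℝ),
      ‖(((if l i ≤ u then c i else 0 : ℝ)) : ℂ) * Complex.exp (-s * u)‖ := by
    simp_rw [fun i => step_norm (hc i) (hl i) hs]
    exact hsum.div_const _
  have heq : ∀ u : ℝ, (stepF c l u : ℂ) * Complex.exp (-s * u) =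
      ∑' i, (((if l i ≤ u then c i else 0 : ℝ)) : ℂ) * Complex.exp (-s * u) := by
    intro u
    rw [tsum_mul_right, stepF, Complex.ofReal_tsum]
  constructor
  · have hm : AEStronglyMeasurable (fun u : ℝ => (stepF c l u : ℂ) * Complex.exp (-s * u))
        (volume.restrict (Ioi 0)) := by
      refine AEStronglyMeasurable.mul ?_ (by apply Continuous.aestronglyMeasurable; fun_prop)
      exact (Complex.measurable_ofReal.comp (stepF_mono hc hfin).measurable).aestronglyMeasurable
    simp_rw [heq] at hm ⊢
    exact integrable_tsum_of_summable hi hn hm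
  · have := hasSum_integral_of_summable_integral_norm hi hn
    simp_rw [heq]
    rw [← this.tsum_eq, ← tsum_div_const]
    exact tsum_congr fun i => (step_single (c := c i) (hl i) hs).2


lemma log_prime_pos {p : ℕ → ℝ} (hmono : Monotone p) (hp1 : 1 < p 0) (k : ℕ) : 0 < Real.log (p k) :=
  Real.log_pos (hp1.trans_le (hmono (Nat.zero_le k)))

lemma pi_finite {p : ℕ → ℝ} (hmono : Monotone p) (hp1 : 1 < p 0) (hptop : Tendsto p atTop atTop) (u : ℝ) :
    {q : ℕ × ℕ | ((q.2 : ℝ) + 1) * Real.log (p q.1) ≤ u}.Finite := by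
  have hpos := log_prime_pos hmono hp1
  have ht : Tendsto (fun k => Real.log (p k)) atTop atTop := Real.tendsto_log_atTop.comp hptop
  obtain ⟨K, hK⟩ := (ht.eventually (eventually_gt_atTop u)).exists_forall_of_atTop
  obtain ⟨J, hJ⟩ := exists_nat_gt (u / Real.log (p 0))
  refine ((Set.finite_Iio K).prod (Set.finite_Iio J)).subset ?_
  rintro ⟨k, j⟩ hq
  simp only [mem_ofPred_eq] at hq
  have hk := hpos k
  have h1 : Real.log (p k) ≤ u := by
    have : (0:ℝ) ≤ j := Nat.cast_nonneg j
    nlinarith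
  have h2 : (j:ℝ) < J := by
    refine lt_of_le_of_lt ?_ hJ
    rw [le_div_iff₀ (hpos 0)]
    have h3 : Real.log (p 0) ≤ Real.log (p k) :=
      Real.log_le_log (by linarith) (hmono (Nat.zero_le k))
    have : (0:ℝ) ≤ j := Nat.cast_nonneg j
    nlinarith [mul_le_mul_of_nonneg_left h3 this]
  refine ⟨?_, ?_⟩
  · simp only [mem_Iio]
    by_contra h
    exact absurd (hK k (not_lt.1 h)) (not_lt.2 h1)
  · exact_mod_cast h2

lemma card_eq_tsum {ι : Type*} (P : ι → Prop) [DecidablePred P] (hf : {i | P i}.Finite) (c : ℝ) :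
    (∑' i, if P i then c else 0) = (Nat.card {i // P i} : ℝ) * c := by
  rw [tsum_eq_sum (s := hf.toFinset)]
  · rw [Finset.sum_congr rfl (g := fun _ => c)]
    · rw [Finset.sum_const, nsmul_eq_mul]
      congr 2
      exact (Nat.card_eq_card_finite_toFinset hf).symm
    · intro i hi
      rw [if_pos (by simpa using hi)]
  · intro i hi
    rw [if_neg (by simpa using hi)]

noncomputable def cPi (q : ℕ × ℕ) : ℝ := 1 / ((q.2 : ℝ) + 1)
noncomputable def lPi (p : ℕ → ℝ) (q : ℕ × ℕ) : ℝ := ((q.2 : ℝ) + 1) * Real.log (p q.1)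

lemma cPi_nonneg (q : ℕ × ℕ) : 0 ≤ cPi q := by unfold cPi; positivity

lemma pi_summable {p : ℕ → ℝ} (hmono : Monotone p) (hp1 : 1 < p 0) (hptop : Tendsto p atTop atTop) (u : ℝ) :
    Summable fun q => if lPi p q ≤ u then cPi q else 0 := by
  refine summable_of_hasFiniteSupport ((pi_finite hmono hp1 hptop u).subset ?_)
  intro q hq
  by_contra h
  exact hq (if_neg h)

lemma pi_step {p : ℕ → ℝ} (hmono : Monotone p) (hp1 : 1 < p 0) (hptop : Tendsto p atTop atTop) (u : ℝ) :
    PiCount p (Real.exp u) = stepF cPi (lPi p) u := by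
  have hs := pi_summable hmono hp1 hptop u
  rw [stepF, ← (Equiv.prodComm ℕ ℕ).tsum_eq]
  have hs' : Summable fun q : ℕ × ℕ => if lPi p (Equiv.prodComm ℕ ℕ q) ≤ u then cPi (Equiv.prodComm ℕ ℕ q) else 0 :=
    (Equiv.prodComm ℕ ℕ).summable_iff.2 hs
  rw [hs'.tsum_prod, PiCount]
  refine tsum_congr fun j => ?_
  have hP : ∀ k, p k ≤ Real.exp u ^ ((1:ℝ) / (j + 1)) ↔ lPi p (k, j) ≤ u := by
    intro k
    have hk : 0 < p k := by linarith [hmono (Nat.zero_le k)]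
    have hj : (0:ℝ) < j + 1 := by positivity
    rw [← Real.exp_mul, ← Real.log_le_iff_le_exp hk, lPi]
    simp only
    rw [mul_one_div, le_div_iff₀ hj, mul_comm]
  have h1 := card_eq_tsum (fun k => lPi p (k, j) ≤ u)
    (((pi_finite hmono hp1 hptop u).preimage (f := fun k : ℕ => (k, j))
      (fun a _ b _ h => by simpa using h)).subset fun k hk => hk) (1 / ((j:ℝ) + 1))
  refine Eq.trans ?_ (h1.symm.trans (tsum_congr fun k => rfl))
  rw [mul_one_div]
  congr 2
  exact Nat.card_congr (Equiv.subtypeEquivRight hP)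

lemma nval_pos {p : ℕ → ℝ} (hmono : Monotone p) (hp1 : 1 < p 0) (α : ℕ →₀ ℕ) : 1 ≤ nval p α := by
  unfold nval Finsupp.prod
  refine Finset.prod_induction _ (fun x : ℝ => 1 ≤ x) (fun a b ha hb => one_le_mul_of_one_le_of_one_le ha hb)
    le_rfl fun k _ => ?_
  exact one_le_pow₀ (hp1.le.trans (hmono (Nat.zero_le k)))

theorem arith {p : ℕ → ℝ} (hmono : Monotone p) (hp1 : 1 < p 0) (hptop : Tendsto p atTop atTop)
    (hPi : ∀ δ > 0, IntegrableOn (fun u => PiCount p (Real.exp u) * Real.exp (-u) * Real.exp (-δ * u)) (Ioi 0)) :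
    (∀ u h, 0 ≤ h → (Ncount p (Real.exp u) * Real.exp (-u)) * Real.exp (-h) ≤
        Ncount p (Real.exp (u + h)) * Real.exp (-(u + h))) ∧
    (∀ δ > 0, IntegrableOn (fun u => (Ncount p (Real.exp u) * Real.exp (-u)) * Real.exp (-δ * u)) (Ioi 0)) ∧
    ∀ z : ℂ, 0 < z.re →
      ∫ u in Ioi (0:ℝ), ((Ncount p (Real.exp u) * Real.exp (-u) : ℝ) : ℂ) * Complex.exp (-z * u) =
        (1 / (1 + z)) * Complex.exp ((1 + z) *
          ∫ u in Ioi (0:ℝ), ((PiCount p (Real.exp u) * Real.exp (-u) : ℝ) : ℂ) * Complex.exp (-z * u)) := by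
  have hpos := log_prime_pos hmono hp1
  have hpp : ∀ k, 0 < p k := fun k => by linarith [hmono (Nat.zero_le k)]
  have hl : ∀ q, 0 ≤ lPi p q := fun q => mul_nonneg (by positivity) (hpos _).le
  have hfin := pi_summable hmono hp1 hptop
  have hsumPi : ∀ σ : ℝ, 1 < σ → Summable fun q => cPi q * Real.exp (-σ * lPi p q) := by
    intro σ hσ
    refine step_a cPi_nonneg hl hfin (by linarith) ?_
    have := hPi (σ - 1) (by linarith)
    refine this.congr_fun (fun u _ => ?_) measurableSet_Ioi
    simp only
    rw [← pi_step hmono hp1 hptop, mul_assoc, ← Real.exp_add]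
    congr 2; ring
  have hnv := nval_pos hmono hp1
  have hnlog : ∀ α, 0 ≤ Real.log (nval p α) := fun α => Real.log_nonneg (hnv α)
  have hlogn : ∀ α : ℕ →₀ ℕ, Real.log (nval p α) = ∑ k ∈ α.support, (α k : ℝ) * Real.log (p k) := by
    intro α
    rw [nval, Finsupp.prod, Real.log_prod (fun k _ => (pow_pos (hpp k) _).ne')]
    exact Finset.sum_congr rfl fun k _ => Real.log_pow _ _
  have hprod : ∀ s : ℂ, ∀ α : ℕ →₀ ℕ, (α.prod fun k e => (Complex.exp (-s * Real.log (p k))) ^ e) =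
      Complex.exp (-s * Real.log (nval p α)) := by
    intro s α
    rw [hlogn, Finsupp.prod]
    push_cast
    rw [Finset.mul_sum, Complex.exp_sum]
    refine Finset.prod_congr rfl fun k _ => ?_
    rw [← Complex.exp_nat_mul]
    congr 1; ring
  have hterm : ∀ s : ℂ, ∀ q : ℕ × ℕ, (Complex.exp (-s * Real.log (p q.1))) ^ (q.2 + 1) / (q.2 + 1 : ℂ) =
      cPi q * Complex.exp (-s * lPi p q) := by
    intro s q
    rw [← Complex.exp_nat_mul, cPi, lPi]
    push_cast
    rw [one_div, div_eq_inv_mul]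
    congr 2; ring
  have heul : ∀ s : ℂ, 1 < s.re →
      Summable (fun α => Real.exp (-s.re * Real.log (nval p α))) ∧
      HasSum (fun α => Complex.exp (-s * Real.log (nval p α)))
        (Complex.exp (∑' q, cPi q * Complex.exp (-s * lPi p q))) := by
    intro s hs
    have := euler (fun k => Complex.exp (-s * Real.log (p k))) ?_ ?_
    · simp only [hprod, hterm] at this
      refine ⟨this.1.congr fun α => ?_, this.2⟩
      rw [Complex.norm_exp]; simp
    · intro k
      rw [Complex.norm_exp, Real.exp_lt_one_iff]
      have := hpos k
      simp
      nlinarith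
    · simp only [hterm]
      refine (hsumPi s.re hs).congr fun q => ?_
      rw [norm_mul, Complex.norm_exp, Complex.norm_real, Real.norm_of_nonneg (cPi_nonneg q)]
      simp
  have hNfin : ∀ u : ℝ, {α : ℕ →₀ ℕ | Real.log (nval p α) ≤ u}.Finite := by
    intro u
    have h1 := (heul 2 (by norm_num)).1
    have h2 := h1.tendsto_cofinite_zero.eventually (gt_mem_nhds (Real.exp_pos (-2 * u)))
    rw [Filter.eventually_cofinite] at h2
    refine h2.subset fun α hα => ?_
    simp only [mem_ofPred_eq, not_lt] at hα ⊢
    apply Real.exp_le_exp.2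
    simp
    linarith
  have hNs : ∀ u, Summable fun α : ℕ →₀ ℕ => if Real.log (nval p α) ≤ u then (1:ℝ) else 0 := by
    intro u
    refine summable_of_hasFiniteSupport ((hNfin u).subset ?_)
    intro q hq
    by_contra h
    exact hq (if_neg h)
  have hN : ∀ u, (Ncount p (Real.exp u) : ℝ) = stepF (fun _ => 1) (fun α => Real.log (nval p α)) u := by
    intro u
    rw [stepF, card_eq_tsum _ (hNfin u), mul_one, Ncount]
    congr 1
    refine Nat.card_congr (Equiv.subtypeEquivRight fun α => ?_)
    rw [Real.log_le_iff_le_exp (by linarith [hnv α])]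
  have hNb : ∀ s : ℂ, 1 < s.re → _ := fun s hs => step_b (c := fun _ : ℕ →₀ ℕ => (1:ℝ))
    (l := fun α => Real.log (nval p α)) (fun _ => zero_le_one) hnlog hNs (s := s) (by linarith)
    (by simpa using (heul s hs).1)
  have hmulexp : ∀ (A : ℝ) (z : ℂ) (u : ℝ), ((A * Real.exp (-u) : ℝ) : ℂ) * Complex.exp (-z * u) =
      (A : ℂ) * Complex.exp (-(1 + z) * u) := by
    intro A z u
    push_cast
    rw [mul_assoc, ← Complex.exp_add]
    congr 2; ring
  refine ⟨?_, ?_, ?_⟩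
  · intro u h hh
    rw [mul_assoc, ← Real.exp_add, neg_add, hN, hN]
    refine mul_le_mul_of_nonneg_right ?_ (Real.exp_pos _).le
    exact stepF_mono (fun _ => zero_le_one) hNs (by linarith)
  · intro δ hδ
    have h1 := (hNb (1 + δ) (by simpa using hδ)).1.re
    refine IntegrableOn.congr_fun h1 (fun u _ => ?_) measurableSet_Ioi
    rw [← hN]
    rw [show (-(1 + (δ:ℂ)) * (u:ℂ)) = ((-(1+δ) * u : ℝ) : ℂ) by push_cast; ring, ← Complex.ofReal_exp,
      ← Complex.ofReal_mul]
    simp only [RCLike.re_to_complex, Complex.ofReal_re]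
    rw [mul_assoc, ← Real.exp_add]
    congr 2; ring
  · intro z hz
    have hsr : 1 < (1 + z).re := by simpa using hz
    have hs0 : (1 + z) ≠ 0 := by intro h; rw [h] at hsr; simp at hsr; linarith
    simp_rw [hmulexp, hN, pi_step hmono hp1 hptop]
    rw [(hNb (1+z) hsr).2, (step_b cPi_nonneg hl hfin (by linarith) (hsumPi _ hsr)).2,
      mul_div_cancel₀ _ hs0, ← (heul _ hsr).2.tsum_eq]
    simp only [Complex.ofReal_one, one_mul]
    ring


/-- The oscillating main term. -/
noncomputable def gB {k : ℕ} (t y b : Fin k → ℝ) (u : ℝ) : ℝ := 1 + ∑ j, b j * Real.cos (t j * u + y j)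

lemma gB_cont {k : ℕ} (t y b : Fin k → ℝ) : Continuous (gB t y b) := by
  unfold gB; fun_prop

lemma gB_bound {k : ℕ} (t y b : Fin k → ℝ) (u : ℝ) : |gB t y b u| ≤ 1 + ∑ j, |b j| := by
  unfold gB
  refine (abs_add_le _ _).trans ?_
  rw [abs_one]
  gcongr
  refine (Finset.abs_sum_le_sum_abs _ _).trans (Finset.sum_le_sum fun j _ => ?_)
  rw [abs_mul]
  exact mul_le_of_le_one_right (abs_nonneg _) (Real.abs_cos_le_one _)

theorem pi_decomp {p : ℕ → ℝ} (hmono : Monotone p) (hp1 : 1 < p 0) (hptop : Tendsto p atTop atTop)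
    {k : ℕ} (t y b : Fin k → ℝ)
    (hL1 : ∫⁻ x in Set.Ici (2:ℝ), ENNReal.ofReal
      (|PiCount p x - x / Real.log x *
        (1 + ∑ j, b j * Real.cos (t j * Real.log x + y j))| / x ^ 2) < ⊤) :
    ∃ e : ℝ → ℝ, Integrable e ∧ (∀ u ≤ 0, e u = 0) ∧
      ∀ u > 0, PiCount p (Real.exp u) * Real.exp (-u) = e u + qk u * gB t y b u := by
  have hPmono : Monotone (fun u => PiCount p (Real.exp u)) := by
    have : (fun u => PiCount p (Real.exp u)) = stepF cPi (lPi p) := funext (pi_step hmono hp1 hptop)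
    rw [this]; exact stepF_mono cPi_nonneg (pi_summable hmono hp1 hptop)
  have hPnn : ∀ u, 0 ≤ PiCount p (Real.exp u) := fun u => tsum_nonneg fun j => by positivity
  have hPm : Measurable (fun u => PiCount p (Real.exp u)) := hPmono.measurable
  have hgm : Measurable (gB t y b) := (gB_cont t y b).measurable
  set B := 1 + ∑ j, |b j| with hB
  have hgB := gB_bound t y b
  have hB0 : 0 ≤ B := (abs_nonneg _).trans (hgB 0)
  set d : ℝ → ℝ := fun u => PiCount p (Real.exp u) * Real.exp (-u) - qk u * gB t y b u with hd
  have hdm : Measurable d := (hPm.mul (by fun_prop)).sub (qk_measurable.mul hgm)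
  have hl2 : 0 < Real.log 2 := Real.log_pos (by norm_num)
  refine ⟨(Ioi 0).indicator d, ?_, ?_, ?_⟩
  · rw [integrable_indicator_iff measurableSet_Ioi, ← Ioo_union_Ici_eq_Ioi hl2]
    refine IntegrableOn.union ?_ ?_
    · refine Measure.integrableOn_of_bounded (M := PiCount p (Real.exp (Real.log 2)) + B)
        (by simp) hdm.aestronglyMeasurable ?_
      refine (ae_restrict_iff' measurableSet_Ioo).2 (Eventually.of_forall fun u hu => ?_)
      rw [Real.norm_eq_abs, hd]
      simp only
      refine (abs_sub _ _).trans (add_le_add ?_ ?_)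
      · rw [abs_of_nonneg (mul_nonneg (hPnn u) (Real.exp_pos _).le)]
        have h1 : Real.exp (-u) ≤ 1 := Real.exp_le_one_iff.2 (by linarith [hu.1])
        exact (mul_le_of_le_one_right (hPnn u) h1).trans (hPmono hu.2.le)
      · rw [abs_mul]
        have := mul_le_mul (qk_abs hu.1) (hgB u) (abs_nonneg _) zero_le_one
        linarith
    · set D : ℝ → ℝ := fun u => PiCount p (Real.exp u) * Real.exp (-u) - gB t y b u / u with hD
      have hDm : Measurable D := (hPm.mul (by fun_prop)).sub (hgm.div measurable_id)
      have hDi : IntegrableOn D (Ici (Real.log 2)) := by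
        refine ⟨hDm.aestronglyMeasurable, ?_⟩
        have himg : Real.exp '' Ici (Real.log 2) = Ici 2 := by
          ext x
          constructor
          · rintro ⟨u, hu, rfl⟩
            exact (Real.log_le_iff_le_exp (by norm_num)).1 hu
          · intro hx
            have hx0 : (0:ℝ) < x := lt_of_lt_of_le (by norm_num) hx
            exact ⟨Real.log x, Real.log_le_log (by norm_num) hx, Real.exp_log hx0⟩
        rw [← himg, lintegral_image_eq_lintegral_abs_deriv_mul measurableSet_Ici
          (fun u _ => (Real.hasDerivAt_exp u).hasDerivWithinAt) (Real.exp_injective.injOn)] at hL1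
        refine lt_of_le_of_lt (le_of_eq ?_) hL1
        refine setLIntegral_congr_fun measurableSet_Ici fun u hu => ?_
        have hu0 : 0 < u := lt_of_lt_of_le hl2 hu
        rw [← ENNReal.ofReal_mul (abs_nonneg _), ← ofReal_norm]
        congr 1
        rw [Real.log_exp, abs_of_pos (Real.exp_pos u), Real.norm_eq_abs, hD]
        simp only
        have h1 : PiCount p (Real.exp u) * Real.exp (-u) - gB t y b u / u =
          (PiCount p (Real.exp u) - Real.exp u / u * (1 + ∑ j, b j * Real.cos (t j * u + y j))) * Real.exp (-u) := by
          rw [Real.exp_neg, gB]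
          generalize (∑ j, b j * Real.cos (t j * u + y j)) = w
          have := (Real.exp_pos u).ne'
          field_simp
        rw [h1, abs_mul, abs_of_pos (Real.exp_pos (-u)), Real.exp_neg]
        generalize |PiCount p (Real.exp u) - Real.exp u / u * (1 + ∑ j, b j * Real.cos (t j * u + y j))| = w
        have := (Real.exp_pos u).ne'
        field_simp
      have hR : IntegrableOn (fun u => gB t y b u * Real.exp (-u) / u) (Ici (Real.log 2)) := by
        have h1 : IntegrableOn (fun u : ℝ => B / Real.log 2 * Real.exp (-u)) (Ici (Real.log 2)) := by
          refine Integrable.const_mul ?_ _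
          have := (integrableOn_exp_neg_Ioi (Real.log 2))
          exact IntegrableOn.congr_set_ae this Ioi_ae_eq_Ici.symm
        refine Integrable.mono' h1 ?_ ?_
        · exact ((hgm.mul (by fun_prop)).div measurable_id).aestronglyMeasurable
        · refine (ae_restrict_iff' measurableSet_Ici).2 (Eventually.of_forall fun u hu => ?_)
          have hu0 : 0 < u := lt_of_lt_of_le hl2 hu
          rw [Real.norm_eq_abs, abs_div, abs_mul, abs_of_pos (Real.exp_pos _), abs_of_pos hu0,
            mul_div_right_comm]
          have hu' : Real.log 2 ≤ u := hu
          gcongr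
          exact hgB u
      refine (hDi.add hR).congr_fun (fun u hu => ?_) measurableSet_Ici
      have hu0 : 0 < u := lt_of_lt_of_le hl2 hu
      simp only [hD, hd, qk, Pi.add_apply]
      field_simp
      ring
  · intro u hu
    exact indicator_of_notMem (by simpa using hu) _
  · intro u hu
    rw [indicator_of_mem (by exact hu), hd]
    ring

theorem pi_laplace {P e g : ℝ → ℝ} (he : Integrable e) (h0 : ∀ u ≤ 0, e u = 0)
    (hg : Measurable g) (B : ℝ) (hB : ∀ u, |g u| ≤ B) (hP : ∀ u > 0, P u = e u + qk u * g u) :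
    (∀ δ > 0, IntegrableOn (fun u => P u * Real.exp (-δ * u)) (Ioi 0)) ∧
    ∀ z : ℂ, 0 < z.re → ∫ u in Ioi (0:ℝ), ((P u : ℝ) : ℂ) * Complex.exp (-z * u) =
      (∫ u, (e u : ℂ) * Complex.exp (-z * u)) +
      ∫ u in Ioi (0:ℝ), ((qk u * g u : ℝ) : ℂ) * Complex.exp (-z * u) := by
  have hi : ∀ z : ℂ, 0 < z.re → IntegrableOn (fun u : ℝ => (e u : ℂ) * Complex.exp (-z * u)) (Ioi 0) :=
    fun z hz => (damp_integrable he h0 hz.le).integrableOn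
  have hcongr : ∀ z : ℂ, ∀ u ∈ Ioi (0:ℝ), (e u : ℂ) * Complex.exp (-z * u) +
      ((qk u * g u : ℝ) : ℂ) * Complex.exp (-z * u) = ((P u : ℝ) : ℂ) * Complex.exp (-z * u) := by
    intro z u hu
    rw [hP u hu]; push_cast; ring
  constructor
  · intro δ hδ
    have hδ' : 0 < (δ:ℂ).re := by simpa using hδ
    have h1 : IntegrableOn (fun u : ℝ => (e u : ℂ) * Complex.exp (-(δ:ℂ) * u) +
      ((qk u * g u : ℝ) : ℂ) * Complex.exp (-(δ:ℂ) * u)) (Ioi 0) :=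
      (hi δ hδ').add (qk_integrable hδ' g hg B hB)
    have h2 := (h1.congr_fun (hcongr δ) measurableSet_Ioi).re
    refine IntegrableOn.congr_fun h2 (fun u _ => ?_) measurableSet_Ioi
    rw [show (-(δ:ℂ) * (u:ℂ)) = ((-δ * u : ℝ) : ℂ) by push_cast; ring, ← Complex.ofReal_exp,
      ← Complex.ofReal_mul]
    simp only [RCLike.re_to_complex, Complex.ofReal_re]
  · intro z hz
    rw [← setIntegral_congr_fun measurableSet_Ioi (hcongr z)]
    refine (integral_add (hi z hz) (qk_integrable hz g hg B hB)).trans ?_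
    congr 1
    refine setIntegral_eq_integral_of_forall_compl_eq_zero fun u hu => ?_
    rw [h0 u (by simpa using hu)]; simp

/-- Frequencies. -/
noncomputable def tauF {k : ℕ} (t : Fin k → ℝ) : Fin k ⊕ Fin k → ℝ := Sum.elim t (fun j => -t j)

/-- Coefficients. -/
noncomputable def betaF {k : ℕ} (y b : Fin k → ℝ) : Fin k ⊕ Fin k → ℂ :=
  Sum.elim (fun j => b j / 2 * Complex.exp (y j * Complex.I)) (fun j => b j / 2 * Complex.exp (-y j * Complex.I))

/-- `Σ β_i Λ(z - iτ_i)`. -/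
noncomputable def SF {ι : Type*} [Fintype ι] (τ : ι → ℝ) (β : ι → ℂ) (z : ℂ) : ℂ :=
  ∑ i, β i * Lam (z - τ i * Complex.I)

lemma gB_laplace {k : ℕ} (t y b : Fin k → ℝ) {z : ℂ} (hz : 0 < z.re) :
    ∫ u in Ioi (0:ℝ), ((qk u * gB t y b u : ℝ) : ℂ) * Complex.exp (-z * u) =
      Lam z + SF (tauF t) (betaF y b) z := by
  have hre : ∀ i, 0 < (z - tauF t i * Complex.I).re := by intro i; simpa using hz
  have hq : ∀ z : ℂ, 0 < z.re → IntegrableOn (fun u : ℝ => ((qk u : ℝ) : ℂ) * Complex.exp (-z * u)) (Ioi 0) := by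
    intro z hz
    simpa using qk_integrable hz (fun _ => 1) measurable_const 1 (by simp)
  have hpt : ∀ u : ℝ, ((qk u * gB t y b u : ℝ) : ℂ) * Complex.exp (-z * u) =
      ((qk u : ℝ) : ℂ) * Complex.exp (-z * u) +
      ∑ i, betaF y b i * (((qk u : ℝ) : ℂ) * Complex.exp (-(z - tauF t i * Complex.I) * u)) := by
    intro u
    rw [Fintype.sum_sum_type]
    simp only [tauF, betaF, Sum.elim_inl, Sum.elim_inr, gB]
    rw [← Finset.sum_add_distrib]
    push_cast
    rw [mul_add, add_mul, mul_one, Finset.mul_sum, Finset.sum_mul]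
    congr 1
    refine Finset.sum_congr rfl fun j _ => ?_
    rw [Complex.cos]
    have e1 : Complex.exp (-(z - t j * Complex.I) * u) = Complex.exp (-z * u) * Complex.exp (t j * u * Complex.I) := by
      rw [← Complex.exp_add]; congr 1; ring
    have e2 : Complex.exp (-(z - -t j * Complex.I) * u) = Complex.exp (-z * u) * Complex.exp (-(t j * u) * Complex.I) := by
      rw [← Complex.exp_add]; congr 1; ring
    rw [e1, e2, add_mul, neg_add, add_mul, Complex.exp_add, Complex.exp_add]
    ring
  simp_rw [hpt]
  rw [integral_add (hq z hz) (integrable_finsetSum _ fun i _ => (hq _ (hre i)).const_mul _),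
    integral_finsetSum _ fun i _ => (hq _ (hre i)).const_mul _, frullani hz, SF]
  congr 1
  refine Finset.sum_congr rfl fun i _ => ?_
  rw [integral_const_mul, frullani (hre i)]


/-- Closed right half plane. -/
def Hc : Set ℂ := {z | 0 ≤ z.re}
/-- Open right half plane. -/
def Ho : Set ℂ := {z | 0 < z.re}

lemma Ho_sub : Ho ⊆ Hc := fun z (h : 0 < z.re) => (show 0 ≤ z.re from h.le)

lemma Lam_diffAt {z : ℂ} (hz : z ∈ Hc) (h0 : z ≠ 0) : DifferentiableAt ℂ Lam z := by
  have hz' : 0 ≤ z.re := hz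
  have h1 : z ∈ Complex.slitPlane := by
    rw [Complex.mem_slitPlane_iff]
    by_contra h
    push Not at h
    exact h0 (Complex.ext (le_antisymm h.1 hz') h.2)
  have h2 : 1 + z ∈ Complex.slitPlane := by
    left; simp; linarith
  unfold Lam
  exact ((differentiableAt_id.const_add (1:ℂ)).clog h2).sub (differentiableAt_id.clog h1)

lemma clog_bound {w : ℂ} (hw : w ≠ 0) (h1 : ‖w‖ ≤ 1) : ‖Complex.log w‖ ≤ 6 * ‖w‖ ^ (-(1/2) : ℝ) := by
  have hpos : 0 < ‖w‖ := norm_pos_iff.2 hw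
  have h2 : |Real.log ‖w‖ * ‖w‖ ^ (1/2 : ℝ)| < 1 / (1/2 : ℝ) :=
    Real.abs_log_mul_self_rpow_lt _ _ hpos h1 (by norm_num)
  have hr : 0 < ‖w‖ ^ (1/2 : ℝ) := Real.rpow_pos_of_pos hpos _
  have hr1 : ‖w‖ ^ (1/2 : ℝ) ≤ 1 := Real.rpow_le_one hpos.le h1 (by norm_num)
  have h3 : ‖Complex.log w‖ ≤ |Real.log ‖w‖| + Real.pi := by
    refine (Complex.norm_le_abs_re_add_abs_im _).trans ?_
    rw [Complex.log_re, Complex.log_im]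
    gcongr
    exact Complex.abs_arg_le_pi w
  rw [Real.rpow_neg hpos.le, ← div_eq_mul_inv, le_div_iff₀ hr]
  rw [abs_mul, abs_of_pos hr] at h2
  have := Real.pi_lt_four
  nlinarith [Real.pi_pos]

lemma bdd_of_cont {f : ℂ → ℂ} {s : Set ℂ} {z0 : ℂ} (h : ContinuousWithinAt f s z0) :
    ∃ C, 0 ≤ C ∧ ∀ᶠ z in 𝓝[s] z0, ‖f z‖ ≤ C := by
  refine ⟨‖f z0‖ + 1, by positivity, ?_⟩
  have := (h.norm.tendsto).eventually (gt_mem_nhds (lt_add_one ‖f z0‖))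
  filter_upwards [this] with z hz using hz.le

lemma pow_dom_integrable (t0 ε θ : ℝ) (hθ : θ < 1) :
    Integrable (fun t : ℝ => (Ioo 0 ε).indicator (fun r => r ^ (-θ)) |t - t0|) := by
  set f : ℝ → ℝ := (Ioo 0 ε).indicator (fun r => r ^ (-θ)) with hf
  have h1 : Integrable f := by
    rw [hf, integrable_indicator_iff measurableSet_Ioo]
    rcases le_or_gt ε 0 with h | h
    · rw [Ioo_eq_empty (by linarith)]; exact integrableOn_empty
    · have := (intervalIntegral.intervalIntegrable_rpow' (a := 0) (b := ε) (r := -θ) (by linarith))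
      rw [intervalIntegrable_iff_integrableOn_Ioo_of_le h.le] at this
      exact this
  have h2 : Integrable (fun x : ℝ => f |x|) := by
    refine (h1.add h1.comp_neg).congr (Eventually.of_forall fun x => ?_)
    simp only [Pi.add_apply]
    have hneg : ∀ x ≤ 0, f x = 0 := fun x hx => indicator_of_notMem (fun h => absurd h.1 (not_lt.2 hx)) _
    rcases le_total x 0 with h | h
    · rw [hneg x h, abs_of_nonpos h, zero_add]
    · rw [hneg (-x) (by linarith), abs_of_nonneg h, add_zero]
  exact h2.comp_sub_right t0

/-- Gluing of local bounds. -/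
lemma glue (G : ℂ → ℂ) (hloc : ∀ t0 : ℝ, ∃ C θ : ℝ, 0 ≤ C ∧ 0 ≤ θ ∧ θ < 1 ∧
      ∀ᶠ z in 𝓝[Ho] ((t0 : ℂ) * Complex.I), ‖G z‖ ≤ C * ‖z - t0 * Complex.I‖ ^ (-θ)) (R : ℝ) :
    ∃ D : ℝ → ℝ, Integrable D ∧ ∃ δ0 > 0, ∀ᵐ t : ℝ, |t| ≤ R → ∀ δ : ℝ, 0 < δ → δ < δ0 →
      ‖G (δ + t * Complex.I)‖ ≤ D t := by
  let P : Set ℝ → Prop := fun S => ∃ D : ℝ → ℝ, Integrable D ∧ ∃ δ0 > 0, ∀ᵐ t : ℝ, t ∈ S →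
    ∀ δ : ℝ, 0 < δ → δ < δ0 → ‖G (δ + t * Complex.I)‖ ≤ D t
  have hP : P (Icc (-R) R) := by
    refine isCompact_Icc.induction_on (p := P) ?_ ?_ ?_ ?_
    · exact ⟨fun _ => 0, integrable_zero _ _ _, 1, one_pos, by simp⟩
    · rintro S T hST ⟨D, hD, δ0, h0, h⟩
      exact ⟨D, hD, δ0, h0, h.mono fun t ht hS => ht (hST hS)⟩
    · rintro S T ⟨D, hD, δ0, h0, h⟩ ⟨D', hD', δ0', h0', h'⟩
      refine ⟨fun t => |D t| + |D' t|, hD.abs.add hD'.abs, min δ0 δ0', lt_min h0 h0', ?_⟩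
      filter_upwards [h, h'] with t h1 h2 hST δ hδ hδ2
      rcases hST with hS | hS
      · have := h1 hS δ hδ (hδ2.trans_le (min_le_left _ _))
        have := le_abs_self (D t)
        have := abs_nonneg (D' t)
        linarith
      · have := h2 hS δ hδ (hδ2.trans_le (min_le_right _ _))
        have := le_abs_self (D' t)
        have := abs_nonneg (D t)
        linarith
    · intro t0 _
      obtain ⟨C, θ, hC, hθ0, hθ1, hev⟩ := hloc t0
      obtain ⟨ε, hε, hball⟩ := Metric.mem_nhdsWithin_iff.1 hev
      refine ⟨Ioo (t0 - ε/2) (t0 + ε/2), mem_nhdsWithin_of_mem_nhds (Ioo_mem_nhds (by linarith) (by linarith)),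
        fun t => C * (Ioo 0 ε).indicator (fun r => r ^ (-θ)) |t - t0|,
        (pow_dom_integrable t0 ε θ hθ1).const_mul C, ε/2, by linarith, ?_⟩
      have hne : ∀ᵐ t : ℝ, t ≠ t0 := by simp [ae_iff]
      filter_upwards [hne] with t hne ht δ hδ hδ2
      have hz : ((δ : ℂ) + t * Complex.I) - t0 * Complex.I = (δ : ℂ) + ((t - t0 : ℝ) : ℂ) * Complex.I := by
        push_cast; ring
      have habs : |t - t0| < ε/2 := by rw [abs_lt]; constructor <;> linarith [ht.1, ht.2]
      have hpos : 0 < |t - t0| := abs_pos.2 (sub_ne_zero.2 hne)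
      have hle : ‖((δ : ℂ) + t * Complex.I) - t0 * Complex.I‖ < ε := by
        rw [hz]
        refine (norm_add_le _ _).trans_lt ?_
        rw [norm_mul, Complex.norm_real, Complex.norm_real, Complex.norm_I, mul_one, Real.norm_eq_abs,
          Real.norm_eq_abs, abs_of_pos hδ]
        linarith
      have hge : |t - t0| ≤ ‖((δ : ℂ) + t * Complex.I) - t0 * Complex.I‖ := by
        rw [hz]
        have := Complex.abs_im_le_norm ((δ : ℂ) + ((t - t0 : ℝ) : ℂ) * Complex.I)
        simpa using this
      have hG := hball (a := (δ : ℂ) + t * Complex.I) ⟨by rw [Metric.mem_ball, dist_eq_norm]; exact hle,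
        by simp [Ho, hδ]⟩
      refine le_trans hG ?_
      rw [indicator_of_mem (by exact ⟨hpos, by linarith⟩)]
      refine mul_le_mul_of_nonneg_left ?_ hC
      exact Real.rpow_le_rpow_of_nonpos hpos hge (by linarith)
  obtain ⟨D, hD, δ0, h0, h⟩ := hP
  exact ⟨D, hD, δ0, h0, h.mono fun t ht hS => ht (abs_le.1 hS)⟩


/-- The exponent. -/
noncomputable def QF {ι : Type*} [Fintype ι] (τ : ι → ℝ) (β : ι → ℂ) (E : ℂ → ℂ) (z : ℂ) : ℂ :=
  z * (Lam z + E z) + (1 + z) * SF τ β z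

/-- The boundary function. -/
noncomputable def GF {ι : Type*} [Fintype ι] (τ : ι → ℝ) (β : ι → ℂ) (E : ℂ → ℂ) (z : ℂ) : ℂ :=
  Complex.exp (E z) * (1 / z) * (Complex.exp (QF τ β E z) - Complex.exp (SF τ β 0))

lemma sub_mem_Hc {z : ℂ} (hz : z ∈ Hc) (t : ℝ) : z - t * Complex.I ∈ Hc := by
  have h : 0 ≤ z.re := hz
  show 0 ≤ (z - t * Complex.I).re
  simpa using h

lemma Lam_shift_diffAt {z : ℂ} (hz : z ∈ Hc) {t : ℝ} (h : z ≠ t * Complex.I) :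
    DifferentiableAt ℂ (fun z => Lam (z - t * Complex.I)) z :=
  (Lam_diffAt (sub_mem_Hc hz t) (sub_ne_zero.2 h)).comp z (differentiableAt_id.sub_const _)

lemma SF_diffAt {ι : Type*} [Fintype ι] (τ : ι → ℝ) (β : ι → ℂ) {z : ℂ} (hz : z ∈ Hc)
    (h : ∀ i, z ≠ τ i * Complex.I) : DifferentiableAt ℂ (SF τ β) z := by
  unfold SF
  exact DifferentiableAt.fun_sum fun i _ => (Lam_shift_diffAt hz (h i)).const_mul _

lemma QF_cont {ι : Type*} [Fintype ι] (τ : ι → ℝ) (β : ι → ℂ) {E : ℂ → ℂ} (hE : ContinuousOn E Hc)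
    {z : ℂ} (hz : z ∈ Hc) (h0 : z ≠ 0) (h : ∀ i, z ≠ τ i * Complex.I) :
    ContinuousWithinAt (QF τ β E) Hc z := by
  unfold QF
  have h1 := (Lam_diffAt hz h0).continuousAt.continuousWithinAt (s := Hc)
  have h2 := (SF_diffAt τ β hz h).continuousAt.continuousWithinAt (s := Hc)
  exact (continuousWithinAt_id.mul (h1.add (hE z hz))).add
    ((continuousWithinAt_const.add continuousWithinAt_id).mul h2)

lemma GF_cont {ι : Type*} [Fintype ι] (τ : ι → ℝ) (β : ι → ℂ) {E : ℂ → ℂ} (hE : ContinuousOn E Hc)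
    {z : ℂ} (hz : z ∈ Hc) (h0 : z ≠ 0) (h : ∀ i, z ≠ τ i * Complex.I) :
    ContinuousWithinAt (GF τ β E) Hc z := by
  unfold GF
  exact ((hE z hz).cexp.mul (continuousWithinAt_const.div continuousWithinAt_id h0)).mul
    ((QF_cont τ β hE hz h0 h).cexp.sub continuousWithinAt_const)

lemma zero_mem_Hc : (0:ℂ) ∈ Hc := by show 0 ≤ (0:ℂ).re; simp

lemma it_mem_Hc (t : ℝ) : (t : ℂ) * Complex.I ∈ Hc := by show 0 ≤ ((t : ℂ) * Complex.I).re; simp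

lemma Ho_ne {z : ℂ} (hz : z ∈ Ho) : z ≠ 0 := by
  rintro rfl
  have : (0:ℝ) < (0:ℂ).re := hz
  simp at this

lemma GF_local_zero {ι : Type*} [Fintype ι] (τ : ι → ℝ) (β : ι → ℂ) {E : ℂ → ℂ}
    (hE : ContinuousOn E Hc) (hτ : ∀ i, τ i ≠ 0) :
    ∃ C θ : ℝ, 0 ≤ C ∧ 0 ≤ θ ∧ θ < 1 ∧
      ∀ᶠ z in 𝓝[Ho] (0 : ℂ), ‖GF τ β E z‖ ≤ C * ‖z‖ ^ (-θ) := by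
  have hE0 : ContinuousWithinAt E Ho 0 := (hE 0 zero_mem_Hc).mono Ho_sub
  have hS0 : DifferentiableAt ℂ (SF τ β) 0 := SF_diffAt τ β zero_mem_Hc fun i h => by
    have := mul_eq_zero.1 h.symm
    simp [hτ i] at this
  obtain ⟨CE, hCE0, hCE⟩ := bdd_of_cont hE0
  obtain ⟨CX, hCX0, hCX⟩ := bdd_of_cont hE0.cexp
  obtain ⟨CS, hCS0, hCS⟩ := bdd_of_cont (hS0.continuousAt.continuousWithinAt (s := Ho))
  have hl1 : ContinuousWithinAt (fun z : ℂ => Complex.log (1 + z)) Ho 0 := by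
    apply ContinuousAt.continuousWithinAt
    exact (continuousAt_const.add continuousAt_id).clog (by simp)
  obtain ⟨CL, hCL0, hCL⟩ := bdd_of_cont hl1
  obtain ⟨CD, hCD0, hCD⟩ := hS0.hasDerivAt.isBigO_sub.exists_nonneg
  have hCD' := hCD.bound.filter_mono (nhdsWithin_le_nhds (s := Ho))
  have hn1 : ∀ᶠ z in 𝓝[Ho] (0:ℂ), ‖z‖ ≤ 1 := by
    have : ∀ᶠ z in 𝓝 (0:ℂ), ‖z‖ < 1 := (continuous_norm.tendsto (0:ℂ)).eventually (gt_mem_nhds (by simp))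
    exact (this.filter_mono nhdsWithin_le_nhds).mono fun z hz => hz.le
  set K := 6 + CL + CE + CD + CS with hK
  have hK0 : 0 < K := by positivity
  -- difference bound
  have hdiff : ∀ᶠ z in 𝓝[Ho] (0:ℂ), ‖QF τ β E z - SF τ β 0‖ ≤ K * ‖z‖ ^ (1/2 : ℝ) := by
    filter_upwards [hCE, hCS, hCL, hCD', hn1, self_mem_nhdsWithin] with z h1 h2 h3 h4 h5 hz
    have hz0 := Ho_ne hz
    have hpos : 0 < ‖z‖ := norm_pos_iff.2 hz0
    have h6 := clog_bound hz0 h5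
    have hr : ‖z‖ ≤ ‖z‖ ^ (1/2 : ℝ) := by
      conv_lhs => rw [← Real.rpow_one ‖z‖]
      exact Real.rpow_le_rpow_of_exponent_ge hpos h5 (by norm_num)
    have h7 : ‖z‖ * ‖z‖ ^ (-(1/2) : ℝ) = ‖z‖ ^ (1/2 : ℝ) := by
      conv_lhs => rw [← Real.rpow_one_add' hpos.le (by norm_num)]
      norm_num
    have e : QF τ β E z - SF τ β 0 = z * Complex.log (1 + z) - z * Complex.log z + z * E z +
        (SF τ β z - SF τ β 0) + z * SF τ β z := by
      unfold QF Lam; ring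
    rw [e]
    simp only [sub_zero] at h4
    calc _ ≤ ‖z‖ * ‖Complex.log (1 + z)‖ + ‖z‖ * ‖Complex.log z‖ + ‖z‖ * ‖E z‖ +
          ‖SF τ β z - SF τ β 0‖ + ‖z‖ * ‖SF τ β z‖ := by
          refine (norm_add_le _ _).trans (add_le_add ((norm_add_le _ _).trans (add_le_add
            ((norm_add_le _ _).trans (add_le_add ((norm_sub_le _ _).trans ?_) ?_)) le_rfl)) ?_) <;>
          simp only [norm_mul, le_refl]
      _ ≤ ‖z‖ * CL + ‖z‖ * (6 * ‖z‖ ^ (-(1/2) : ℝ)) + ‖z‖ * CE + CD * ‖z‖ + ‖z‖ * CS := by gcongr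
      _ = 6 * ‖z‖ ^ (1/2 : ℝ) + ‖z‖ * (CL + CE + CD + CS) := by rw [← h7]; ring
      _ ≤ 6 * ‖z‖ ^ (1/2 : ℝ) + ‖z‖ ^ (1/2 : ℝ) * (CL + CE + CD + CS) := by gcongr
      _ = _ := by rw [hK]; ring
  have hsmall : ∀ᶠ z in 𝓝[Ho] (0:ℂ), K * ‖z‖ ^ (1/2 : ℝ) ≤ 1 := by
    have hc : ContinuousAt (fun z : ℂ => K * ‖z‖ ^ (1/2 : ℝ)) 0 :=
      continuousAt_const.mul (continuous_norm.continuousAt.rpow_const (Or.inr (by norm_num)))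
    have : ∀ᶠ z in 𝓝 (0:ℂ), K * ‖z‖ ^ (1/2 : ℝ) < 1 :=
      hc.tendsto.eventually (gt_mem_nhds (by simp))
    exact (this.filter_mono nhdsWithin_le_nhds).mono fun z hz => hz.le
  refine ⟨CX * (‖Complex.exp (SF τ β 0)‖ * (2 * K)), 1/2, by positivity, by norm_num, by norm_num, ?_⟩
  filter_upwards [hdiff, hsmall, hCX, self_mem_nhdsWithin] with z h1 h2 h3 hz
  have hz0 := Ho_ne hz
  have hpos : 0 < ‖z‖ := norm_pos_iff.2 hz0
  have h4 : Complex.exp (QF τ β E z) - Complex.exp (SF τ β 0) =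
      Complex.exp (SF τ β 0) * (Complex.exp (QF τ β E z - SF τ β 0) - 1) := by
    rw [mul_sub, ← Complex.exp_add]; simp
  have h5 := Complex.norm_exp_sub_one_le (h1.trans h2)
  have h7 : 1 / ‖z‖ * ‖z‖ ^ (1/2 : ℝ) = ‖z‖ ^ (-(1/2) : ℝ) := by
    rw [one_div, ← Real.rpow_neg_one, ← Real.rpow_add hpos]; norm_num
  rw [GF, h4, norm_mul, norm_mul, norm_mul, norm_div, norm_one]
  calc _ ≤ CX * (1 / ‖z‖) * (‖Complex.exp (SF τ β 0)‖ * (2 * (K * ‖z‖ ^ (1/2 : ℝ)))) := by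
        gcongr
        exact h5.trans (by linarith)
    _ = CX * (‖Complex.exp (SF τ β 0)‖ * (2 * K)) * (1 / ‖z‖ * ‖z‖ ^ (1/2 : ℝ)) := by ring
    _ = _ := by rw [h7]

lemma GF_local_tau {ι : Type*} [Fintype ι] (τ : ι → ℝ) (β : ι → ℂ) {E : ℂ → ℂ}
    (hE : ContinuousOn E Hc) (hτ : ∀ i, τ i ≠ 0) (hinj : Function.Injective τ)
    (hκ : ∀ i, ((1 + τ i * Complex.I) * β i).re < 1) (i : ι) :
    ∃ C θ : ℝ, 0 ≤ C ∧ 0 ≤ θ ∧ θ < 1 ∧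
      ∀ᶠ z in 𝓝[Ho] ((τ i : ℂ) * Complex.I), ‖GF τ β E z‖ ≤ C * ‖z - τ i * Complex.I‖ ^ (-θ) := by
  set z0 : ℂ := (τ i : ℂ) * Complex.I with hz0
  set κ := (1 + τ i * Complex.I) * β i with hκd
  have hzH : z0 ∈ Hc := it_mem_Hc _
  have hzne : z0 ≠ 0 := by simp [hz0, hτ i]
  have hE0 : ContinuousWithinAt E Ho z0 := (hE z0 hzH).mono Ho_sub
  have hXc : ContinuousWithinAt (fun z => Complex.exp (E z) * (1 / z)) Ho z0 :=
    hE0.cexp.mul (continuousWithinAt_const.div continuousWithinAt_id hzne)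
  obtain ⟨CX, hCX0, hCX⟩ := bdd_of_cont hXc
  set Rg : ℂ → ℂ := fun z => z * (Lam z + E z) + (1 + z) * (∑ j ∈ Finset.univ.erase i, β j * Lam (z - τ j * Complex.I)) +
    (1 + z) * (β i * Complex.log (1 + (z - z0))) with hRg
  have hRc : ContinuousWithinAt Rg Ho z0 := by
    have h1 := (Lam_diffAt hzH hzne).continuousAt.continuousWithinAt (s := Ho)
    have h2 : ContinuousAt (fun z => ∑ j ∈ Finset.univ.erase i, β j * Lam (z - τ j * Complex.I)) z0 := by
      apply tendsto_finsetSum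
      intro j hj
      refine ((Lam_shift_diffAt hzH ?_).const_mul _).continuousAt
      intro h
      have := mul_right_cancel₀ Complex.I_ne_zero (hz0.symm.trans h)
      exact (Finset.ne_of_mem_erase hj) (hinj (Complex.ofReal_injective this)).symm
    have h3 : ContinuousAt (fun z => Complex.log (1 + (z - z0))) z0 :=
      (continuousAt_const.add (continuousAt_id.sub continuousAt_const)).clog (by simp [← hz0])
    have h4 : ContinuousWithinAt (fun z : ℂ => 1 + z) Ho z0 := continuousWithinAt_const.add continuousWithinAt_id
    exact ((continuousWithinAt_id.mul (h1.add hE0)).add (h4.mul h2.continuousWithinAt)).add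
      (h4.mul (continuousWithinAt_const.mul h3.continuousWithinAt))
  obtain ⟨CR, hCR0, hCR⟩ := bdd_of_cont hRc
  have hn1 : ∀ᶠ z in 𝓝[Ho] z0, ‖z - z0‖ ≤ 1 := by
    have : ∀ᶠ z in 𝓝 z0, ‖z - z0‖ < 1 :=
      ((continuous_id.sub continuous_const).norm.tendsto z0).eventually (gt_mem_nhds (by simp [← hz0]))
    exact (this.filter_mono nhdsWithin_le_nhds).mono fun z hz => hz.le
  set θ := max κ.re 0 with hθ
  set A := CR + 6 * ‖β i‖ + |κ.im| * Real.pi with hA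
  refine ⟨CX * (Real.exp A + ‖Complex.exp (SF τ β 0)‖), θ, by positivity, le_max_right _ _,
    max_lt (hκ i) one_pos, ?_⟩
  filter_upwards [hCX, hCR, hn1, self_mem_nhdsWithin] with z h1 h2 h3 hz
  set w := z - z0 with hw
  have hwne : w ≠ 0 := by
    have : w ∈ Ho := by
      have hz' : 0 < z.re := hz
      show 0 < w.re
      simpa [hw, hz0] using hz'
    exact Ho_ne this
  have hpos : 0 < ‖w‖ := norm_pos_iff.2 hwne
  have hQ : QF τ β E z = Rg z - κ * Complex.log w - β i * (w * Complex.log w) := by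
    have hsum : SF τ β z = β i * Lam w + ∑ j ∈ Finset.univ.erase i, β j * Lam (z - τ j * Complex.I) := by
      rw [SF, ← Finset.add_sum_erase _ _ (Finset.mem_univ i)]
    rw [QF, hsum, hRg, hκd]
    simp only
    rw [← hw, show Lam w = Complex.log (1 + w) - Complex.log w from rfl]
    have hzw : z = w + τ i * Complex.I := by rw [hw, hz0]; ring
    linear_combination (-β i * Complex.log w) * hzw
  have hlog := clog_bound hwne h3
  have hwl : ‖w * Complex.log w‖ ≤ 6 := by
    rw [norm_mul]
    have h7 : ‖w‖ * ‖w‖ ^ (-(1/2) : ℝ) = ‖w‖ ^ (1/2 : ℝ) := by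
      conv_lhs => rw [← Real.rpow_one_add' hpos.le (by norm_num)]
      norm_num
    have h8 : ‖w‖ ^ (1/2 : ℝ) ≤ 1 := Real.rpow_le_one hpos.le h3 (by norm_num)
    calc _ ≤ ‖w‖ * (6 * ‖w‖ ^ (-(1/2) : ℝ)) := by gcongr
      _ = 6 * (‖w‖ * ‖w‖ ^ (-(1/2) : ℝ)) := by ring
      _ ≤ 6 := by rw [h7]; linarith
  have hre : (QF τ β E z).re ≤ A - κ.re * Real.log ‖w‖ := by
    rw [hQ, Complex.sub_re, Complex.sub_re]
    have a1 := (Complex.abs_re_le_norm (Rg z)).trans h2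
    have a2 := Complex.abs_re_le_norm (β i * (w * Complex.log w))
    rw [norm_mul] at a2
    have a3 : ‖β i‖ * ‖w * Complex.log w‖ ≤ ‖β i‖ * 6 := by gcongr
    have a4 : (κ * Complex.log w).re = κ.re * Real.log ‖w‖ - κ.im * w.arg := by
      rw [Complex.mul_re, Complex.log_re, Complex.log_im]
    have a5 : |κ.im * w.arg| ≤ |κ.im| * Real.pi := by
      rw [abs_mul]; gcongr; exact Complex.abs_arg_le_pi w
    rw [a4]
    have := le_abs_self (Rg z).re
    have := neg_abs_le (β i * (w * Complex.log w)).re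
    have := le_abs_self (κ.im * w.arg)
    rw [hA]
    linarith
  have hexp : ‖Complex.exp (QF τ β E z)‖ ≤ Real.exp A * ‖w‖ ^ (-θ) := by
    rw [Complex.norm_exp]
    calc _ ≤ Real.exp (A - κ.re * Real.log ‖w‖) := Real.exp_le_exp.2 hre
      _ = Real.exp A * ‖w‖ ^ (-κ.re) := by
          rw [Real.rpow_def_of_pos hpos, ← Real.exp_add]; congr 1; ring
      _ ≤ _ := by
          refine mul_le_mul_of_nonneg_left ?_ (Real.exp_pos _).le
          exact Real.rpow_le_rpow_of_exponent_ge hpos h3 (neg_le_neg (le_max_left _ _))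
  have hone : 1 ≤ ‖w‖ ^ (-θ) :=
    Real.one_le_rpow_of_pos_of_le_one_of_nonpos hpos h3 (neg_nonpos.2 (le_max_right _ _))
  rw [GF, norm_mul]
  calc _ ≤ CX * (Real.exp A * ‖w‖ ^ (-θ) + ‖Complex.exp (SF τ β 0)‖ * ‖w‖ ^ (-θ)) := by
        refine mul_le_mul h1 ?_ (norm_nonneg _) hCX0
        refine (norm_sub_le _ _).trans (add_le_add hexp ?_)
        exact le_mul_of_one_le_right (norm_nonneg _) hone
    _ = _ := by ring

lemma GF_local {ι : Type*} [Fintype ι] (τ : ι → ℝ) (β : ι → ℂ) {E : ℂ → ℂ}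
    (hE : ContinuousOn E Hc) (hτ : ∀ i, τ i ≠ 0) (hinj : Function.Injective τ)
    (hκ : ∀ i, ((1 + τ i * Complex.I) * β i).re < 1) (t0 : ℝ) :
    ∃ C θ : ℝ, 0 ≤ C ∧ 0 ≤ θ ∧ θ < 1 ∧
      ∀ᶠ z in 𝓝[Ho] ((t0 : ℂ) * Complex.I), ‖GF τ β E z‖ ≤ C * ‖z - t0 * Complex.I‖ ^ (-θ) := by
  by_cases h0 : t0 = 0
  · subst h0
    simpa using GF_local_zero τ β hE hτ
  by_cases h1 : ∃ i, τ i = t0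
  · obtain ⟨i, rfl⟩ := h1
    exact GF_local_tau τ β hE hτ hinj hκ i
  · push Not at h1
    have hc : ContinuousWithinAt (GF τ β E) Ho ((t0 : ℂ) * Complex.I) := by
      refine (GF_cont τ β hE (it_mem_Hc _) (by simp [h0]) fun i h => ?_).mono Ho_sub
      have := mul_right_cancel₀ Complex.I_ne_zero h
      exact h1 i (Complex.ofReal_injective this).symm
    obtain ⟨C, hC, hev⟩ := bdd_of_cont hc
    exact ⟨C, 0, hC, le_rfl, one_pos, hev.mono fun z hz => by simpa using hz⟩


lemma tauF_inj {k : ℕ} {t : Fin k → ℝ} (ht : StrictMono t) (hpos : ∀ j, 0 < t j) :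
    Function.Injective (tauF t) := by
  rintro (i | i) (j | j) h <;> simp only [tauF, Sum.elim_inl, Sum.elim_inr] at h
  · rw [ht.injective h]
  · linarith [hpos i, hpos j]
  · linarith [hpos i, hpos j]
  · rw [ht.injective (neg_injective h)]

lemma tauF_ne {k : ℕ} {t : Fin k → ℝ} (hpos : ∀ j, 0 < t j) (i : Fin k ⊕ Fin k) : tauF t i ≠ 0 := by
  rcases i with j | j <;> simp only [tauF, Sum.elim_inl, Sum.elim_inr] <;> have := hpos j
  · exact this.ne'
  · linarith

lemma kappa_lt {k : ℕ} {t y b : Fin k → ℝ}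
    (hcond : ∀ j, b j * Real.sqrt (1 + t j ^ 2) * Real.cos (y j + Real.arctan (t j)) < 2)
    (i : Fin k ⊕ Fin k) : ((1 + tauF t i * Complex.I) * betaF y b i).re < 1 := by
  have key : ∀ j, b j / 2 * (Real.cos (y j) - t j * Real.sin (y j)) < 1 := by
    intro j
    have h := hcond j
    have hs : 0 < Real.sqrt (1 + t j ^ 2) := Real.sqrt_pos.2 (by positivity)
    rw [Real.cos_add, Real.cos_arctan, Real.sin_arctan] at h
    have e : b j * Real.sqrt (1 + t j ^ 2) * (Real.cos (y j) * (1 / Real.sqrt (1 + t j ^ 2)) -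
        Real.sin (y j) * (t j / Real.sqrt (1 + t j ^ 2))) = b j * (Real.cos (y j) - t j * Real.sin (y j)) := by
      field_simp
    rw [e] at h
    linarith
  rcases i with j | j
  · refine lt_of_eq_of_lt ?_ (key j)
    simp only [tauF, betaF, Sum.elim_inl]
    rw [Complex.exp_mul_I, ← Complex.ofReal_cos, ← Complex.ofReal_sin]
    simp [Complex.mul_re, Complex.mul_im, -Complex.ofReal_cos, -Complex.ofReal_sin]
    ring
  · refine lt_of_eq_of_lt ?_ (key j)
    simp only [tauF, betaF, Sum.elim_inr]
    rw [Complex.exp_mul_I, Complex.cos_neg, Complex.sin_neg, ← Complex.ofReal_cos, ← Complex.ofReal_sin]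
    simp [Complex.mul_re, Complex.mul_im, -Complex.ofReal_cos, -Complex.ofReal_sin]
    ring

lemma Lam_conj {t : ℝ} (ht : t ≠ 0) :
    Lam (-((t : ℂ) * Complex.I)) = (starRingEnd ℂ) (Lam (t * Complex.I)) := by
  unfold Lam
  rw [map_sub]
  have h1 : (1 + (t : ℂ) * Complex.I) ∈ Complex.slitPlane := by left; simp
  have h2 : ((t : ℂ) * Complex.I) ∈ Complex.slitPlane := by
    rw [Complex.mem_slitPlane_iff]; right; simpa using ht
  rw [← Complex.log_conj _ (Complex.mem_slitPlane_iff_arg.1 h1).1,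
    ← Complex.log_conj _ (Complex.mem_slitPlane_iff_arg.1 h2).1]
  simp

lemma SF_zero_real {k : ℕ} {t y b : Fin k → ℝ} (hpos : ∀ j, 0 < t j) :
    ∃ c0 : ℝ, SF (tauF t) (betaF y b) 0 = c0 := by
  apply Complex.conj_eq_iff_real.1
  rw [SF, Fintype.sum_sum_type]
  simp only [tauF, betaF, Sum.elim_inl, Sum.elim_inr]
  rw [map_add, map_sum, map_sum, add_comm]
  have e1 : ∀ j, (starRingEnd ℂ) ((b j : ℂ) / 2 * Complex.exp (y j * Complex.I)) =
      (b j : ℂ) / 2 * Complex.exp (-y j * Complex.I) := by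
    intro j
    rw [map_mul, ← Complex.exp_conj, map_div₀, Complex.conj_ofReal, map_ofNat]; simp
  have e2 : ∀ j, (starRingEnd ℂ) ((b j : ℂ) / 2 * Complex.exp (-y j * Complex.I)) =
      (b j : ℂ) / 2 * Complex.exp (y j * Complex.I) := by
    intro j
    rw [map_mul, ← Complex.exp_conj, map_div₀, Complex.conj_ofReal, map_ofNat]; simp
  have e3 : ∀ j, (starRingEnd ℂ) (Lam (0 - (t j : ℂ) * Complex.I)) = Lam (0 - ((-t j : ℝ) : ℂ) * Complex.I) := by
    intro j
    rw [zero_sub, Lam_conj (hpos j).ne']; simp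
  have e4 : ∀ j, (starRingEnd ℂ) (Lam (0 - ((-t j : ℝ) : ℂ) * Complex.I)) = Lam (0 - (t j : ℂ) * Complex.I) := by
    intro j
    rw [← e3]; simp
  congr 1
  · refine Finset.sum_congr rfl fun j _ => ?_
    rw [map_mul, e2, e4]
  · refine Finset.sum_congr rfl fun j _ => ?_
    rw [map_mul, e1, e3]

lemma E_cont {e : ℝ → ℝ} (he : Integrable e) (h0 : ∀ u ≤ 0, e u = 0) :
    ContinuousOn (fun z : ℂ => ∫ u, (e u : ℂ) * Complex.exp (-z * u)) Hc := by
  refine continuousOn_of_dominated (bound := fun u => ‖e u‖) ?_ ?_ he.norm ?_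
  · intro z hz; exact (damp_integrable he h0 hz).aestronglyMeasurable
  · intro z hz
    refine Eventually.of_forall fun u => ?_
    rcases le_total u 0 with h | h
    · simp [h0 u h]
    · rw [norm_mul, Complex.norm_real]
      exact mul_le_of_le_one_right (norm_nonneg _) (norm_damp_le hz h)
  · exact Eventually.of_forall fun u => by fun_prop

lemma M_integrable {M : ℝ → ℝ} (hMi : ∀ δ > 0, IntegrableOn (fun u => M u * Real.exp (-δ * u)) (Ioi 0))
    {z : ℂ} (hz : 0 < z.re) : IntegrableOn (fun u : ℝ => (M u : ℂ) * Complex.exp (-z * u)) (Ioi 0) := by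
  have h1 := hMi z.re hz
  have e : ∀ u : ℝ, (M u : ℂ) * Complex.exp (-z * u) =
      ((M u * Real.exp (-z.re * u) : ℝ) : ℂ) * Complex.exp (-(z.im * Complex.I) * u) := by
    intro u
    push_cast
    rw [mul_assoc, ← Complex.exp_add]
    congr 2
    conv_lhs => rw [← Complex.re_add_im z]
    ring
  refine Integrable.mono' h1.norm ?_ (Eventually.of_forall fun u => ?_)
  · simp_rw [e]
    have h2 : AEStronglyMeasurable (fun u : ℝ => ((M u * Real.exp (-z.re * u) : ℝ) : ℂ)) (volume.restrict (Ioi 0)) :=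
      (Integrable.ofReal h1).aestronglyMeasurable
    exact h2.mul (by apply Continuous.aestronglyMeasurable; fun_prop)
  · rw [e, norm_mul, Complex.norm_real, Complex.norm_exp]
    simp

theorem main_thm (p : ℕ → ℝ) (hmono : Monotone p) (hp1 : 1 < p 0)
    (hptop : Tendsto p atTop atTop)
    (k : ℕ) (t y b : Fin k → ℝ) (htmono : StrictMono t) (htpos : ∀ j, 0 < t j)
    (hL1 : ∫⁻ x in Set.Ici (2:ℝ), ENNReal.ofReal
      (|PiCount p x - x / Real.log x *
        (1 + ∑ j, b j * Real.cos (t j * Real.log x + y j))| / x ^ 2) < ⊤)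
    (hcond : ∀ j, b j * Real.sqrt (1 + t j ^ 2) * Real.cos (y j + Real.arctan (t j)) < 2) :
    ∃ a : ℝ, 0 < a ∧ Tendsto (fun x : ℝ => (Ncount p x : ℝ) / x) atTop (𝓝 a) := by
  obtain ⟨e, he, he0, hPe⟩ := pi_decomp hmono hp1 hptop t y b hL1
  obtain ⟨hPi, hPl⟩ := pi_laplace he he0 (gB_cont t y b).measurable _ (gB_bound t y b) hPe
  obtain ⟨hMexp, hMi, hMl⟩ := arith hmono hp1 hptop hPi
  set M : ℝ → ℝ := fun u => Ncount p (Real.exp u) * Real.exp (-u) with hM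
  obtain ⟨w, hw, hw0, hwl⟩ := conv_exp he he0
  obtain ⟨hWm, hWb, hWt, hWl⟩ := tail_lemma hw hw0
  obtain ⟨c0, hc0⟩ := SF_zero_real (t := t) (y := y) (b := b) htpos
  set E : ℂ → ℂ := fun z => ∫ u, (e u : ℂ) * Complex.exp (-z * u) with hE
  set τ := tauF t with hτ
  set β := betaF y b with hβ
  have hEc : ContinuousOn E Hc := E_cont he he0
  set c := Real.exp c0 with hc
  have hIw : (∫ u, w u) = Real.exp (∫ u, e u) - 1 := by
    have := hwl 0 (by simp)
    simp only [neg_zero, zero_mul, Complex.exp_zero, mul_one] at this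
    rw [integral_complex_ofReal, integral_complex_ofReal] at this
    exact_mod_cast this
  set a := c * (1 + ∫ u, w u) with ha
  have hapos : 0 < a := by
    rw [ha, hIw, add_sub_cancel]
    exact mul_pos (Real.exp_pos _) (Real.exp_pos _)
  set W : ℝ → ℝ := fun v => ∫ u in Ioi v, w u with hW
  set V : ℝ → ℝ := fun u => a - c * W u with hV
  have hVm : Measurable V := measurable_const.sub (measurable_const.mul hWm)
  have hVB : ∀ u, |V u| ≤ a + c * ∫ u, ‖w u‖ := by
    intro u
    refine (abs_sub _ _).trans (add_le_add (abs_of_pos hapos).le ?_)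
    rw [abs_mul, abs_of_pos (Real.exp_pos c0)]
    exact mul_le_mul_of_nonneg_left (hWb u) (Real.exp_pos _).le
  have hVa : Tendsto V atTop (𝓝 a) := by
    have := (hWt.const_mul c).const_sub a
    simpa using this
  have hexpi : ∀ z : ℂ, 0 < z.re → IntegrableOn (fun v : ℝ => Complex.exp (-z * v)) (Ioi 0) :=
    fun z hz => integrableOn_exp_mul_complex_Ioi (a := -z) (by simpa using hz) 0
  have hWi : ∀ z : ℂ, 0 < z.re → IntegrableOn (fun u : ℝ => (W u : ℂ) * Complex.exp (-z * u)) (Ioi 0) := by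
    intro z hz
    refine Integrable.mono' ((hexpi z hz).norm.const_mul (∫ u, ‖w u‖)) ?_ (Eventually.of_forall fun u => ?_)
    · refine AEStronglyMeasurable.mul ?_ (by apply Continuous.aestronglyMeasurable; fun_prop)
      exact (Complex.measurable_ofReal.comp hWm).aestronglyMeasurable
    · rw [norm_mul, Complex.norm_real]
      exact mul_le_mul_of_nonneg_right (hWb u) (norm_nonneg _)
  have hG : ∀ z : ℂ, 0 < z.re → GF τ β E z =
      ∫ u in Ioi (0:ℝ), ((M u - V u : ℝ) : ℂ) * Complex.exp (-z * u) := by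
    intro z hz
    have hz0 : z ≠ 0 := by rintro rfl; simp at hz
    have hz1 : 1 + z ≠ 0 := by
      intro h
      have := congrArg Complex.re h
      simp at this
      linarith
    have hpt : ∀ u : ℝ, ((M u - V u : ℝ) : ℂ) * Complex.exp (-z * u) =
        ((M u : ℂ) * Complex.exp (-z * u) - (a : ℂ) * Complex.exp (-z * u)) +
          (c : ℂ) * ((W u : ℂ) * Complex.exp (-z * u)) := by
      intro u; simp only [hV]; push_cast; ring
    simp_rw [hpt]
    have i1 := M_integrable hMi hz
    have i2 : IntegrableOn (fun u : ℝ => (a : ℂ) * Complex.exp (-z * u)) (Ioi 0) := (hexpi z hz).const_mul _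
    have i3 : IntegrableOn (fun u : ℝ => (c : ℂ) * ((W u : ℂ) * Complex.exp (-z * u))) (Ioi 0) := (hWi z hz).const_mul _
    have i12 : IntegrableOn (fun u : ℝ => (M u : ℂ) * Complex.exp (-z * u) - (a : ℂ) * Complex.exp (-z * u)) (Ioi 0) :=
      i1.sub i2
    rw [integral_add i12 i3, integral_sub i1 i2, integral_const_mul, integral_const_mul]
    have l1 := hMl z hz
    have l2 : ∫ u in Ioi (0:ℝ), Complex.exp (-z * u) = 1 / z := by
      rw [integral_exp_mul_complex_Ioi (a := -z) (by simpa using hz) 0]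
      simp
    have l3 := hWl z hz
    have hwl' : ∫ u, (w u : ℂ) * Complex.exp (-z * u) = Complex.exp (E z) - 1 := hwl z hz.le
    rw [hwl'] at l3
    rw [hPl z hz, gB_laplace t y b hz] at l1
    have hEz : ∫ u, (e u : ℂ) * Complex.exp (-z * u) = E z := rfl
    rw [hEz] at l1
    rw [l1, l2, l3]
    have hLam : Complex.exp (Lam z) = (1 + z) / z := by
      rw [Lam, Complex.exp_sub, Complex.exp_log hz1, Complex.exp_log hz0]
    have hexp : Complex.exp ((1 + z) * (E z + (Lam z + SF τ β z))) =
        Complex.exp (E z) * ((1 + z) / z) * Complex.exp (QF τ β E z) := by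
      rw [← hLam, ← Complex.exp_add, ← Complex.exp_add, QF]
      congr 1; ring
    have hcc : Complex.exp (SF τ β 0) = (c : ℂ) := by rw [hc0, hc, Complex.ofReal_exp]
    have haa : (a : ℂ) = c * (1 + ((∫ u, w u : ℝ) : ℂ)) := by rw [ha]; push_cast; ring
    rw [GF, hcc, haa, hexp]
    field_simp
    ring
  have hT : Tendsto M atTop (𝓝 a) := by
    refine tauber M V ?_ hMexp hMi hVm _ hVB a hVa (GF τ β E) hG (fun s => GF τ β E (s * Complex.I)) ?_ ?_
    · intro u; rw [hM]; positivity
    · have hfin : ((insert 0 (range τ)) : Set ℝ).Finite := (finite_range τ).insert 0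
      have hae : ∀ᵐ s : ℝ, s ∉ (insert 0 (range τ) : Set ℝ) := by
        rw [ae_iff]
        have : {s : ℝ | ¬ s ∉ (insert 0 (range τ) : Set ℝ)} = insert 0 (range τ) := by
          ext s; exact not_not
        rw [this]
        exact hfin.measure_zero _
      filter_upwards [hae] with s hs
      simp only [mem_insert_iff, mem_range, not_or, not_exists] at hs
      have hcw : ContinuousWithinAt (GF τ β E) Hc (s * Complex.I) := by
        refine GF_cont τ β hEc (it_mem_Hc _) (by simp [hs.1]) fun i h => ?_
        have := mul_right_cancel₀ Complex.I_ne_zero h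
        exact hs.2 i (Complex.ofReal_injective this).symm
      refine hcw.tendsto.comp ?_
      refine tendsto_nhdsWithin_iff.2 ⟨?_, ?_⟩
      · have h1 : Continuous (fun δ : ℝ => (δ : ℂ) + s * Complex.I) := by fun_prop
        have h2 := h1.tendsto 0
        simp only [Complex.ofReal_zero, zero_add] at h2
        exact h2.mono_left nhdsWithin_le_nhds
      · filter_upwards [self_mem_nhdsWithin] with δ hδ
        show 0 ≤ ((δ : ℂ) + s * Complex.I).re
        have : 0 < δ := hδ
        simp
        exact this.le
    · intro R _
      exact glue _ (GF_local τ β hEc (tauF_ne htpos) (tauF_inj htmono htpos) (kappa_lt hcond)) R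
  refine ⟨a, hapos, ?_⟩
  refine (hT.comp Real.tendsto_log_atTop).congr' ?_
  filter_upwards [eventually_gt_atTop 0] with x hx
  simp only [Function.comp, hM]
  rw [Real.exp_neg, Real.exp_log hx, div_eq_mul_inv]


theorem stmt_3 (p : ℕ → ℝ) (hmono : Monotone p) (hp1 : 1 < p 0)
    (hptop : Tendsto p atTop atTop)
    (k : ℕ) (t y b : Fin k → ℝ) (htmono : StrictMono t) (htpos : ∀ j, 0 < t j)
    (hL1 : ∫⁻ x in Set.Ici (2:ℝ), ENNReal.ofReal
      (|PiCount p x - x / Real.log x *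
        (1 + ∑ j, b j * Real.cos (t j * Real.log x + y j))| / x ^ 2) < ⊤)
    (hcond : ∀ j, b j * Real.sqrt (1 + t j ^ 2) * Real.cos (y j + Real.arctan (t j)) < 2) :
    ∃ a : ℝ, 0 < a ∧ Tendsto (fun x : ℝ => (Ncount p x : ℝ) / x) atTop (𝓝 a) := by
  exact main_thm p hmono hp1 hptop k t y b htmono htpos hL1 hcond
end

section
/- Let a Beurling generalized number system be given. If there is a > 0 with N(x)/x → a as x → ∞ and the function s ↦ log ζ(s) + Log(s − 1), analytic on {Re s > 1}, extends continuously to the closed half-plane {Re s ≥ 1}, then m(x) → 0 as x → ∞. -/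
open Filter MeasureTheory Set Topology
open scoped Classical

lemma aux_integrable (τ : ℝ → ℂ) (hm : Measurable τ) (A : ℝ) (hA : 0 ≤ A)
    (hb : ∀ u, ‖τ u‖ ≤ A * (1 + |u|)) (h0 : ∀ u < 0, τ u = 0) (η : ℝ) (hη : 0 < η) :
    Integrable (fun u : ℝ => τ u * Complex.exp (-(η:ℂ) * u)) := by
  have h1 : IntegrableOn (fun u : ℝ => A * (1 + 2/η) * Real.exp (-(η/2) * u)) (Ici 0) := by
    rw [integrableOn_Ici_iff_integrableOn_Ioi]
    exact (integrableOn_exp_mul_Ioi (by linarith) 0).const_mul _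
  have h2 := (integrable_indicator_iff measurableSet_Ici).2 h1
  refine h2.mono' ?_ ?_
  · exact (hm.mul (by fun_prop)).aestronglyMeasurable
  · refine Eventually.of_forall fun u => ?_
    rw [indicator_apply]
    split_ifs with hu
    · have hu : 0 ≤ u := hu
      rw [norm_mul, Complex.norm_exp]
      have : (-(η:ℂ) * u).re = -(η * u) := by simp
      rw [this]
      have e1 : Real.exp (-(η*u)) = Real.exp (-(η/2)*u) * Real.exp (-(η/2)*u) := by
        rw [← Real.exp_add]; congr 1; ring
      have e2 : u * Real.exp (-(η/2)*u) ≤ 2/η := by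
        have := Real.add_one_le_exp (η/2*u)
        have h3 : Real.exp (-(η/2)*u) = (Real.exp (η/2*u))⁻¹ := by
          rw [← Real.exp_neg]; congr 1; ring
        rw [h3, ← div_eq_mul_inv, div_le_div_iff₀ (Real.exp_pos _) hη]
        nlinarith
      have e3 : Real.exp (-(η/2)*u) ≤ 1 := by
        rw [Real.exp_le_one_iff]; nlinarith
      rw [e1, ← mul_assoc]
      refine mul_le_mul_of_nonneg_right ?_ (Real.exp_pos _).le
      calc ‖τ u‖ * Real.exp (-(η/2)*u) ≤ A * (1 + |u|) * Real.exp (-(η/2)*u) := by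
            gcongr; exact hb u
        _ = A * (Real.exp (-(η/2)*u) + u * Real.exp (-(η/2)*u)) := by rw [abs_of_nonneg hu]; ring
        _ ≤ _ := by gcongr
    · rw [h0 u (by simpa using hu)]; simp

lemma fourier_shift (φ : ℝ → ℂ) (u v : ℝ) :
    FourierTransform.fourier (fun t : ℝ => φ t * Complex.exp (2 * Real.pi * u * t * Complex.I)) v
      = FourierTransform.fourier φ (v - u) := by
  rw [Real.fourier_real_eq_integral_exp_smul, Real.fourier_real_eq_integral_exp_smul]
  congr 1; ext t
  simp only [smul_eq_mul]
  rw [mul_comm (φ t), ← mul_assoc, ← Complex.exp_add]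
  congr 2
  push_cast; ring

lemma tauber_A (τ : ℝ → ℂ) (hm : Measurable τ) (A : ℝ) (hA : 0 ≤ A)
    (hb : ∀ u, ‖τ u‖ ≤ A * (1 + |u|)) (h0 : ∀ u < 0, τ u = 0)
    (g : ℂ → ℂ) (hg : ContinuousOn g {z | 0 ≤ z.re})
    (hL : ∀ z : ℂ, 0 < z.re → ∫ u : ℝ, τ u * Complex.exp (-z * u) = g z)
    (φ : SchwartzMap ℝ ℂ) (hφ : HasCompactSupport φ) :
    Tendsto (fun u : ℝ => ∫ y : ℝ, τ (u + y) * FourierTransform.fourier (φ : ℝ → ℂ) y) atTop (𝓝 0) := by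
  have hInteg := aux_integrable τ hm A hA hb h0
  -- identity with damping
  have key : ∀ u η : ℝ, 0 < η →
      ∫ v : ℝ, (τ v * Complex.exp (-(η:ℂ) * v)) * FourierTransform.fourier (φ : ℝ → ℂ) (v - u) =
      ∫ t : ℝ, g (η + 2 * Real.pi * t * Complex.I) * (φ t * Complex.exp (2 * Real.pi * u * t * Complex.I)) := by
    intro u η hη
    have hgi : Integrable (fun t : ℝ => φ t * Complex.exp (2 * Real.pi * u * t * Complex.I)) := by
      refine φ.integrable.mul_bdd (c := 1) (by fun_prop) (Eventually.of_forall fun t => ?_)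
      have := Complex.norm_exp_ofReal_mul_I (2 * Real.pi * u * t)
      push_cast at this
      exact this.le
    have h := VectorFourier.integral_fourierIntegral_smul_eq_flip (L := innerₗ ℝ)
      Real.continuous_fourierChar continuous_inner (hInteg η hη) hgi
    have h' : ∫ t : ℝ, FourierTransform.fourier (fun u : ℝ => τ u * Complex.exp (-(η:ℂ) * u)) t * (φ t * Complex.exp (2 * Real.pi * u * t * Complex.I))
       = ∫ v : ℝ, (τ v * Complex.exp (-(η:ℂ) * v)) * FourierTransform.fourier (fun t : ℝ => φ t * Complex.exp (2 * Real.pi * u * t * Complex.I)) v := by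
      simpa using! h
    simp_rw [fourier_shift] at h'
    rw [← h']
    congr 1; ext t
    congr 1
    rw [Real.fourier_real_eq_integral_exp_smul, ← hL _ (by simpa using hη)]
    congr 1; ext v
    rw [smul_eq_mul, mul_comm, mul_assoc, ← Complex.exp_add]
    congr 2
    push_cast; ring
  set K : SchwartzMap ℝ ℂ := FourierTransform.fourier φ with hK
  have hKc : (K : ℝ → ℂ) = FourierTransform.fourier (φ : ℝ → ℂ) := SchwartzMap.fourier_coe φ
  rw [← hKc] at key ⊢
  have hKint : ∀ u : ℝ, Integrable (fun v : ℝ => A * (1 + |v|) * ‖K (v - u)‖) := by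
    intro u
    have h1 : Integrable (fun y : ℝ => ‖K y‖) := K.integrable.norm
    have h2 : Integrable (fun y : ℝ => ‖y‖ ^ 1 * ‖K y‖) := K.integrable_pow_mul volume 1
    have h3 : Integrable (fun y : ℝ => A * (1 + |u|) * ‖K y‖ + A * (‖y‖ ^ 1 * ‖K y‖)) :=
      (h1.const_mul _).add (h2.const_mul _)
    have h4 := h3.comp_sub_right u
    refine h4.mono' (by fun_prop) (Eventually.of_forall fun v => ?_)
    rw [norm_mul, norm_mul, norm_norm, Real.norm_of_nonneg hA, Real.norm_of_nonneg (by positivity)]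
    have : |v| ≤ |u| + |v - u| := by
      have := abs_add_le u (v - u); simpa using this
    simp only [pow_one, Real.norm_eq_abs]
    have hn := norm_nonneg (K (v-u))
    have : A * (1 + |v|) * ‖K (v-u)‖ ≤ A * (1 + (|u| + |v - u|)) * ‖K (v-u)‖ := by gcongr
    linarith
  have lim : ∀ u : ℝ, ∫ v : ℝ, τ v * K (v - u) =
      ∫ t : ℝ, g (2 * Real.pi * t * Complex.I) * (φ t * Complex.exp (2 * Real.pi * u * t * Complex.I)) := by
    intro u
    have L1 : Tendsto (fun η : ℝ => ∫ v : ℝ, (τ v * Complex.exp (-(η:ℂ) * v)) * K (v - u)) (𝓝[>] 0)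
        (𝓝 (∫ v : ℝ, τ v * K (v - u))) := by
      refine tendsto_integral_filter_of_dominated_convergence _ ?_ ?_ (hKint u) ?_
      · refine Eventually.of_forall fun η => ?_
        exact ((hm.mul (by fun_prop)).mul (by fun_prop)).aestronglyMeasurable
      · filter_upwards [self_mem_nhdsWithin] with η (hη : 0 < η)
        refine Eventually.of_forall fun v => ?_
        rw [norm_mul, norm_mul]
        refine mul_le_mul_of_nonneg_right ?_ (norm_nonneg _)
        rcases lt_or_ge v 0 with hv | hv
        · rw [h0 v hv]; simp; positivity
        · rw [Complex.norm_exp]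
          have : (-(η:ℂ) * v).re = -(η * v) := by simp
          rw [this]
          have : Real.exp (-(η * v)) ≤ 1 := by rw [Real.exp_le_one_iff]; nlinarith
          calc _ ≤ ‖τ v‖ * 1 := by gcongr
            _ ≤ _ := by simpa using hb v
      · refine Eventually.of_forall fun v => ?_
        have : Continuous (fun η : ℝ => (τ v * Complex.exp (-(η:ℂ) * v)) * K (v - u)) := by fun_prop
        have := this.tendsto 0
        simp only [Complex.ofReal_zero, neg_zero, zero_mul, Complex.exp_zero, mul_one] at this
        exact this.mono_left nhdsWithin_le_nhds
    have L2 : Tendsto (fun η : ℝ => ∫ t : ℝ, g (η + 2 * Real.pi * t * Complex.I) * (φ t * Complex.exp (2 * Real.pi * u * t * Complex.I))) (𝓝[>] 0)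
        (𝓝 (∫ t : ℝ, g (2 * Real.pi * t * Complex.I) * (φ t * Complex.exp (2 * Real.pi * u * t * Complex.I)))) := by
      have hcomp : IsCompact ((Icc (0:ℝ) 1) ×ˢ tsupport φ) := isCompact_Icc.prod hφ
      have hcg : ContinuousOn (fun q : ℝ × ℝ => g (q.1 + 2 * Real.pi * q.2 * Complex.I)) {q | 0 ≤ q.1} := by
        refine hg.comp (by fun_prop) ?_
        intro q hq
        simpa using hq
      obtain ⟨M, hM⟩ := hcomp.exists_bound_of_continuousOn (hcg.mono (fun q hq => hq.1.1))
      have hca : ∀ η : ℝ, 0 ≤ η → Continuous (fun t : ℝ => g (η + 2 * Real.pi * t * Complex.I)) := by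
        intro η hη
        have := hcg.comp_continuous (f := fun t : ℝ => (η, t)) (by fun_prop) (fun t => hη)
        exact this
      refine tendsto_integral_filter_of_dominated_convergence (fun t => M * ‖φ t‖) ?_ ?_ (φ.integrable.norm.const_mul M) ?_
      · filter_upwards [self_mem_nhdsWithin] with η (hη : 0 < η)
        have := hca η hη.le
        exact (this.mul (φ.continuous.mul (by fun_prop))).aestronglyMeasurable
      · have h1 : Iio (1:ℝ) ∈ 𝓝[>] (0:ℝ) := mem_nhdsWithin_of_mem_nhds (Iio_mem_nhds one_pos)
        filter_upwards [self_mem_nhdsWithin, h1] with η (hη : 0 < η) (hη1 : η < 1)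
        refine Eventually.of_forall fun t => ?_
        have e := Complex.norm_exp_ofReal_mul_I (2 * Real.pi * u * t)
        push_cast at e
        rw [norm_mul, norm_mul, e, mul_one]
        by_cases ht : t ∈ tsupport φ
        · gcongr
          exact hM (η, t) ⟨⟨hη.le, hη1.le⟩, ht⟩
        · rw [image_eq_zero_of_notMem_tsupport ht]; simp
      · refine Eventually.of_forall fun t => ?_
        refine Tendsto.mul_const _ ?_
        have h1 := hcg (0, t) (by simp)
        have h2 : Tendsto (fun η : ℝ => (η, t)) (𝓝[>] 0) (𝓝[{q : ℝ × ℝ | 0 ≤ q.1}] (0, t)) := by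
          refine tendsto_nhdsWithin_iff.2 ⟨?_, ?_⟩
          · have : Continuous (fun η : ℝ => (η, t)) := by fun_prop
            exact (this.tendsto 0).mono_left nhdsWithin_le_nhds
          · filter_upwards [self_mem_nhdsWithin] with η (hη : 0 < η)
            exact hη.le
        have h3 := h1.tendsto.comp h2
        simpa [Function.comp_def] using h3
    refine tendsto_nhds_unique (L1.congr' ?_) L2
    filter_upwards [self_mem_nhdsWithin] with η (hη : 0 < η)
    exact key u η hη
  have eq : ∀ u : ℝ, ∫ y : ℝ, τ (u + y) * K y =
      FourierTransform.fourier (fun t : ℝ => g (2 * Real.pi * t * Complex.I) * φ t) (-u) := by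
    intro u
    have e1 : ∫ y : ℝ, τ (u + y) * K y = ∫ v : ℝ, τ v * K (v - u) := by
      rw [← integral_sub_right_eq_self (fun y : ℝ => τ (u + y) * K y) u]
      simp
    rw [e1, lim u, Real.fourier_real_eq_integral_exp_smul]
    congr 1; ext t
    rw [smul_eq_mul, mul_comm (Complex.exp _), ← mul_assoc]
    congr 2
    push_cast; ring
  simp_rw [eq]
  refine (Real.zero_at_infty_fourier _).comp ?_
  exact tendsto_neg_atTop_atBot.mono_right atBot_le_cocompact

lemma tauber_B (τ : ℝ → ℂ) (hm : Measurable τ) (A : ℝ) (hA : 0 ≤ A)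
    (hb : ∀ u w, ‖τ w - τ u‖ ≤ A * (1 + |w - u|)) (h0 : ∀ u < 0, τ u = 0)
    (hs : ∀ ε > 0, ∃ δ > 0, ∃ u₀, ∀ u ≥ u₀, ∀ w, |w - u| ≤ δ → ‖τ w - τ u‖ ≤ ε)
    (g : ℂ → ℂ) (hg : ContinuousOn g {z | 0 ≤ z.re})
    (hL : ∀ z : ℂ, 0 < z.re → ∫ u : ℝ, τ u * Complex.exp (-z * u) = g z) :
    Tendsto τ atTop (𝓝 0) := by
  have hb1 : ∀ u, ‖τ u‖ ≤ 2 * A * (1 + |u|) := by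
    intro u
    have h := hb (-1) u
    rw [h0 (-1) (by norm_num), sub_zero] at h
    have : |u - (-1)| ≤ |u| + 1 := by
      have := abs_add_le u 1
      simpa using this
    nlinarith [abs_nonneg u]
  -- kernel
  let b : ContDiffBump (0:ℝ) := default
  have hbc : HasCompactSupport (fun x : ℝ => ((b x : ℝ) : ℂ)) :=
    b.hasCompactSupport.comp_left (g := fun x : ℝ => (x : ℂ)) (by simp)
  let φ : SchwartzMap ℝ ℂ := hbc.toSchwartzMap (Complex.ofRealCLM.contDiff.comp b.contDiff)
  have hφc : (φ : ℝ → ℂ) = fun x : ℝ => ((b x : ℝ) : ℂ) := rfl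
  set K : SchwartzMap ℝ ℂ := FourierTransform.fourier φ with hK
  have hKc : (K : ℝ → ℂ) = FourierTransform.fourier (φ : ℝ → ℂ) := SchwartzMap.fourier_coe φ
  have hK1 : ∫ y, K y = 1 := by
    have h := MeasureTheory.Integrable.fourierInv_fourier_eq (f := φ) φ.integrable
      (by rw [← hKc]; exact K.integrable) (v := 0) φ.continuous.continuousAt
    rw [← hKc, Real.fourierInv_eq'] at h
    have h2 : φ 0 = 1 := by
      rw [hφc]
      have : b 0 = 1 := b.one_of_mem_closedBall (by simpa using b.rIn_pos.le)
      simp [this]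
    rw [h2] at h
    simpa using h
  set C0 := ∫ y, ‖K y‖
  set C1 := ∫ y, ‖y‖ ^ 1 * ‖K y‖
  have hC0 : 0 ≤ C0 := integral_nonneg fun y => by positivity
  have hC1 : 0 ≤ C1 := integral_nonneg fun y => by positivity
  have iK0 : Integrable (fun y : ℝ => ‖K y‖) := K.integrable.norm
  have iK1 : Integrable (fun y : ℝ => ‖y‖ ^ 1 * ‖K y‖) := K.integrable_pow_mul volume 1
  -- scaled version of A
  have hscale : ∀ l : ℝ, 0 < l → Tendsto (fun u : ℝ => ∫ y : ℝ, τ (u + y / l) * K y) atTop (𝓝 0) := by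
    intro l hl
    have h := tauber_A (fun u => τ (u / l)) (hm.comp (by fun_prop)) (2 * A * (1 + 1/l)) (by positivity)
      (by
        intro u
        refine (hb1 (u/l)).trans ?_
        rw [mul_assoc (2*A)]
        gcongr
        rw [abs_div, abs_of_pos hl]
        have : 0 ≤ 1 / l := by positivity
        have h2 : |u| / l = 1/l * |u| := by ring
        rw [h2]
        nlinarith [abs_nonneg u])
      (by intro u hu; exact h0 _ (div_neg_of_neg_of_pos hu hl))
      (fun z => l * g (l * z))
      (by
        refine continuousOn_const.mul (hg.comp (by fun_prop) ?_)
        intro z hz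
        have hz : 0 ≤ z.re := hz
        simp; positivity)
      (by
        intro z hz
        have e := hL (l * z) (by simp; positivity)
        rw [← e]
        have e2 := Measure.integral_comp_mul_left (fun u : ℝ => τ u * Complex.exp (-(l * z) * u)) (l⁻¹)
        rw [inv_inv, abs_of_pos hl, Complex.real_smul] at e2
        rw [← e2]
        congr 1; ext u
        congr 2
        · ring_nf
        · push_cast
          have : (l:ℂ) ≠ 0 := by exact_mod_cast hl.ne'
          field_simp)
      φ (by rw [hφc]; exact hbc)
    rw [← hKc] at h
    have h2 := h.comp (tendsto_id.const_mul_atTop hl)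
    refine h2.congr fun u => ?_
    simp only [Function.comp, id]
    congr 1; ext y
    congr 2
    field_simp
  rw [tendsto_zero_iff_norm_tendsto_zero]
  rw [Metric.tendsto_atTop]
  intro ε hε
  set ε' := ε / (3 * (C0 + 1)) with hε'
  have hε'pos : 0 < ε' := by positivity
  obtain ⟨δ, hδ, u₀, hu₀⟩ := hs ε' hε'pos
  set M := A / δ + A with hM
  have hMnn : 0 ≤ M := by positivity
  set l := 3 * (M * C1 + 1) / ε with hl
  have hlpos : 0 < l := by positivity
  obtain ⟨u₁, hu₁⟩ := Metric.tendsto_atTop.1 (hscale l hlpos) (ε/3) (by positivity)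
  refine ⟨max u₀ u₁, fun u hu => ?_⟩
  have hu0 : u₀ ≤ u := (le_max_left _ _).trans hu
  have hu1 := hu₁ u ((le_max_right _ _).trans hu)
  rw [dist_zero_right] at hu1
  rw [dist_zero_right, norm_norm]
  have hpt : ∀ v, ‖τ (u + v) - τ u‖ ≤ ε' + M * |v| := by
    intro v
    by_cases hv : |v| ≤ δ
    · have := hu₀ u hu0 (u + v) (by simpa using hv)
      have : 0 ≤ M * |v| := by positivity
      linarith
    · push Not at hv
      have h := hb u (u + v)
      rw [add_sub_cancel_left] at h
      have : A ≤ A / δ * |v| := by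
        rw [div_mul_eq_mul_div, le_div_iff₀ hδ]; gcongr
      rw [hM]; nlinarith
  have iτ : Integrable (fun y : ℝ => (τ (u + y / l) - τ u) * K y) := by
    refine ((iK0.const_mul ε').add (iK1.const_mul (M/l))).mono' ?_ ?_
    · have : Measurable (fun y : ℝ => τ (u + y / l)) := hm.comp (by fun_prop)
      exact ((this.sub measurable_const).mul (by fun_prop)).aestronglyMeasurable
    · refine Eventually.of_forall fun y => ?_
      rw [norm_mul]
      have := hpt (y/l)
      rw [abs_div, abs_of_pos hlpos] at this
      simp only [pow_one, Real.norm_eq_abs, Pi.add_apply]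
      calc _ ≤ (ε' + M * (|y|/l)) * ‖K y‖ := by gcongr
        _ = _ := by ring
  have iKτ : Integrable (fun y : ℝ => τ u * K y) := K.integrable.const_mul _
  have hsplit : ∫ y : ℝ, τ (u + y / l) * K y = (∫ y : ℝ, (τ (u + y / l) - τ u) * K y) + τ u := by
    have : ∫ y : ℝ, τ u * K y = τ u := by
      rw [integral_const_mul, hK1, mul_one]
    have h2 := integral_add iτ iKτ
    rw [this] at h2
    rw [← h2]
    congr 1; ext y; ring
  have hbd : ‖∫ y : ℝ, (τ (u + y / l) - τ u) * K y‖ ≤ ε' * C0 + M / l * C1 := by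
    calc _ ≤ ∫ y : ℝ, (ε' * ‖K y‖ + M/l * (‖y‖^1 * ‖K y‖)) := by
          refine norm_integral_le_of_norm_le ((iK0.const_mul ε').add (iK1.const_mul (M/l))) ?_
          refine Eventually.of_forall fun y => ?_
          rw [norm_mul]
          have := hpt (y/l)
          rw [abs_div, abs_of_pos hlpos] at this
          simp only [pow_one, Real.norm_eq_abs]
          calc _ ≤ (ε' + M * (|y|/l)) * ‖K y‖ := by gcongr
            _ = _ := by ring
      _ = _ := by
          rw [integral_add (iK0.const_mul ε') (iK1.const_mul (M/l)), integral_const_mul, integral_const_mul]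
  have b1 : ε' * C0 < ε/3 := by
    rw [hε', div_mul_eq_mul_div, div_lt_div_iff₀ (by positivity) (by positivity)]
    nlinarith
  have b2 : M / l * C1 < ε/3 := by
    rw [div_mul_eq_mul_div, div_lt_iff₀ hlpos, hl]
    have : ε / 3 * (3 * (M * C1 + 1) / ε) = M * C1 + 1 := by field_simp
    rw [this]; linarith
  have : τ u = (∫ y : ℝ, τ (u + y / l) * K y) - ∫ y : ℝ, (τ (u + y / l) - τ u) * K y := by
    rw [hsplit]; ring
  have h3 := norm_sub_le (∫ y : ℝ, τ (u + y / l) * K y) (∫ y : ℝ, (τ (u + y / l) - τ u) * K y)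
  rw [← this] at h3
  linarith

lemma p_gt_one {p : ℕ → ℝ} (hmono : Monotone p) (hp1 : 1 < p 0) (k : ℕ) : 1 < p k :=
  hp1.trans_le (hmono (Nat.zero_le k))

lemma one_le_nval {p : ℕ → ℝ} (hp : ∀ k, 1 < p k) (α : ℕ →₀ ℕ) : 1 ≤ nval p α := by
  unfold nval Finsupp.prod
  refine Finset.prod_induction _ (fun x : ℝ => 1 ≤ x) (fun a b ha hb => one_le_mul_of_one_le_of_one_le ha hb) le_rfl ?_
  exact fun k _ => one_le_pow₀ (hp k).le

lemma fin_nval {p : ℕ → ℝ} {a : ℝ} (ha : 0 < a)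
    (hN : Tendsto (fun x : ℝ => (Ncount p x : ℝ) / x) atTop (𝓝 a)) (x : ℝ) :
    {α : ℕ →₀ ℕ | nval p α ≤ x}.Finite := by
  have h1 := (hN.eventually_const_lt ha).and (eventually_ge_atTop x)
  obtain ⟨y, hy, hxy⟩ := h1.exists
  have h2 : Ncount p y ≠ 0 := by
    intro h; rw [h] at hy; simp at hy
  have h3 : Finite {α : ℕ →₀ ℕ // nval p α ≤ y} := (Nat.card_ne_zero.1 h2).2
  have h4 : {α : ℕ →₀ ℕ | nval p α ≤ y}.Finite := h3
  exact h4.subset fun α hα => le_trans hα hxy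

lemma Ncount_eq {p : ℕ → ℝ} (hf : ∀ x, {α : ℕ →₀ ℕ | nval p α ≤ x}.Finite) (x : ℝ) :
    Ncount p x = (hf x).toFinset.card := by
  unfold Ncount
  exact Nat.card_eq_card_finite_toFinset (hf x)

lemma mB_eq {p : ℕ → ℝ} (hf : ∀ x, {α : ℕ →₀ ℕ | nval p α ≤ x}.Finite) (x : ℝ) :
    mB p x = ∑ α ∈ (hf x).toFinset, muB α / nval p α := by
  unfold mB
  rw [← Finset.tsum_subtype]
  refine ((Equiv.subtypeEquivRight (fun α => ?_)).tsum_eq (fun α : {α // α ∈ (hf x).toFinset} => muB α / nval p α))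
  simp

lemma Ncount_mono {p : ℕ → ℝ} (hf : ∀ x, {α : ℕ →₀ ℕ | nval p α ≤ x}.Finite) :
    Monotone (Ncount p) := by
  intro x y hxy
  rw [Ncount_eq hf, Ncount_eq hf]
  refine Finset.card_le_card ?_
  intro α; simp; intro h; exact h.trans hxy

lemma abs_muB_le (α : ℕ →₀ ℕ) : |muB α| ≤ 1 := by
  unfold muB; split_ifs <;> simp

lemma mB_diff {p : ℕ → ℝ} (hp : ∀ k, 1 < p k)
    (hf : ∀ x, {α : ℕ →₀ ℕ | nval p α ≤ x}.Finite) {x y : ℝ} (hx : 0 < x) (hxy : x ≤ y) :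
    |mB p y - mB p x| ≤ ((Ncount p y : ℝ) - Ncount p x) / x := by
  have hsub : (hf x).toFinset ⊆ (hf y).toFinset := by
    intro α; simp; intro h; exact h.trans hxy
  rw [mB_eq hf, mB_eq hf, Ncount_eq hf, Ncount_eq hf, ← Finset.sum_sdiff hsub, add_sub_cancel_right]
  have hc : ((hf y).toFinset.card : ℝ) - (hf x).toFinset.card = ((hf y).toFinset \ (hf x).toFinset).card := by
    rw [Finset.card_sdiff_of_subset hsub, Nat.cast_sub (Finset.card_le_card hsub)]
  rw [hc]
  refine (Finset.abs_sum_le_sum_abs _ _).trans ?_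
  have : ∀ α ∈ (hf y).toFinset \ (hf x).toFinset, |muB α / nval p α| ≤ 1 / x := by
    intro α hα
    simp at hα
    have h1 := one_le_nval hp α
    rw [abs_div, abs_of_pos (by linarith : 0 < nval p α)]
    exact div_le_div₀ zero_le_one (abs_muB_le α) hx hα.2.le
  refine (Finset.sum_le_card_nsmul _ _ _ this).trans ?_
  rw [nsmul_eq_mul, mul_one_div]

lemma Ncount_bound {p : ℕ → ℝ} (hp : ∀ k, 1 < p k) {a : ℝ} (ha : 0 < a)
    (hN : Tendsto (fun x : ℝ => (Ncount p x : ℝ) / x) atTop (𝓝 a)) :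
    ∃ C : ℝ, 0 < C ∧ ∀ x : ℝ, 0 < x → (Ncount p x : ℝ) ≤ C * x := by
  have hf := fin_nval ha hN
  have h1 := (hN.eventually_lt_const (show a < a + 1 by linarith)).and (eventually_ge_atTop 1)
  obtain ⟨X, hX⟩ := eventually_atTop.1 h1
  have hX1 := (hX X le_rfl).2
  refine ⟨(a+1) * X, by positivity, fun x hx => ?_⟩
  have key : ∀ y ≥ X, (Ncount p y : ℝ) ≤ (a+1) * y := by
    intro y hy
    have hy1 := (hX y hy)
    have : 0 < y := by linarith
    exact ((div_lt_iff₀ this).1 hy1.1).le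
  rcases lt_or_ge x 1 with h | h
  · have : Ncount p x = 0 := by
      rw [Ncount_eq hf, Finset.card_eq_zero]
      ext α; simp; exact h.trans_le (one_le_nval hp α)
    rw [this]; simp; positivity
  · rcases le_total X x with h2 | h2
    · refine (key x h2).trans ?_
      nlinarith [mul_nonneg (mul_nonneg (by linarith : 0 ≤ a + 1) (by linarith : 0 ≤ X - 1)) hx.le]
    · have h3 : (Ncount p x : ℝ) ≤ Ncount p X := by exact_mod_cast Ncount_mono hf h2
      refine (h3.trans (key X le_rfl)).trans ?_
      nlinarith [mul_nonneg (mul_nonneg (by linarith : 0 ≤ a + 1) (by linarith : 0 ≤ X)) (by linarith : 0 ≤ x - 1)]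

lemma summable_nval {p : ℕ → ℝ} (hp : ∀ k, 1 < p k) {C : ℝ} (hC : 0 < C)
    (hf : ∀ x, {α : ℕ →₀ ℕ | nval p α ≤ x}.Finite)
    (hb : ∀ x : ℝ, 0 < x → (Ncount p x : ℝ) ≤ C * x) {σ : ℝ} (hσ : 1 < σ) :
    Summable (fun α : ℕ →₀ ℕ => nval p α ^ (-σ)) := by
  let q : (ℕ →₀ ℕ) → ℕ := fun α => ⌊Real.log (nval p α)⌋₊
  have hn : ∀ α, 0 < nval p α := fun α => zero_lt_one.trans_le (one_le_nval hp α)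
  have hq1 : ∀ α, Real.exp (q α) ≤ nval p α := by
    intro α
    rw [← Real.le_log_iff_exp_le (hn α)]
    exact Nat.floor_le (Real.log_nonneg (one_le_nval hp α))
  have hq2 : ∀ α, nval p α ≤ Real.exp (q α + 1) := by
    intro α
    rw [← Real.log_le_iff_le_exp (hn α)]
    exact (Nat.lt_floor_add_one _).le
  rw [← (Equiv.sigmaFiberEquiv q).summable_iff]
  have hfin : ∀ k, Finite {α // q α = k} := by
    intro k
    have h : {α | q α = k}.Finite := by
      refine (hf (Real.exp (k+1))).subset ?_
      intro α hα
      have hα : q α = k := hα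
      have := hq2 α
      rw [hα] at this; exact this
    exact h
  refine (summable_sigma_of_nonneg (fun x => Real.rpow_nonneg (hn _).le _)).2 ⟨fun k => ?_, ?_⟩
  · have := hfin k
    exact Summable.of_finite
  · have hgeo : Summable (fun k : ℕ => C * Real.exp 1 * (Real.exp (1 - σ)) ^ k) :=
      (summable_geometric_of_lt_one (Real.exp_pos _).le (by rw [Real.exp_lt_one_iff]; linarith)).mul_left _
    refine Summable.of_nonneg_of_le (fun k => tsum_nonneg fun x => Real.rpow_nonneg (hn _).le _) (fun k => ?_) hgeo
    have := hfin k
    have := Fintype.ofFinite {α // q α = k}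
    rw [tsum_fintype]
    have hle : ∀ x ∈ (Finset.univ : Finset {α // q α = k}),
        ((fun α : ℕ →₀ ℕ => nval p α ^ (-σ)) ∘ (Equiv.sigmaFiberEquiv q)) ⟨k, x⟩ ≤ Real.exp (-(σ * k)) := by
      intro x _
      have h1 := hq1 x
      rw [x.2] at h1
      have : Real.exp (-(σ * k)) = (Real.exp k) ^ (-σ) := by
        rw [← Real.exp_mul]; congr 1; ring
      rw [this]
      exact Real.rpow_le_rpow_of_nonpos (Real.exp_pos _) h1 (by linarith)
    refine (Finset.sum_le_card_nsmul _ _ _ hle).trans ?_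
    have hcard : (Finset.univ : Finset {α // q α = k}).card ≤ Ncount p (Real.exp (k+1)) := by
      rw [Finset.card_univ, ← Nat.card_eq_fintype_card]
      unfold Ncount
      have : Finite {α // nval p α ≤ Real.exp (k+1)} := hf _
      refine Nat.card_le_card_of_injective (fun x : {α // q α = k} => (⟨x.1, ?_⟩ : {α // nval p α ≤ Real.exp (k+1)})) ?_
      · have := hq2 x.1
        rw [x.2] at this; exact this
      · intro x y h
        simpa [Subtype.ext_iff] using h
    have hcard' : ((Finset.univ : Finset {α // q α = k}).card : ℝ) ≤ C * Real.exp (k+1) :=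
      le_trans (by exact_mod_cast hcard) (hb _ (Real.exp_pos _))
    rw [nsmul_eq_mul]
    calc _ ≤ C * Real.exp (k+1) * Real.exp (-(σ * k)) := by gcongr
      _ = _ := by
        rw [← Real.exp_nat_mul, mul_assoc, mul_assoc, ← Real.exp_add, ← Real.exp_add]
        congr 2; ring

noncomputable def toF (S : Finset ℕ) : ℕ →₀ ℕ := Finsupp.indicator S (fun _ _ => 1)

lemma toF_apply (S : Finset ℕ) (k : ℕ) : toF S k = if k ∈ S then 1 else 0 := by
  unfold toF; simp [Finsupp.indicator_apply]

lemma toF_support (S : Finset ℕ) : (toF S).support = S := by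
  ext k; simp [toF_apply]

lemma toF_inj : Function.Injective toF := by
  intro S T h
  rw [← toF_support S, h, toF_support]

lemma muB_toF (S : Finset ℕ) : muB (toF S) = (-1) ^ S.card := by
  unfold muB
  rw [if_pos, toF_support]
  intro k; rw [toF_apply]; split_ifs <;> simp

lemma nval_toF (p : ℕ → ℝ) (S : Finset ℕ) : nval p (toF S) = ∏ k ∈ S, p k := by
  unfold nval Finsupp.prod
  rw [toF_support]
  refine Finset.prod_congr rfl fun k hk => ?_
  rw [toF_apply, if_pos hk]; simp

lemma muB_support : Function.support muB ⊆ Set.range toF := by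
  intro α hα
  have h : ∀ k, α k ≤ 1 := by
    by_contra hc
    apply hα
    unfold muB; rw [if_neg hc]
  refine ⟨α.support, ?_⟩
  ext k
  rw [toF_apply]
  have := h k
  split_ifs with hk
  · rw [Finsupp.mem_support_iff] at hk; omega
  · rw [Finsupp.notMem_support_iff] at hk; exact hk.symm

lemma prod_cpow {p : ℕ → ℝ} (hp : ∀ k, 1 < p k) (S : Finset ℕ) (s : ℂ) :
    (((∏ k ∈ S, p k : ℝ) : ℂ)) ^ s = ∏ k ∈ S, (p k : ℂ) ^ s := by
  induction S using Finset.induction_on with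
  | empty => simp
  | insert k S hk ih =>
    rw [Finset.prod_insert hk, Finset.prod_insert hk, ← ih, Complex.ofReal_mul,
      Complex.mul_cpow_ofReal_nonneg (by linarith [hp k])
        (Finset.prod_nonneg fun i _ => by linarith [hp i])]

lemma euler_s5 {p : ℕ → ℝ} (hmono : Monotone p) (hp : ∀ k, 1 < p k) {s : ℂ} (hs : 1 < s.re)
    (hsum : Summable (fun α : ℕ →₀ ℕ => nval p α ^ (-s.re))) :
    ∑' α : ℕ →₀ ℕ, (muB α : ℂ) * (nval p α : ℂ) ^ (-s) = Complex.exp (-logZeta p s) := by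
  have hp0 : ∀ k, 0 < p k := fun k => zero_lt_one.trans (hp k)
  have hzn : ∀ k, ‖(p k : ℂ) ^ (-s)‖ = p k ^ (-s.re) := by
    intro k
    rw [Complex.norm_cpow_eq_rpow_re_of_pos (hp0 k)]; simp
  have hps : Summable (fun k => ‖(p k : ℂ) ^ (-s)‖) := by
    have h := hsum.comp_injective (i := fun k : ℕ => (Finsupp.single k 1 : ℕ →₀ ℕ))
      (Finsupp.single_left_injective one_ne_zero)
    refine h.congr fun k => ?_
    rw [hzn]
    simp [nval]
  set z : ℕ → ℂ := fun k => (p k : ℂ) ^ (-s) with hz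
  set r : ℝ := p 0 ^ (-s.re) with hr
  have hr0 : 0 ≤ r := Real.rpow_nonneg (hp0 0).le _
  have hr1 : r < 1 := Real.rpow_lt_one_of_one_lt_of_neg (hp 0) (by linarith)
  have hzr : ∀ k, ‖z k‖ ≤ r := by
    intro k
    rw [hz]; simp only; rw [hzn]
    exact Real.rpow_le_rpow_of_nonpos (hp0 0) (hmono (Nat.zero_le k)) (by linarith)
  have hz1 : ∀ k, ‖z k‖ < 1 := fun k => (hzr k).trans_lt hr1
  -- logZeta
  have hlog : logZeta p s = ∑' k, -Complex.log (1 - z k) := by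
    unfold logZeta
    have e1 : ∀ j k : ℕ, ((p k : ℂ) ^ (-s * (j + 1))) / (j + 1) = z k ^ (j+1) / ((j:ℂ)+1) := by
      intro j k
      have : (-s * ((j:ℂ) + 1)) = -s * ((j + 1 : ℕ) : ℂ) := by push_cast; ring
      rw [this, Complex.cpow_mul_nat]
    simp_rw [e1]
    have hs2 : Summable (Function.uncurry fun (k j : ℕ) => z k ^ (j+1) / ((j:ℂ)+1)) := by
      have hg : Summable (fun x : ℕ × ℕ => ‖z x.1‖ * r ^ x.2) :=
        hps.mul_of_nonneg (summable_geometric_of_lt_one hr0 hr1) (fun k => norm_nonneg _)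
          (fun j => pow_nonneg hr0 j)
      refine Summable.of_norm_bounded hg ?_
      rintro ⟨k, j⟩
      simp only [Function.uncurry]
      have h1 : (1:ℝ) ≤ ‖(j:ℂ) + 1‖ := by
        have : (j:ℂ) + 1 = ((j + 1 : ℕ) : ℂ) := by push_cast; ring
        rw [this, Complex.norm_natCast]; simp
      rw [norm_div, norm_pow, pow_succ']
      refine (div_le_self (by positivity) h1).trans ?_
      gcongr
      exact hzr k
    rw [Summable.tsum_comm hs2]
    refine tsum_congr fun k => ?_
    have h := Complex.hasSum_taylorSeries_neg_log (hz1 k)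
    rw [← hasSum_nat_add_iff' 1] at h
    simpa using h.tsum_eq
  have hexp : Complex.exp (-logZeta p s) = ∏' k, (1 + -z k) := by
    rw [hlog, ← tsum_neg]
    simp only [neg_neg, ← sub_eq_add_neg]
    refine Complex.cexp_tsum_eq_tprod (f := fun k => 1 - z k) ?_ ?_
    · intro k h
      have : z k = 1 := (sub_eq_zero.1 h).symm
      have h2 := hz1 k
      rw [this] at h2; simp at h2
    · have := Complex.summable_log_one_add_of_summable (f := fun k => -z k) hps.of_norm.neg
      simpa [sub_eq_add_neg] using this
  rw [hexp, tprod_one_add (summable_finsetProd_of_summable_norm (by simpa using hps))]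
  rw [← toF_inj.tsum_eq]
  · refine tsum_congr fun S => ?_
    rw [muB_toF, nval_toF, prod_cpow hp, Finset.prod_neg]
    push_cast; rfl
  · intro α hα
    apply muB_support
    intro h
    apply hα
    simp [h]

lemma mB_increment {p : ℕ → ℝ} (hp : ∀ k, 1 < p k)
    (hf : ∀ x, {α : ℕ →₀ ℕ | nval p α ≤ x}.Finite) {C : ℝ} (hC : 0 < C)
    (hb : ∀ x : ℝ, 0 < x → (Ncount p x : ℝ) ≤ C * x) (n : ℕ) :
    ∀ u d : ℝ, 0 ≤ d → d ≤ n →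
      |mB p (Real.exp (u + d)) - mB p (Real.exp u)| ≤ C * Real.exp 1 * n := by
  induction n with
  | zero =>
    intro u d h0 h1
    have : d = 0 := le_antisymm (by simpa using h1) h0
    simp [this]
  | succ n ih =>
    intro u d h0 h1
    have step : ∀ v e : ℝ, 0 ≤ e → e ≤ 1 →
        |mB p (Real.exp (v + e)) - mB p (Real.exp v)| ≤ C * Real.exp 1 := by
      intro v e he0 he1
      refine (mB_diff hp hf (Real.exp_pos v) (Real.exp_le_exp.2 (by linarith))).trans ?_
      rw [div_le_iff₀ (Real.exp_pos v)]
      have h2 := hb (Real.exp (v + e)) (Real.exp_pos _)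
      have h3 : Real.exp (v + e) ≤ Real.exp 1 * Real.exp v := by
        rw [← Real.exp_add]; exact Real.exp_le_exp.2 (by linarith)
      have h4 : (0:ℝ) ≤ Ncount p (Real.exp v) := Nat.cast_nonneg _
      nlinarith
    have hE : 0 ≤ C * Real.exp 1 := by positivity
    push_cast at h1 ⊢
    rcases le_total d 1 with hd | hd
    · refine (step u d h0 hd).trans ?_
      have : (0:ℝ) ≤ n := Nat.cast_nonneg _
      nlinarith
    · have h5 := ih (u + 1) (d - 1) (by linarith) (by linarith)
      have h6 := step u 1 zero_le_one le_rfl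
      have e : u + 1 + (d - 1) = u + d := by ring
      rw [e] at h5
      have h7 := abs_sub_le (mB p (Real.exp (u + d))) (mB p (Real.exp (u + 1))) (mB p (Real.exp u))
      linarith

lemma mB_lin {p : ℕ → ℝ} (hp : ∀ k, 1 < p k)
    (hf : ∀ x, {α : ℕ →₀ ℕ | nval p α ≤ x}.Finite) {C : ℝ} (hC : 0 < C)
    (hb : ∀ x : ℝ, 0 < x → (Ncount p x : ℝ) ≤ C * x) (u w : ℝ) :
    |mB p (Real.exp w) - mB p (Real.exp u)| ≤ C * Real.exp 1 * (1 + |w - u|) := by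
  have main : ∀ u w : ℝ, u ≤ w →
      |mB p (Real.exp w) - mB p (Real.exp u)| ≤ C * Real.exp 1 * (1 + |w - u|) := by
    intro u w h
    have h1 := mB_increment hp hf hC hb ⌈w - u⌉₊ u (w - u) (by linarith) (Nat.le_ceil _)
    rw [add_sub_cancel] at h1
    refine h1.trans ?_
    gcongr
    rw [abs_of_nonneg (by linarith)]
    linarith [Nat.ceil_lt_add_one (show 0 ≤ w - u by linarith)]
  rcases le_total u w with h | h
  · exact main u w h
  · rw [abs_sub_comm, abs_sub_comm w u]; exact main w u h

lemma mB_slow {p : ℕ → ℝ} (hp : ∀ k, 1 < p k)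
    (hf : ∀ x, {α : ℕ →₀ ℕ | nval p α ≤ x}.Finite) {a : ℝ} (ha : 0 < a)
    (hN : Tendsto (fun x : ℝ => (Ncount p x : ℝ) / x) atTop (𝓝 a)) (ε : ℝ) (hε : 0 < ε) :
    ∃ δ > 0, ∃ u₀ : ℝ, ∀ u ≥ u₀, ∀ w, |w - u| ≤ δ →
      |mB p (Real.exp w) - mB p (Real.exp u)| ≤ ε := by
  obtain ⟨δ, hδ, hδε⟩ : ∃ δ > 0, a * (Real.exp δ - 1) < ε := by
    have hc : Continuous (fun d : ℝ => a * (Real.exp d - 1)) := by fun_prop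
    have h1 : Tendsto (fun d : ℝ => a * (Real.exp d - 1)) (𝓝[>] 0) (𝓝 0) := by
      have := (hc.tendsto 0).mono_left (nhdsWithin_le_nhds (s := Ioi 0))
      simpa using this
    obtain ⟨d, hd, hd2⟩ := ((h1.eventually_lt_const hε).and self_mem_nhdsWithin).exists
    exact ⟨d, hd2, hd⟩
  have hT : Tendsto (fun u : ℝ => Real.exp δ * ((Ncount p (Real.exp (u + δ)) : ℝ) / Real.exp (u + δ))
      - (Ncount p (Real.exp u) : ℝ) / Real.exp u) atTop (𝓝 (Real.exp δ * a - a)) := by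
    have t1 := hN.comp Real.tendsto_exp_atTop
    have t2 := t1.comp (tendsto_atTop_add_const_right atTop δ tendsto_id)
    exact (t2.const_mul (Real.exp δ)).sub t1
  have hev := hT.eventually_lt_const (show Real.exp δ * a - a < ε by linarith)
  obtain ⟨u₁, hu₁⟩ := eventually_atTop.1 hev
  have main : ∀ u ≥ u₁, ∀ w, u ≤ w → w ≤ u + δ →
      |mB p (Real.exp w) - mB p (Real.exp u)| ≤ ε := by
    intro u hu w h1 h2
    refine (mB_diff hp hf (Real.exp_pos u) (Real.exp_le_exp.2 h1)).trans ?_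
    have h3 := (hu₁ u hu).le
    have h4 : (Ncount p (Real.exp w) : ℝ) ≤ Ncount p (Real.exp (u + δ)) := by
      exact_mod_cast Ncount_mono hf (Real.exp_le_exp.2 h2)
    refine le_trans ?_ h3
    rw [sub_div]
    gcongr
    rw [div_le_iff₀ (Real.exp_pos u), Real.exp_add]
    have := (Real.exp_pos u).ne'
    have := (Real.exp_pos δ).ne'
    field_simp
    rw [← Real.exp_add, add_comm δ u]
    exact h4
  refine ⟨δ, hδ, u₁ + δ, fun u hu w hw => ?_⟩
  rw [abs_le] at hw
  rcases le_total u w with h | h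
  · exact main u (by linarith) w h (by linarith)
  · rw [abs_sub_comm]
    exact main w (by linarith) u h (by linarith)

lemma mB_tsum {p : ℕ → ℝ} (hp : ∀ k, 1 < p k) (u : ℝ) :
    mB p (Real.exp u) =
      ∑' α : ℕ →₀ ℕ, (Ici (Real.log (nval p α))).indicator (fun _ => muB α / nval p α) u := by
  unfold mB
  have h := tsum_subtype {α : ℕ →₀ ℕ | nval p α ≤ Real.exp u} (fun α => muB α / nval p α)
  refine h.trans (tsum_congr fun α => ?_)
  have hn : 0 < nval p α := zero_lt_one.trans_le (one_le_nval hp α)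
  simp only [indicator_apply, mem_ofPred_eq, mem_Ici, Real.log_le_iff_le_exp hn]

lemma laplace {p : ℕ → ℝ} (hp : ∀ k, 1 < p k)
    (hsum : ∀ σ : ℝ, 1 < σ → Summable (fun α : ℕ →₀ ℕ => nval p α ^ (-σ)))
    (z : ℂ) (hz : 0 < z.re) :
    ∫ u : ℝ, ((mB p (Real.exp u) : ℝ) : ℂ) * Complex.exp (-z * u) =
      (∑' α : ℕ →₀ ℕ, (muB α : ℂ) * (nval p α : ℂ) ^ (-(1 + z))) / z := by
  have hn : ∀ α, 0 < nval p α := fun α => zero_lt_one.trans_le (one_le_nval hp α)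
  let F : (ℕ →₀ ℕ) → ℝ → ℂ := fun α =>
    (Ici (Real.log (nval p α))).indicator (fun u : ℝ => ((muB α / nval p α : ℝ) : ℂ) * Complex.exp (-z * u))
  have hF : ∀ u : ℝ, ((mB p (Real.exp u) : ℝ) : ℂ) * Complex.exp (-z * u) = ∑' α, F α u := by
    intro u
    rw [mB_tsum hp, Complex.ofReal_tsum, ← tsum_mul_right]
    refine tsum_congr fun α => ?_
    simp only [F, indicator_apply]
    split_ifs <;> simp
  have hFi : ∀ α, Integrable (F α) := by
    intro α
    rw [integrable_indicator_iff measurableSet_Ici, integrableOn_Ici_iff_integrableOn_Ioi]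
    exact (integrableOn_exp_mul_complex_Ioi (by simpa using hz) _).const_mul _
  have hFI : ∀ α, ∫ u, F α u = ((muB α : ℂ) * (nval p α : ℂ) ^ (-(1 + z))) / z := by
    intro α
    have hc : (nval p α : ℂ) ≠ 0 := by exact_mod_cast (hn α).ne'
    have hz0 : z ≠ 0 := by rintro rfl; simp at hz
    simp only [F]
    rw [integral_indicator measurableSet_Ici, integral_Ici_eq_integral_Ioi, integral_const_mul,
      integral_exp_mul_complex_Ioi (by simpa using hz), neg_add, Complex.cpow_add _ _ hc,
      Complex.cpow_neg_one, Complex.cpow_def_of_ne_zero hc, Complex.ofReal_log (hn α).le,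
      neg_div_neg_eq, mul_comm (Complex.log _)]
    push_cast
    ring
  have hFn : ∀ α, ∫ u, ‖F α u‖ = |muB α| * nval p α ^ (-(1 + z.re)) / z.re := by
    intro α
    have e : ∀ u, ‖F α u‖ = (Ici (Real.log (nval p α))).indicator
        (fun u : ℝ => |muB α| / nval p α * Real.exp (-z.re * u)) u := by
      intro u
      simp only [F, indicator_apply]
      split_ifs
      · rw [norm_mul, Complex.norm_real, Complex.norm_exp, Real.norm_eq_abs, abs_div, abs_of_pos (hn α)]
        simp
      · simp
    simp_rw [e]
    rw [integral_indicator measurableSet_Ici, integral_Ici_eq_integral_Ioi, integral_const_mul,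
      integral_exp_mul_Ioi (by simpa using hz), neg_add, Real.rpow_add (hn α), Real.rpow_neg_one,
      Real.rpow_def_of_pos (hn α), neg_div_neg_eq, mul_comm (Real.log _)]
    ring
  have hS : Summable (fun α => ∫ u, ‖F α u‖) := by
    simp_rw [hFn]
    refine Summable.div_const ?_ _
    refine Summable.of_nonneg_of_le (fun α => ?_) (fun α => ?_) (hsum (1 + z.re) (by linarith))
    · exact mul_nonneg (abs_nonneg _) (Real.rpow_nonneg (hn α).le _)
    · exact mul_le_of_le_one_left (Real.rpow_nonneg (hn α).le _) (abs_muB_le α)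
  have h := (hasSum_integral_of_summable_integral_norm hFi hS).tsum_eq
  simp_rw [hF]
  rw [← h]
  simp_rw [hFI]
  rw [tsum_div_const]

theorem stmt_5 (p : ℕ → ℝ) (hmono : Monotone p) (hp1 : 1 < p 0)
    (hptop : Tendsto p atTop atTop)
    (a : ℝ) (ha : 0 < a)
    (hN : Tendsto (fun x : ℝ => (Ncount p x : ℝ) / x) atTop (𝓝 a))
    (hcont : ∃ h : ℂ → ℂ, ContinuousOn h {s : ℂ | 1 ≤ s.re} ∧
      ∀ s : ℂ, 1 < s.re → h s = logZeta p s + Complex.log (s - 1)) :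
    Tendsto (mB p) atTop (𝓝 0) := by
  obtain ⟨h, hc, hh⟩ := hcont
  have hp := p_gt_one hmono hp1
  have hf := fin_nval ha hN
  obtain ⟨C, hC, hb⟩ := Ncount_bound hp ha hN
  have hsum : ∀ σ : ℝ, 1 < σ → Summable (fun α : ℕ →₀ ℕ => nval p α ^ (-σ)) :=
    fun σ hσ => summable_nval hp hC hf hb hσ
  have hmeas : Measurable (fun u : ℝ => mB p (Real.exp u)) := by
    simp_rw [mB_tsum hp]
    refine Measurable.tsum fun α => ?_
    exact measurable_const.indicator measurableSet_Ici
  have hT := tauber_B (fun u => ((mB p (Real.exp u) : ℝ) : ℂ))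
    (Complex.measurable_ofReal.comp hmeas) (C * Real.exp 1) (by positivity)
    (by
      intro u w
      rw [← Complex.ofReal_sub, Complex.norm_real]
      exact mB_lin hp hf hC hb u w)
    (by
      intro u hu
      have : mB p (Real.exp u) = 0 := by
        rw [mB_eq hf]
        refine Finset.sum_eq_zero fun α hα => ?_
        simp at hα
        have h1 := one_le_nval hp α
        have h2 : Real.exp u < 1 := by rw [Real.exp_lt_one_iff]; exact hu
        linarith
      simp [this])
    (by
      intro ε hε
      obtain ⟨δ, hδ, u₀, H⟩ := mB_slow hp hf ha hN ε hε
      refine ⟨δ, hδ, u₀, fun u hu w hw => ?_⟩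
      rw [← Complex.ofReal_sub, Complex.norm_real]
      exact H u hu w hw)
    (fun z => Complex.exp (-h (1 + z)))
    (by
      refine Complex.continuous_exp.comp_continuousOn (ContinuousOn.neg (hc.comp (by fun_prop) ?_))
      intro z hz
      have hz : 0 ≤ z.re := hz
      simpa using hz)
    (by
      intro z hz
      have hs : 1 < (1 + z).re := by simpa using hz
      have hz0 : z ≠ 0 := by rintro rfl; simp at hz
      rw [laplace hp hsum z hz, euler_s5 hmono hp hs (hsum _ hs), hh _ hs, add_sub_cancel_left,
        neg_add, Complex.exp_add, Complex.exp_neg (Complex.log z), Complex.exp_log hz0, div_eq_mul_inv])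
  have hR : Tendsto (fun u : ℝ => mB p (Real.exp u)) atTop (𝓝 0) := by
    have := (Complex.continuous_re.tendsto 0).comp hT
    simpa [Function.comp_def] using this
  have hlog := hR.comp Real.tendsto_log_atTop
  refine hlog.congr' ?_
  filter_upwards [eventually_gt_atTop 0] with x hx
  simp [Real.exp_log hx]
end
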